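/- Let n ≥ 4 be an integer and let p be a real number with 2n/(n−1) ≤ p < n. Then for every smooth function u : ℝⁿ → ℝ with compact support contained in the open unit ball Bⁿ, one has ∫_{Bⁿ} ((1−|x|²)/2)^p |∇u(x)|^p (2/(1−|x|²))^n dx − ((n−1)/p)^p ∫_{Bⁿ} |u(x)|^p (2/(1−|x|²))^n dx ≥ S(n,p)^p ( ∫_{Bⁿ} |u(x)|^{np/(n−p)} (2/(1−|x|²))^n dx )^{(n−p)/n}. -/

import Mathlib

open Real MeasureTheory

/-- Volume of the Euclidean unit ball in `ℝⁿ`. -/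
noncomputable def unitBallVol (n : ℕ) : ℝ := π ^ ((n : ℝ) / 2) / Real.Gamma ((n : ℝ) / 2 + 1)

/-- The sharp constant `S(n,p)` in the `Lᵖ` Sobolev inequality in `ℝⁿ`. -/
noncomputable def sobolevConst (n : ℕ) (p : ℝ) : ℝ :=
  ((1 / (n : ℝ)) * (((n : ℝ) * (p - 1)) / ((n : ℝ) - p)) ^ (1 - 1 / p) *
    (Real.Gamma (n : ℝ) /
      (Real.Gamma ((n : ℝ) / p) * Real.Gamma ((n : ℝ) + 1 - (n : ℝ) / p) * unitBallVol n)) ^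
        (1 / (n : ℝ)))⁻¹

section Reflection

variable {E : Type*} [NormedAddCommGroup E]

/-- The hyperbolic reflection of the unit ball given by the inversion centred at `c` (with
`1 < ‖c‖`) whose sphere is orthogonal to the unit sphere. -/
noncomputable def hypRefl [InnerProductSpace ℝ E] (c : E) : E → E :=
  EuclideanGeometry.inversion c (√(‖c‖ ^ 2 - 1))

/-- The conformal factor of `hypRefl c` at `x`. -/
noncomputable def reflFactor (c x : E) : ℝ := (‖c‖ ^ 2 - 1) / ‖x - c‖ ^ 2

/-- `x` and `y` are at hyperbolic distance less than `2 * arsinh ε`. -/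
def HypNear (ε : ℝ) (x y : E) : Prop :=
  ‖x - y‖ ^ 2 < ε ^ 2 * ((1 - ‖x‖ ^ 2) * (1 - ‖y‖ ^ 2))

lemma HypNear.symm {ε : ℝ} {x y : E} (h : HypNear ε x y) : HypNear ε y x := by
  unfold HypNear at *
  rw [norm_sub_rev, mul_comm (1 - ‖y‖ ^ 2)]
  exact h

lemma norm_center_sq_pos {c : E} (hc : 1 < ‖c‖) : 0 < ‖c‖ ^ 2 - 1 := by nlinarith

lemma ne_center {c x : E} (hc : 1 < ‖c‖) (hx : ‖x‖ < 1) : x ≠ c := by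
  rintro rfl; linarith

lemma reflFactor_pos {c x : E} (hc : 1 < ‖c‖) (hx : ‖x‖ < 1) : 0 < reflFactor c x :=
  div_pos (norm_center_sq_pos hc) (pow_pos (norm_pos_iff.2 (sub_ne_zero.2 (ne_center hc hx))) 2)

lemma reflFactor_mul {c x : E} (hc : 1 < ‖c‖) (hx : ‖x‖ < 1) :
    reflFactor c x * ‖x - c‖ ^ 2 = ‖c‖ ^ 2 - 1 :=
  div_mul_cancel₀ _ (pow_pos (norm_pos_iff.2 (sub_ne_zero.2 (ne_center hc hx))) 2).ne'

variable [InnerProductSpace ℝ E]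

lemma hypRefl_apply {c : E} (hc : 1 < ‖c‖) (x : E) :
    hypRefl c x = c + reflFactor c x • (x - c) := by
  simp only [hypRefl, EuclideanGeometry.inversion, reflFactor, div_pow,
    Real.sq_sqrt (norm_center_sq_pos hc).le, dist_eq_norm, vsub_eq_sub, vadd_eq_add]
  rw [add_comm]

lemma hypRefl_hypRefl {c : E} (hc : 1 < ‖c‖) (x : E) : hypRefl c (hypRefl c x) = x :=
  EuclideanGeometry.inversion_inversion c
    (Real.sqrt_pos.2 (norm_center_sq_pos hc)).ne' x

lemma one_sub_norm_hypRefl_sq {c x : E} (hc : 1 < ‖c‖) (hx : ‖x‖ < 1) :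
    1 - ‖hypRefl c x‖ ^ 2 = reflFactor c x * (1 - ‖x‖ ^ 2) := by
  have h1 := reflFactor_mul hc hx
  have h2 : ‖x‖ ^ 2 = ‖c‖ ^ 2 + 2 * inner ℝ c (x - c) + ‖x - c‖ ^ 2 := by
    rw [← norm_add_sq_real]; simp
  rw [hypRefl_apply hc, norm_add_sq_real, inner_smul_right, norm_smul, mul_pow, h2,
    Real.norm_eq_abs, sq_abs]
  linear_combination (1 - reflFactor c x) * h1

lemma norm_hypRefl_lt_one {c x : E} (hc : 1 < ‖c‖) (hx : ‖x‖ < 1) : ‖hypRefl c x‖ < 1 := by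
  have h := one_sub_norm_hypRefl_sq hc hx
  have h2 : 0 < reflFactor c x * (1 - ‖x‖ ^ 2) :=
    mul_pos (reflFactor_pos hc hx) (by nlinarith [norm_nonneg x])
  nlinarith [norm_nonneg (hypRefl c x)]

lemma norm_hypRefl_sub_sq {c x y : E} (hc : 1 < ‖c‖) (hx : ‖x‖ < 1) (hy : ‖y‖ < 1) :
    ‖hypRefl c x - hypRefl c y‖ ^ 2 = reflFactor c x * reflFactor c y * ‖x - y‖ ^ 2 := by
  rw [← dist_eq_norm, hypRefl,
    EuclideanGeometry.dist_inversion_inversion (ne_center hc hx) (ne_center hc hy),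
    Real.sq_sqrt (norm_center_sq_pos hc).le, dist_eq_norm, dist_eq_norm, dist_eq_norm]
  simp only [reflFactor]
  have := norm_pos_iff.2 (sub_ne_zero.2 (ne_center hc hx))
  have := norm_pos_iff.2 (sub_ne_zero.2 (ne_center hc hy))
  field_simp

lemma reflFactor_hypRefl {c x : E} (hc : 1 < ‖c‖) (hx : ‖x‖ < 1) :
    reflFactor c (hypRefl c x) * reflFactor c x = 1 := by
  have h1 := one_sub_norm_hypRefl_sq hc hx
  have h2 := one_sub_norm_hypRefl_sq hc (norm_hypRefl_lt_one hc hx)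
  rw [hypRefl_hypRefl hc, h1, ← mul_assoc] at h2
  have h3 : 1 - ‖x‖ ^ 2 ≠ 0 := by nlinarith [norm_nonneg x]
  exact (mul_right_cancel₀ h3 (by linarith))

lemma hypNear_hypRefl {ε : ℝ} {c x y : E} (hc : 1 < ‖c‖) (hx : ‖x‖ < 1) (hy : ‖y‖ < 1)
    (h : HypNear ε x y) : HypNear ε (hypRefl c x) (hypRefl c y) := by
  unfold HypNear at *
  rw [norm_hypRefl_sub_sq hc hx hy, one_sub_norm_hypRefl_sq hc hx, one_sub_norm_hypRefl_sq hc hy]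
  have := mul_lt_mul_of_pos_left h (mul_pos (reflFactor_pos hc hx) (reflFactor_pos hc hy))
  linarith

lemma hypNear_of_hypNear_hypRefl {ε : ℝ} {c x y : E} (hc : 1 < ‖c‖) (hx : ‖x‖ < 1)
    (hy : ‖y‖ < 1) (hx' : reflFactor c x ≤ 1) (hy' : reflFactor c y ≤ 1)
    (h : HypNear ε x (hypRefl c y)) : HypNear ε x y := by
  unfold HypNear at *
  rw [one_sub_norm_hypRefl_sq hc hy] at h
  have hl := reflFactor_pos hc hy
  have h1 := reflFactor_mul hc hy
  have h1' := reflFactor_mul hc hx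
  have hX : ‖x - y‖ ^ 2 = ‖x - c‖ ^ 2 - 2 * inner ℝ (x - c) (y - c) + ‖y - c‖ ^ 2 := by
    rw [← norm_sub_sq_real]; simp
  have hY : ‖x - hypRefl c y‖ ^ 2 = ‖x - c‖ ^ 2
      - 2 * (reflFactor c y * inner ℝ (x - c) (y - c))
      + reflFactor c y ^ 2 * ‖y - c‖ ^ 2 := by
    have : x - hypRefl c y = (x - c) - reflFactor c y • (y - c) := by
      rw [hypRefl_apply hc]; abel
    rw [this, norm_sub_sq_real, inner_smul_right, norm_smul, mul_pow, Real.norm_eq_abs, sq_abs]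
  have key : reflFactor c y * ‖x - y‖ ^ 2 ≤ ‖x - hypRefl c y‖ ^ 2 := by
    rw [hX, hY]
    have h3 : ‖c‖ ^ 2 - 1 ≤ ‖x - c‖ ^ 2 := by
      rw [← h1']; exact mul_le_of_le_one_left (by positivity) hx'
    nlinarith
  have : reflFactor c y * ‖x - y‖ ^ 2
      < reflFactor c y * (ε ^ 2 * ((1 - ‖x‖ ^ 2) * (1 - ‖y‖ ^ 2))) := by
    calc _ ≤ _ := key
      _ < _ := h
      _ = _ := by ring
  exact lt_of_mul_lt_mul_left this hl.le

lemma norm_le_norm_hypRefl {c x : E} (hc : 1 < ‖c‖) (hx : ‖x‖ < 1) (h : reflFactor c x ≤ 1) :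
    ‖x‖ ≤ ‖hypRefl c x‖ := by
  have h1 := one_sub_norm_hypRefl_sq hc hx
  have h2 : reflFactor c x * (1 - ‖x‖ ^ 2) ≤ 1 - ‖x‖ ^ 2 :=
    mul_le_of_le_one_left (by nlinarith [norm_nonneg x]) h
  exact (sq_le_sq₀ (norm_nonneg _) (norm_nonneg _)).1 (by linarith)

lemma hypRefl_eq_self {c x : E} (hc : 1 < ‖c‖) (h : reflFactor c x = 1) : hypRefl c x = x := by
  rw [hypRefl_apply hc, h]; simp

/-- Two points of the ball at different distances from the origin are exchanged by a hyperbolic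
reflection. -/
lemma exists_hypRefl_eq {x y : E} (hxy : ‖x‖ < ‖y‖) (hy : ‖y‖ < 1) :
    ∃ c : E, 1 < ‖c‖ ∧ hypRefl c x = y := by
  have hx : ‖x‖ < 1 := hxy.trans hy
  set d : ℝ := ‖y‖ ^ 2 - ‖x‖ ^ 2 with hd
  have hdpos : 0 < d := by nlinarith [norm_nonneg x]
  set c : E := d⁻¹ • ((1 - ‖x‖ ^ 2) • y - (1 - ‖y‖ ^ 2) • x) with hcdef
  have hdc : d • c = (1 - ‖x‖ ^ 2) • y - (1 - ‖y‖ ^ 2) • x := by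
    rw [hcdef, smul_smul, mul_inv_cancel₀ hdpos.ne', one_smul]
  have hxyne : x ≠ y := by rintro rfl; exact lt_irrefl _ hxy
  have hpos : 0 < ‖y - x‖ := norm_pos_iff.2 (sub_ne_zero.2 hxyne.symm)
  have hyc : d • (y - c) = -((1 - ‖y‖ ^ 2) • (y - x)) := by
    rw [smul_sub, hdc, hd]; module
  have hxc : d • (x - c) = -((1 - ‖x‖ ^ 2) • (y - x)) := by
    rw [smul_sub, hdc, hd]; module
  have hsq (a : ℝ) (v w : E) (h : d • v = -(a • w)) : d ^ 2 * ‖v‖ ^ 2 = a ^ 2 * ‖w‖ ^ 2 := by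
    have := congrArg (fun z => ‖z‖ ^ 2) h
    simpa [norm_smul, mul_pow] using this
  have hyx : ‖y - x‖ ^ 2 = ‖y‖ ^ 2 - 2 * inner ℝ y x + ‖x‖ ^ 2 := norm_sub_sq_real y x
  have hcn : d ^ 2 * (‖c‖ ^ 2 - 1) = (1 - ‖x‖ ^ 2) * (1 - ‖y‖ ^ 2) * ‖y - x‖ ^ 2 := by
    have : d ^ 2 * ‖c‖ ^ 2 = ‖d • c‖ ^ 2 := by simp [norm_smul, mul_pow]
    rw [mul_sub, this, hdc, norm_sub_sq_real, norm_smul, norm_smul, inner_smul_left,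
      inner_smul_right, mul_pow, mul_pow, Real.norm_eq_abs, Real.norm_eq_abs, sq_abs, sq_abs, hyx,
      hd]
    simp only [conj_trivial]
    ring
  have hx1 : 0 < 1 - ‖x‖ ^ 2 := by nlinarith [norm_nonneg x]
  have hy1 : 0 < 1 - ‖y‖ ^ 2 := by nlinarith [norm_nonneg y]
  have hc : 1 < ‖c‖ := by
    have h1 : 0 < d ^ 2 * (‖c‖ ^ 2 - 1) := by rw [hcn]; positivity
    have h2 : 0 < ‖c‖ ^ 2 - 1 := pos_of_mul_pos_right h1 (by positivity)
    nlinarith [norm_nonneg c]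
  refine ⟨c, hc, ?_⟩
  have hfac : reflFactor c x = (1 - ‖y‖ ^ 2) / (1 - ‖x‖ ^ 2) := by
    have h1 := reflFactor_mul hc hx
    have h2 := hsq _ _ _ hxc
    rw [eq_div_iff hx1.ne']
    have h3 : (reflFactor c x * (1 - ‖x‖ ^ 2)) * ((1 - ‖x‖ ^ 2) * ‖y - x‖ ^ 2)
        = (1 - ‖y‖ ^ 2) * ((1 - ‖x‖ ^ 2) * ‖y - x‖ ^ 2) := by
      calc _ = reflFactor c x * ((1 - ‖x‖ ^ 2) ^ 2 * ‖y - x‖ ^ 2) := by ring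
        _ = reflFactor c x * (d ^ 2 * ‖x - c‖ ^ 2) := by rw [h2]
        _ = d ^ 2 * (reflFactor c x * ‖x - c‖ ^ 2) := by ring
        _ = _ := by rw [h1, hcn]; ring
    exact mul_right_cancel₀ (by positivity) h3
  rw [hypRefl_apply hc, hfac]
  have h4 : d • (c + ((1 - ‖y‖ ^ 2) / (1 - ‖x‖ ^ 2)) • (x - c)) = d • y := by
    rw [smul_add, smul_comm d (_ / _) (x - c), hxc, hdc, smul_neg, smul_smul,
      div_mul_cancel₀ _ hx1.ne', hd]
    module
  exact smul_right_injective E hdpos.ne' h4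

end Reflection

section HyperbolicVolume

variable {n : ℕ}

/-- The hyperbolic volume on the Poincaré ball, extended by zero to the Euclidean space. -/
noncomputable def hypVol (n : ℕ) : Measure (EuclideanSpace ℝ (Fin n)) :=
  (volume.restrict (Metric.ball 0 1)).withDensity
    fun x => ENNReal.ofReal ((2 / (1 - ‖x‖ ^ 2)) ^ n)

lemma measurable_hypVol_density :
    Measurable fun x : EuclideanSpace ℝ (Fin n) => ENNReal.ofReal ((2 / (1 - ‖x‖ ^ 2)) ^ n) := by
  fun_prop

lemma hypVol_apply {A : Set (EuclideanSpace ℝ (Fin n))} (hA : MeasurableSet A) :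
    hypVol n A = ∫⁻ x in A ∩ Metric.ball 0 1, ENNReal.ofReal ((2 / (1 - ‖x‖ ^ 2)) ^ n) := by
  rw [hypVol, withDensity_apply _ hA, Measure.restrict_restrict hA]

lemma lintegral_hypVol (f : EuclideanSpace ℝ (Fin n) → ENNReal) (hf : Measurable f) :
    ∫⁻ x, f x ∂hypVol n
      = ∫⁻ x in Metric.ball 0 1, ENNReal.ofReal ((2 / (1 - ‖x‖ ^ 2)) ^ n) * f x := by
  rw [hypVol, lintegral_withDensity_eq_lintegral_mul _ measurable_hypVol_density hf]
  rfl

lemma measurable_hypRefl_prod {α : Type*} [MeasurableSpace α]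
    {f g : α → EuclideanSpace ℝ (Fin n)} (hf : Measurable f) (hg : Measurable g) :
    Measurable fun a => hypRefl (f a) (g a) := by
  have h1 : Measurable fun a => (√(‖f a‖ ^ 2 - 1) / dist (g a) (f a)) ^ 2 :=
    ((((hf.norm.pow_const 2).sub_const 1).sqrt).div (hg.dist hf)).pow_const 2
  have h2 : Measurable fun a => (√(‖f a‖ ^ 2 - 1) / dist (g a) (f a)) ^ 2 • (g a - f a) + f a :=
    (h1.smul (hg.sub hf)).add hf
  exact h2

lemma measurable_hypRefl (c : EuclideanSpace ℝ (Fin n)) : Measurable (hypRefl c) :=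
  measurable_hypRefl_prod measurable_const measurable_id

lemma hasFDerivAt_hypRefl {c x : EuclideanSpace ℝ (Fin n)} (hc : 1 < ‖c‖) (hx : ‖x‖ < 1) :
    ∃ f' : EuclideanSpace ℝ (Fin n) →L[ℝ] EuclideanSpace ℝ (Fin n),
      HasFDerivAt (hypRefl c) f' x ∧ |f'.det| = reflFactor c x ^ n := by
  refine ⟨_, EuclideanGeometry.hasFDerivAt_inversion (ne_center hc hx), ?_⟩
  have h1 : (√(‖c‖ ^ 2 - 1) / dist x c) ^ 2 = reflFactor c x := by
    rw [div_pow, Real.sq_sqrt (norm_center_sq_pos hc).le, dist_eq_norm, reflFactor]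
  rw [h1, ContinuousLinearMap.det, ContinuousLinearMap.toLinearMap_smul, LinearMap.det_smul,
    abs_mul, abs_pow, abs_of_pos (reflFactor_pos hc hx), finrank_euclideanSpace_fin]
  have h2 := Submodule.det_reflection (K := (Submodule.span ℝ {x - c})ᗮ)
  have h3 : |LinearMap.det (((Submodule.span ℝ {x - c})ᗮ.reflection :
      EuclideanSpace ℝ (Fin n) →L[ℝ] EuclideanSpace ℝ (Fin n)) :
      EuclideanSpace ℝ (Fin n) →ₗ[ℝ] EuclideanSpace ℝ (Fin n))| = 1 := by
    have := congrArg abs h2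
    rw [abs_pow, abs_neg, abs_one, one_pow] at this
    exact this
  rw [h3, mul_one]

lemma measurePreserving_hypRefl {c : EuclideanSpace ℝ (Fin n)} (hc : 1 < ‖c‖) :
    MeasurePreserving (hypRefl c) (hypVol n) (hypVol n) := by
  refine ⟨measurable_hypRefl c, ?_⟩
  ext A hA
  rw [Measure.map_apply (measurable_hypRefl c) hA, hypVol_apply (measurable_hypRefl c hA),
    hypVol_apply hA]
  have himg : hypRefl c ⁻¹' A ∩ Metric.ball 0 1 = hypRefl c '' (A ∩ Metric.ball 0 1) := by
    ext x
    simp only [Set.mem_inter_iff, Set.mem_preimage, mem_ball_zero_iff, Set.mem_image]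
    constructor
    · rintro ⟨h1, h2⟩
      exact ⟨hypRefl c x, ⟨h1, norm_hypRefl_lt_one hc h2⟩, hypRefl_hypRefl hc x⟩
    · rintro ⟨y, ⟨h1, h2⟩, rfl⟩
      rw [hypRefl_hypRefl hc]
      exact ⟨h1, norm_hypRefl_lt_one hc h2⟩
  choose! f' hf' hdet using fun (x : EuclideanSpace ℝ (Fin n)) (hx : ‖x‖ < 1) =>
    hasFDerivAt_hypRefl hc hx
  rw [himg, lintegral_image_eq_lintegral_abs_det_fderiv_mul volume
    (hA.inter measurableSet_ball) (f' := f')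
    (fun x hx => (hf' x (mem_ball_zero_iff.1 hx.2)).hasFDerivWithinAt)
    (Function.Involutive.injective (hypRefl_hypRefl hc)).injOn]
  refine setLIntegral_congr_fun (hA.inter measurableSet_ball) fun x hx => ?_
  have hx1 : ‖x‖ < 1 := mem_ball_zero_iff.1 hx.2
  have hl := reflFactor_pos hc hx1
  rw [hdet x hx1, ← ENNReal.ofReal_mul (by positivity), ← mul_pow, one_sub_norm_hypRefl_sq hc hx1]
  congr 2
  field_simp

lemma hypVol_closedBall_lt_top {ρ : ℝ} (hρ : ρ < 1) :
    hypVol n (Metric.closedBall 0 ρ) < ⊤ := by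
  rcases lt_or_ge ρ 0 with h0 | h0
  · simp [Metric.closedBall_eq_empty.2 h0]
  rw [hypVol_apply measurableSet_closedBall]
  have hpos : 0 < 1 - ρ ^ 2 := by nlinarith
  calc ∫⁻ x in Metric.closedBall 0 ρ ∩ Metric.ball (0 : EuclideanSpace ℝ (Fin n)) 1,
        ENNReal.ofReal ((2 / (1 - ‖x‖ ^ 2)) ^ n)
      ≤ ∫⁻ x in Metric.closedBall 0 ρ ∩ Metric.ball (0 : EuclideanSpace ℝ (Fin n)) 1,
        ENNReal.ofReal ((2 / (1 - ρ ^ 2)) ^ n) := by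
        refine setLIntegral_mono measurable_const fun x hx => ENNReal.ofReal_le_ofReal ?_
        have hx1 : ‖x‖ ≤ ρ := mem_closedBall_zero_iff.1 hx.1
        have : ‖x‖ ^ 2 ≤ ρ ^ 2 := by gcongr
        have h2 : 0 < 1 - ‖x‖ ^ 2 := by linarith
        exact pow_le_pow_left₀ (by positivity)
          (div_le_div_of_nonneg_left (by norm_num) hpos (by linarith)) n
    _ < ⊤ := by
        rw [setLIntegral_const]
        exact ENNReal.mul_lt_top ENNReal.ofReal_lt_top
          ((measure_mono Set.inter_subset_right).trans_lt measure_ball_lt_top)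

lemma restrict_absolutelyContinuous_hypVol :
    (volume.restrict (Metric.ball (0 : EuclideanSpace ℝ (Fin n)) 1)) ≪ hypVol n := by
  refine withDensity_absolutelyContinuous' measurable_hypVol_density.aemeasurable ?_
  filter_upwards [ae_restrict_mem measurableSet_ball] with x hx
  have hx1 : ‖x‖ < 1 := mem_ball_zero_iff.1 hx
  have : 0 < 1 - ‖x‖ ^ 2 := by nlinarith [norm_nonneg x]
  exact (ENNReal.ofReal_pos.2 (by positivity)).ne'

lemma hypVol_absolutelyContinuous : hypVol n ≪ volume :=
  (withDensity_absolutelyContinuous _ _).trans Measure.restrict_le_self.absolutelyContinuous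

lemma volume_eq_zero_of_hypVol_eq_zero {A : Set (EuclideanSpace ℝ (Fin n))}
    (hA : A ⊆ Metric.ball 0 1) (h : hypVol n A = 0) : volume A = 0 := by
  have := restrict_absolutelyContinuous_hypVol h
  rwa [Measure.restrict_eq_self _ hA] at this

end HyperbolicVolume

section Polarization

variable {n : ℕ}

/-- The open hyperbolic neighbourhood of a set in the unit ball. -/
def hypNbhd {E : Type*} [NormedAddCommGroup E] (ε : ℝ) (A : Set E) : Set E :=
  {x | ‖x‖ < 1 ∧ ∃ y ∈ A, HypNear ε x y}

/-- The part of the space outside the sphere of `hypRefl c`. -/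
def reflSide {E : Type*} [NormedAddCommGroup E] (c : E) : Set E :=
  {x | ‖c‖ ^ 2 - 1 ≤ ‖x - c‖ ^ 2}

/-- The two-point symmetrization of a set with respect to `hypRefl c`. -/
noncomputable def polarization {E : Type*} [NormedAddCommGroup E] [InnerProductSpace ℝ E]
    (c : E) (C : Set E) : Set E :=
  (reflSide c ∩ (C ∪ hypRefl c ⁻¹' C)) ∪ (C ∩ hypRefl c ⁻¹' C)

section General

variable {E : Type*} [NormedAddCommGroup E]

lemma isClosed_reflSide (c : E) : IsClosed (reflSide c) :=
  isClosed_le continuous_const (by fun_prop)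

lemma isOpen_hypNbhd (ε : ℝ) (A : Set E) : IsOpen (hypNbhd ε A) := by
  have : hypNbhd ε A = ⋃ y ∈ A, ({x | ‖x‖ < 1} ∩ {x | HypNear ε x y}) := by
    ext x; simp [hypNbhd]
  rw [this]
  refine isOpen_biUnion fun y _ => (isOpen_lt (by fun_prop) (by fun_prop)).inter ?_
  exact isOpen_lt (by fun_prop) (by fun_prop)

lemma hypNbhd_mono (ε : ℝ) {A B : Set E} (h : A ⊆ B) : hypNbhd ε A ⊆ hypNbhd ε B :=
  fun _ ⟨h1, y, hy, h2⟩ => ⟨h1, y, h hy, h2⟩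

lemma hypNbhd_subset_ball (ε : ℝ) (A : Set E) : hypNbhd ε A ⊆ Metric.ball 0 1 :=
  fun _ hx => mem_ball_zero_iff.2 hx.1

variable {c x : E}

lemma mem_reflSide (hc : 1 < ‖c‖) (hx : ‖x‖ < 1) : x ∈ reflSide c ↔ reflFactor c x ≤ 1 := by
  rw [reflFactor, div_le_one (pow_pos (norm_pos_iff.2 (sub_ne_zero.2 (ne_center hc hx))) 2)]
  rfl

variable [InnerProductSpace ℝ E]

lemma hypRefl_mem_reflSide (hc : 1 < ‖c‖) (hx : ‖x‖ < 1) (h : x ∉ reflSide c) :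
    hypRefl c x ∈ reflSide c := by
  rw [mem_reflSide hc hx] at h
  rw [mem_reflSide hc (norm_hypRefl_lt_one hc hx)]
  have := reflFactor_hypRefl hc hx
  have := reflFactor_pos hc (norm_hypRefl_lt_one hc hx)
  nlinarith

lemma hypRefl_eq_self_of_mem (hc : 1 < ‖c‖) (hx : ‖x‖ < 1) (h : x ∈ reflSide c)
    (h' : hypRefl c x ∈ reflSide c) : hypRefl c x = x := by
  rw [mem_reflSide hc hx] at h
  rw [mem_reflSide hc (norm_hypRefl_lt_one hc hx)] at h'
  have := reflFactor_hypRefl hc hx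
  have := reflFactor_pos hc (norm_hypRefl_lt_one hc hx)
  have := reflFactor_pos hc hx
  exact hypRefl_eq_self hc (by nlinarith)

lemma hypRefl_preimage_subset_ball (hc : 1 < ‖c‖) {C : Set E} (hC : C ⊆ Metric.ball 0 1) :
    hypRefl c ⁻¹' C ⊆ Metric.ball 0 1 := by
  intro x hx
  rw [← hypRefl_hypRefl hc x]
  exact mem_ball_zero_iff.2 (norm_hypRefl_lt_one hc (mem_ball_zero_iff.1 (hC hx)))

lemma polarization_subset_ball (hc : 1 < ‖c‖) {C : Set E} (hC : C ⊆ Metric.ball 0 1) :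
    polarization c C ⊆ Metric.ball 0 1 := by
  rintro x (⟨_, h | h⟩ | ⟨h, _⟩)
  exacts [hC h, hypRefl_preimage_subset_ball hc hC h, hC h]

lemma polarization_subset_closedBall (hc : 1 < ‖c‖) {C : Set E} {ρ : ℝ} (hρ : ρ < 1)
    (hC : C ⊆ Metric.closedBall 0 ρ) : polarization c C ⊆ Metric.closedBall 0 ρ := by
  have hC1 := hC.trans (Metric.closedBall_subset_ball hρ)
  rintro x (⟨hxH, h | h⟩ | ⟨h, _⟩)
  · exact hC h
  · have hx := mem_ball_zero_iff.1 (hypRefl_preimage_subset_ball hc hC1 h)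
    exact mem_closedBall_zero_iff.2 ((norm_le_norm_hypRefl hc hx
      ((mem_reflSide hc hx).1 hxH)).trans (mem_closedBall_zero_iff.1 (hC h)))
  · exact hC h

lemma isCompact_polarization (hc : 1 < ‖c‖) {C : Set E} (hC : C ⊆ Metric.ball 0 1)
    (hC' : IsCompact C) : IsCompact (polarization c C) := by
  have h1 : hypRefl c ⁻¹' C = hypRefl c '' C := by
    ext x
    exact ⟨fun h => ⟨_, h, hypRefl_hypRefl hc x⟩, by
      rintro ⟨y, hy, rfl⟩; rwa [Set.mem_preimage, hypRefl_hypRefl hc]⟩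
  have h2 : IsCompact (hypRefl c ⁻¹' C) := by
    rw [h1]
    refine hC'.image_of_continuousOn ?_
    have : ContinuousOn (fun x => c + reflFactor c x • (x - c)) C := by
      unfold reflFactor
      refine continuousOn_const.add (ContinuousOn.smul (continuousOn_const.div (by fun_prop) ?_)
        (by fun_prop))
      intro x hx
      have := ne_center hc (mem_ball_zero_iff.1 (hC hx))
      exact pow_ne_zero 2 (norm_ne_zero_iff.2 (sub_ne_zero.2 this))
    exact this.congr fun x _ => hypRefl_apply hc x
  exact ((hC'.union h2).inter_left (isClosed_reflSide c)).union (hC'.inter h2)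

lemma hypNbhd_polarization_subset (hc : 1 < ‖c‖) {C : Set E} (hC : C ⊆ Metric.ball 0 1) (ε : ℝ) :
    hypNbhd ε (polarization c C) ⊆ polarization c (hypNbhd ε C) := by
  rintro x ⟨hx, y, hy, hxy⟩
  have hy1 : ‖y‖ < 1 := mem_ball_zero_iff.1 (polarization_subset_ball hc hC hy)
  have hσ := norm_hypRefl_lt_one hc hx
  have hσxy := hypNear_hypRefl hc hx hy1 hxy
  have key : x ∉ reflSide c → y ∈ reflSide c → HypNear ε (hypRefl c x) y := fun h1 h2 =>
    hypNear_of_hypNear_hypRefl hc hσ hy1 ((mem_reflSide hc hσ).1 (hypRefl_mem_reflSide hc hx h1))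
      ((mem_reflSide hc hy1).1 h2) hσxy
  rcases hy with ⟨hyH, h | h⟩ | ⟨h, h'⟩
  · by_cases hxH : x ∈ reflSide c
    · exact Or.inl ⟨hxH, Or.inl ⟨hx, y, h, hxy⟩⟩
    · exact Or.inr ⟨⟨hx, y, h, hxy⟩, hσ, y, h, key hxH hyH⟩
  · by_cases hxH : x ∈ reflSide c
    · exact Or.inl ⟨hxH, Or.inr ⟨hσ, _, h, hσxy⟩⟩
    · refine Or.inr ⟨⟨hx, _, h, ?_⟩, hσ, _, h, hσxy⟩
      have := hypNear_hypRefl hc hσ hy1 (key hxH hyH)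
      rwa [hypRefl_hypRefl hc] at this
  · exact Or.inr ⟨⟨hx, y, h, hxy⟩, hσ, _, h', hσxy⟩

end General

variable {c : EuclideanSpace ℝ (Fin n)} {C : Set (EuclideanSpace ℝ (Fin n))}

lemma measurableSet_polarization (hC : MeasurableSet C) : MeasurableSet (polarization c C) :=
  ((isClosed_reflSide c).measurableSet.inter (hC.union (measurable_hypRefl c hC))).union
    (hC.inter (measurable_hypRefl c hC))

lemma hypVol_polarization (hc : 1 < ‖c‖) (hC : C ⊆ Metric.ball 0 1) (hCm : MeasurableSet C) :
    hypVol n (polarization c C) = hypVol n C := by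
  have hσC : MeasurableSet (hypRefl c ⁻¹' C) := measurable_hypRefl c hCm
  have hH : MeasurableSet (reflSide c) := (isClosed_reflSide c).measurableSet
  have h1 : polarization c C = (C ∩ hypRefl c ⁻¹' C) ∪
      ((reflSide c ∩ (C \ hypRefl c ⁻¹' C)) ∪ (reflSide c ∩ (hypRefl c ⁻¹' C \ C))) := by
    ext x; simp only [polarization, Set.mem_union, Set.mem_inter_iff, Set.mem_sdiff]; tauto
  have h2 : C = (C ∩ hypRefl c ⁻¹' C) ∪
      ((reflSide c ∩ (C \ hypRefl c ⁻¹' C)) ∪ ((C \ hypRefl c ⁻¹' C) \ reflSide c)) := by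
    ext x; simp only [Set.mem_union, Set.mem_inter_iff, Set.mem_sdiff]; tauto
  have h3 : (C \ hypRefl c ⁻¹' C) \ reflSide c
      = hypRefl c ⁻¹' (reflSide c ∩ (hypRefl c ⁻¹' C \ C)) := by
    ext x
    simp only [Set.mem_inter_iff, Set.mem_sdiff, Set.mem_preimage, hypRefl_hypRefl hc]
    constructor
    · rintro ⟨⟨h, h'⟩, h''⟩
      exact ⟨hypRefl_mem_reflSide hc (mem_ball_zero_iff.1 (hC h)) h'', h, h'⟩
    · rintro ⟨h'', h, h'⟩
      refine ⟨⟨h, h'⟩, fun hxH => h' ?_⟩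
      rwa [hypRefl_eq_self_of_mem hc (mem_ball_zero_iff.1 (hC h)) hxH h'']
  have h4 : hypVol n ((C \ hypRefl c ⁻¹' C) \ reflSide c)
      = hypVol n (reflSide c ∩ (hypRefl c ⁻¹' C \ C)) := by
    rw [h3]
    exact (measurePreserving_hypRefl hc).measure_preimage
      (hH.inter (hσC.diff hCm)).nullMeasurableSet
  have dj : ∀ {s t : Set (EuclideanSpace ℝ (Fin n))}, (∀ x, x ∈ s → x ∉ t) → Disjoint s t :=
    fun h => Set.disjoint_left.2 h
  conv_rhs => rw [h2]
  rw [h1, measure_union (dj fun x => by simp; tauto)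
      ((hH.inter (hCm.diff hσC)).union (hH.inter (hσC.diff hCm))),
    measure_union (dj fun x => by simp; tauto) (hH.inter (hσC.diff hCm)),
    measure_union (dj fun x => by simp; tauto)
      ((hH.inter (hCm.diff hσC)).union ((hCm.diff hσC).diff hH)),
    measure_union (dj fun x => by simp; tauto) ((hCm.diff hσC).diff hH), h4]

lemma hypVol_hypNbhd_polarization_le (hc : 1 < ‖c‖) (hC : C ⊆ Metric.ball 0 1) (ε : ℝ) :
    hypVol n (hypNbhd ε (polarization c C)) ≤ hypVol n (hypNbhd ε C) :=
  (measure_mono (hypNbhd_polarization_subset hc hC ε)).trans_eq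
    (hypVol_polarization hc (hypNbhd_subset_ball ε C) (isOpen_hypNbhd ε C).measurableSet)

lemma hypVol_polarization_inter_closedBall (hc : 1 < ‖c‖)
    (hCm : MeasurableSet C) {r : ℝ} (hr : r < 1) :
    hypVol n (C ∩ Metric.closedBall 0 r) + hypVol n ((Metric.closedBall 0 r \ C) ∩
        hypRefl c ⁻¹' (C \ Metric.closedBall 0 r))
      ≤ hypVol n (polarization c C ∩ Metric.closedBall 0 r) := by
  set B : Set (EuclideanSpace ℝ (Fin n)) := Metric.closedBall 0 r
  have hB : MeasurableSet B := measurableSet_closedBall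
  have hB1 : ∀ x ∈ B, ‖x‖ < 1 := fun x hx => (mem_closedBall_zero_iff.1 hx).trans_lt hr
  set T := (B \ C) ∩ hypRefl c ⁻¹' (C \ B) with hT
  have hTm : MeasurableSet T := (hB.diff hCm).inter (measurable_hypRefl c (hCm.diff hB))
  have hPm : MeasurableSet (polarization c C) := measurableSet_polarization hCm
  have hTsub : T ⊆ (polarization c C ∩ B) \ C := by
    rintro x ⟨⟨hxB, hxC⟩, hxC', hxB'⟩
    refine ⟨⟨?_, hxB⟩, hxC⟩
    by_cases hxH : x ∈ reflSide c
    · exact Or.inl ⟨hxH, Or.inr hxC'⟩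
    · exfalso
      have hx1 := hB1 x hxB
      have h1 := hypRefl_mem_reflSide hc hx1 hxH
      have h2 := norm_le_norm_hypRefl hc (norm_hypRefl_lt_one hc hx1)
        ((mem_reflSide hc (norm_hypRefl_lt_one hc hx1)).1 h1)
      rw [hypRefl_hypRefl hc] at h2
      exact hxB' (mem_closedBall_zero_iff.2 (h2.trans (mem_closedBall_zero_iff.1 hxB)))
  have hsub : (C ∩ B) \ polarization c C ⊆ hypRefl c ⁻¹' (((polarization c C ∩ B) \ C) \ T) := by
    rintro x ⟨⟨hxC, hxB⟩, hxP⟩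
    have hx1 := hB1 x hxB
    have hxH : x ∉ reflSide c := fun h => hxP (Or.inl ⟨h, Or.inl hxC⟩)
    have hσC : hypRefl c x ∉ C := fun h => hxP (Or.inr ⟨hxC, h⟩)
    have h1 := hypRefl_mem_reflSide hc hx1 hxH
    have h2 := norm_le_norm_hypRefl hc (norm_hypRefl_lt_one hc hx1)
      ((mem_reflSide hc (norm_hypRefl_lt_one hc hx1)).1 h1)
    rw [hypRefl_hypRefl hc] at h2
    refine ⟨⟨⟨Or.inl ⟨h1, Or.inr ?_⟩, ?_⟩, hσC⟩, ?_⟩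
    · rwa [Set.mem_preimage, hypRefl_hypRefl hc]
    · exact mem_closedBall_zero_iff.2 (h2.trans (mem_closedBall_zero_iff.1 hxB))
    · rintro ⟨_, _, h⟩
      rw [hypRefl_hypRefl hc] at h
      exact h hxB
  have hle : hypVol n ((C ∩ B) \ polarization c C)
      ≤ hypVol n (((polarization c C ∩ B) \ C) \ T) :=
    (measure_mono hsub).trans_eq ((measurePreserving_hypRefl hc).measure_preimage
      (((hPm.inter hB).diff hCm).diff hTm).nullMeasurableSet)
  rw [← measure_inter_add_sdiff (C ∩ B) hPm, ← measure_inter_add_sdiff (polarization c C ∩ B) hCm,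
    ← measure_inter_add_sdiff ((polarization c C ∩ B) \ C) hTm,
    Set.inter_eq_self_of_subset_right hTsub]
  have h5 : C ∩ B ∩ polarization c C = polarization c C ∩ B ∩ C := by
    ext x; simp only [Set.mem_inter_iff]; tauto
  rw [h5, add_assoc, add_comm (hypVol n T)]
  gcongr

end Polarization

section Isoperimetry

open TopologicalSpace Filter Topology

variable {n : ℕ}

lemma upperSemicontinuous_measure_compacts {X : Type*} [TopologicalSpace X] [MeasurableSpace X]
    (μ : Measure X) [μ.OuterRegular] : UpperSemicontinuous fun K : Compacts X => μ K := by
  intro K y hy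
  obtain ⟨U, hKU, hU, hUy⟩ := Set.exists_isOpen_lt_of_lt (K : Set X) y hy
  filter_upwards [(Compacts.isOpen_subsets_of_isOpen hU).mem_nhds hKU] with K' hK'
  exact (measure_mono hK').trans_lt hUy

lemma eventually_subset_hypNbhd {E : Type*} [NormedAddCommGroup E] {ε : ℝ} {F : Set E}
    (hF : IsCompact F) (K : Compacts E) (hFK : F ⊆ hypNbhd ε K) :
    ∀ᶠ K' : Compacts E in 𝓝 K, F ⊆ hypNbhd ε K' := by
  refine hF.induction_on (p := fun F => ∀ᶠ K' : Compacts E in 𝓝 K, F ⊆ hypNbhd ε K')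
    (by simp) (fun s t hst ht => ht.mono fun _ h => hst.trans h)
    (fun s t hs ht => (hs.and ht).mono fun _ h => Set.union_subset h.1 h.2) fun x hx => ?_
  obtain ⟨hx1, y, hy, hxy⟩ := hFK hx
  have hopen : IsOpen {q : E × E | HypNear ε q.1 q.2} :=
    isOpen_lt (by fun_prop) (by fun_prop)
  obtain ⟨U, V, hU, hV, hxU, hyV, hUV⟩ := isOpen_prod_iff.1 hopen x y hxy
  refine ⟨U ∩ Metric.ball 0 1, mem_nhdsWithin_of_mem_nhds ((hU.inter Metric.isOpen_ball).mem_nhds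
    ⟨hxU, mem_ball_zero_iff.2 hx1⟩), ?_⟩
  filter_upwards [(Compacts.isOpen_inter_nonempty_of_isOpen hV).mem_nhds ⟨y, hy, hyV⟩]
    with K' hK' z hz
  obtain ⟨w, hwK, hwV⟩ := hK'
  exact ⟨mem_ball_zero_iff.1 hz.2, w, hwK, hUV (Set.mk_mem_prod hz.1 hwV)⟩

lemma lowerSemicontinuous_measure_hypNbhd {E : Type*} [NormedAddCommGroup E] [ProperSpace E]
    [MeasurableSpace E] (μ : Measure E) (ε : ℝ) :
    LowerSemicontinuous fun K : Compacts E => μ (hypNbhd ε K) := by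
  intro K y hy
  obtain ⟨F, hFc, hFsub, hFU, hFm⟩ := (isOpen_hypNbhd ε (K : Set E)).exists_iUnion_isClosed
  have hy : y < μ (hypNbhd ε K) := hy
  rw [← hFU, hFm.measure_iUnion] at hy
  obtain ⟨k, hk⟩ := lt_iSup_iff.1 hy
  have hFk : IsCompact (F k) := Metric.isCompact_of_isClosed_isBounded (hFc k)
    (Metric.isBounded_ball.subset ((hFsub k).trans (hypNbhd_subset_ball ε _)))
  filter_upwards [eventually_subset_hypNbhd hFk K (hFsub k)] with K' hK'
  exact hk.trans_le (measure_mono hK')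

lemma differentiableOn_hypRefl_center {z : EuclideanSpace ℝ (Fin n)} (hz : ‖z‖ < 1) :
    DifferentiableOn ℝ (fun c => hypRefl c z) {c | 1 < ‖c‖} := by
  have h : DifferentiableOn ℝ (fun c => c + ((‖c‖ ^ 2 - 1) / ‖z - c‖ ^ 2) • (z - c))
      {c : EuclideanSpace ℝ (Fin n) | 1 < ‖c‖} := by
    intro c hc
    have h1 : DifferentiableAt ℝ (fun c : EuclideanSpace ℝ (Fin n) => ‖c‖ ^ 2 - 1) c :=
      (differentiableAt_id.norm_sq ℝ).sub_const 1
    have h2 : DifferentiableAt ℝ (fun c : EuclideanSpace ℝ (Fin n) => ‖z - c‖ ^ 2) c :=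
      ((differentiableAt_const z).sub differentiableAt_id).norm_sq ℝ
    have h3 : ‖z - c‖ ^ 2 ≠ 0 :=
      pow_ne_zero 2 (norm_ne_zero_iff.2 (sub_ne_zero.2 (ne_center hc hz)))
    have h4 := h1.mul (h2.fun_inv h3)
    exact (differentiableAt_id.add (h4.smul
      ((differentiableAt_const z).sub differentiableAt_id))).differentiableWithinAt
  exact h.congr fun c hc => hypRefl_apply hc z

/-- If all hyperbolic reflections fail to move a part of positive measure of `C \ B` into `B \ C`,
where `B` is a centred ball, then one of these two sets is null. -/
lemma volume_eq_zero_or_of_forall_hypRefl {C : Set (EuclideanSpace ℝ (Fin n))}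
    (hC : C ⊆ Metric.ball 0 1) (hCm : MeasurableSet C) {r : ℝ} (hr : r < 1)
    (h : ∀ c : EuclideanSpace ℝ (Fin n), 1 < ‖c‖ → volume ((Metric.closedBall 0 r \ C) ∩
        hypRefl c ⁻¹' (C \ Metric.closedBall 0 r)) = 0) :
    volume (Metric.closedBall 0 r \ C) = 0 ∨ volume (C \ Metric.closedBall 0 r) = 0 := by
  rw [or_iff_not_imp_left]
  intro hBC
  set B : Set (EuclideanSpace ℝ (Fin n)) := Metric.closedBall 0 r
  have hB : MeasurableSet B := measurableSet_closedBall
  let p : EuclideanSpace ℝ (Fin n) → EuclideanSpace ℝ (Fin n) → Prop := fun c z =>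
    ¬ ((z ∈ B \ C ∧ 1 < ‖c‖) ∧ hypRefl c z ∈ C \ B)
  have hpm : MeasurableSet
      {q : EuclideanSpace ℝ (Fin n) × EuclideanSpace ℝ (Fin n) | p q.1 q.2} := by
    refine MeasurableSet.compl (MeasurableSet.inter (MeasurableSet.inter ?_ ?_) ?_)
    · exact measurable_snd (hB.diff hCm)
    · exact measurableSet_lt measurable_const measurable_fst.norm
    · exact measurable_hypRefl_prod measurable_fst measurable_snd (hCm.diff hB)
  have h1 : ∀ᵐ c : EuclideanSpace ℝ (Fin n), ∀ᵐ z : EuclideanSpace ℝ (Fin n), p c z := by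
    refine Eventually.of_forall fun c => ?_
    by_cases hc : 1 < ‖c‖
    · rw [ae_iff]
      refine measure_mono_null ?_ (h c hc)
      intro z hz
      obtain ⟨⟨h1, _⟩, h2⟩ := not_not.1 hz
      exact ⟨h1, h2⟩
    · exact Eventually.of_forall fun z hz => hc hz.1.2
  rw [Measure.ae_ae_comm hpm] at h1
  obtain ⟨z, hz, hzp⟩ := ((frequently_ae_mem_iff.2 hBC).and_eventually h1).exists
  have hz1 : ‖z‖ < 1 := (mem_closedBall_zero_iff.1 hz.1).trans_lt hr
  have hG : volume {c | 1 < ‖c‖ ∧ hypRefl c z ∈ C \ B} = 0 := by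
    rw [ae_iff] at hzp
    refine measure_mono_null ?_ hzp
    intro c hc
    exact not_not.2 ⟨⟨hz, hc.1⟩, hc.2⟩
  have himg := addHaar_image_eq_zero_of_differentiableOn_of_addHaar_eq_zero volume
    ((differentiableOn_hypRefl_center hz1).mono fun c hc => hc.1) hG
  refine measure_mono_null ?_ himg
  intro y hy
  have hzy : ‖z‖ < ‖y‖ := (mem_closedBall_zero_iff.1 hz.1).trans_lt
    (lt_of_not_ge fun h => hy.2 (mem_closedBall_zero_iff.2 h))
  obtain ⟨c, hc, hcz⟩ := exists_hypRefl_eq hzy (mem_ball_zero_iff.1 (hC hy.1))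
  exact ⟨c, ⟨hc, by rwa [hcz]⟩, hcz⟩

/-- The isoperimetric inequality in hyperbolic space: balls minimize the volume of
neighbourhoods. -/
theorem hypVol_hypNbhd_closedBall_le {A : Set (EuclideanSpace ℝ (Fin n))} (hA : IsCompact A)
    (hA1 : A ⊆ Metric.ball 0 1) {r : ℝ} (hr0 : 0 < r) (hr : r < 1)
    (hv : hypVol n (Metric.closedBall 0 r) ≤ hypVol n A) (ε : ℝ) :
    hypVol n (hypNbhd ε (Metric.closedBall 0 r)) ≤ hypVol n (hypNbhd ε A) := by
  set B : Set (EuclideanSpace ℝ (Fin n)) := Metric.closedBall 0 r with hBdef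
  have hB : MeasurableSet B := measurableSet_closedBall
  obtain ⟨ρ, hρ, hAρ⟩ : ∃ ρ < 1, A ⊆ Metric.closedBall 0 ρ := by
    obtain ⟨ρ, hρ, hAρ⟩ := exists_lt_subset_ball hA.isClosed hA1
    exact ⟨ρ, hρ, hAρ.trans Metric.ball_subset_closedBall⟩
  have hρ1 : Metric.closedBall (0 : EuclideanSpace ℝ (Fin n)) ρ ⊆ Metric.ball 0 1 :=
    Metric.closedBall_subset_ball hρ
  have : IsFiniteMeasure ((hypVol n).restrict (Metric.closedBall 0 ρ)) :=
    ⟨by rw [Measure.restrict_apply_univ]; exact hypVol_closedBall_lt_top hρ⟩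
  have : IsFiniteMeasure ((hypVol n).restrict B) :=
    ⟨by rw [Measure.restrict_apply_univ]; exact hypVol_closedBall_lt_top hr⟩
  have hres : ∀ K : Compacts (EuclideanSpace ℝ (Fin n)),
      (K : Set (EuclideanSpace ℝ (Fin n))) ⊆ Metric.closedBall 0 ρ →
      (hypVol n).restrict (Metric.closedBall 0 ρ) K = hypVol n K :=
    fun K hK => Measure.restrict_eq_self _ hK
  have hresB : ∀ K : Compacts (EuclideanSpace ℝ (Fin n)),
      (hypVol n).restrict B K = hypVol n (K ∩ B) :=
    fun K => Measure.restrict_apply K.isCompact.measurableSet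
  let S : Set (Compacts (EuclideanSpace ℝ (Fin n))) :=
    {K | (K : Set (EuclideanSpace ℝ (Fin n))) ⊆ Metric.closedBall 0 ρ} ∩
    ({K | hypVol n A ≤ (hypVol n).restrict (Metric.closedBall 0 ρ) K} ∩
      {K | hypVol n (hypNbhd ε K) ≤ hypVol n (hypNbhd ε A)})
  have hS : IsCompact S := by
    refine (Compacts.isCompact_subsets_of_isCompact (isCompact_closedBall 0 ρ)).inter_right
      (IsClosed.inter ?_ ?_)
    · exact (upperSemicontinuous_measure_compacts _).isClosed_preimage _
    · exact (lowerSemicontinuous_measure_hypNbhd (hypVol n) ε).isClosed_preimage _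
  have hAS : (⟨A, hA⟩ : Compacts (EuclideanSpace ℝ (Fin n))) ∈ S :=
    ⟨hAρ, (hres ⟨A, hA⟩ hAρ).ge, (le_refl (hypVol n (hypNbhd ε A)) : _)⟩
  obtain ⟨C, hCS, hCmax⟩ := ((upperSemicontinuous_measure_compacts
    ((hypVol n).restrict B)).upperSemicontinuousOn S).exists_isMaxOn ⟨_, hAS⟩ hS
  obtain ⟨hCρ, hCA, hCN⟩ := hCS
  have hCρ : (C : Set (EuclideanSpace ℝ (Fin n))) ⊆ Metric.closedBall 0 ρ := hCρ
  have hCN : hypVol n (hypNbhd ε C) ≤ hypVol n (hypNbhd ε A) := hCN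
  have hCA : hypVol n A ≤ hypVol n C := by rw [← hres C hCρ]; exact hCA
  have hCm : MeasurableSet (C : Set (EuclideanSpace ℝ (Fin n))) := C.isCompact.measurableSet
  have hC1 : (C : Set (EuclideanSpace ℝ (Fin n))) ⊆ Metric.ball 0 1 := hCρ.trans hρ1
  have hBfin : hypVol n B ≠ ⊤ := (hypVol_closedBall_lt_top hr).ne
  have hT : ∀ c : EuclideanSpace ℝ (Fin n), 1 < ‖c‖ → volume ((B \ C) ∩
        hypRefl c ⁻¹' (C \ B)) = 0 := by
    intro c hc
    let P : Compacts (EuclideanSpace ℝ (Fin n)) :=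
      ⟨polarization c C, isCompact_polarization hc hC1 C.isCompact⟩
    have hPρ : (P : Set (EuclideanSpace ℝ (Fin n))) ⊆ Metric.closedBall 0 ρ :=
      polarization_subset_closedBall hc hρ hCρ
    have hPS : P ∈ S := by
      refine ⟨hPρ, ?_, ?_⟩
      · change _ ≤ (hypVol n).restrict _ P
        rw [hres P hPρ]
        exact hCA.trans (hypVol_polarization hc hC1 hCm).ge
      · exact (hypVol_hypNbhd_polarization_le hc hC1 ε).trans hCN
    have h1 : (hypVol n).restrict B P ≤ (hypVol n).restrict B C := hCmax hPS
    rw [hresB, hresB] at h1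
    have h2 := (hypVol_polarization_inter_closedBall hc hCm hr).trans h1
    refine volume_eq_zero_of_hypVol_eq_zero
      (fun x hx => Metric.closedBall_subset_ball hr hx.1.1) ?_
    have h3 : hypVol n (C ∩ B) ≠ ⊤ := measure_ne_top_of_subset Set.inter_subset_right hBfin
    have h4 : hypVol n (C ∩ B) + hypVol n ((B \ C) ∩ hypRefl c ⁻¹' (C \ B))
        ≤ hypVol n (C ∩ B) + 0 := by rw [add_zero]; exact h2
    exact le_antisymm ((ENNReal.add_le_add_iff_left h3).1 h4) zero_le
  have hnull : hypVol n (B \ C) = 0 := by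
    rcases volume_eq_zero_or_of_forall_hypRefl hC1 hCm hr hT with h | h
    · exact hypVol_absolutelyContinuous h
    · have h' : hypVol n (C \ B) = 0 := hypVol_absolutelyContinuous h
      have h1 := hv.trans hCA
      rw [← measure_inter_add_sdiff B hCm, ← measure_inter_add_sdiff (C : Set _) hB, h', add_zero,
        Set.inter_comm] at h1
      have h3 : hypVol n (C ∩ B) ≠ ⊤ := measure_ne_top_of_subset Set.inter_subset_right hBfin
      have h4 : hypVol n (C ∩ B) + hypVol n (B \ C) ≤ hypVol n (C ∩ B) + 0 := by
        rw [add_zero]; exact h1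
      exact le_antisymm ((ENNReal.add_le_add_iff_left h3).1 h4) zero_le
  have hballC : Metric.ball 0 r ⊆ (C : Set (EuclideanSpace ℝ (Fin n))) := by
    have hopen : IsOpen (Metric.ball 0 r \ (C : Set (EuclideanSpace ℝ (Fin n)))) :=
      Metric.isOpen_ball.sdiff C.isCompact.isClosed
    have h1 : volume (Metric.ball 0 r \ (C : Set (EuclideanSpace ℝ (Fin n)))) = 0 := by
      refine volume_eq_zero_of_hypVol_eq_zero
        (fun x hx => Metric.ball_subset_ball hr.le hx.1)
        (measure_mono_null (Set.sdiff_subset_sdiff_left Metric.ball_subset_closedBall) hnull)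
    exact Set.sdiff_eq_empty.1 ((hopen.measure_eq_zero_iff volume).1 h1)
  have hBC : B ⊆ C := by
    rw [hBdef, ← closure_ball _ hr0.ne']
    exact closure_minimal hballC C.isCompact.isClosed
  exact (measure_mono (hypNbhd_mono ε hBC)).trans hCN

end Isoperimetry

section BallVolume

/-- The radial part of the volume of hyperbolic balls of Euclidean radius `r`. -/
noncomputable def radialVol (n : ℕ) (r : ℝ) : ℝ :=
  ∫ t in (0 : ℝ)..r, t ^ (n - 1) * (2 / (1 - t ^ 2)) ^ n

/-- The Euclidean isoperimetric profile. -/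
noncomputable def euclProfile (n : ℕ) (v : ℝ) : ℝ :=
  n * unitBallVol n ^ (1 / (n : ℝ)) * v ^ (1 - 1 / (n : ℝ))

/-- A lower bound for the isoperimetric profile of the hyperbolic space. -/
noncomputable def isoProfile (n : ℕ) (p v : ℝ) : ℝ :=
  (euclProfile n v ^ p + (((n : ℝ) - 1) * v) ^ p) ^ (1 / p)

lemma unitBallVol_pos (n : ℕ) : 0 < unitBallVol n :=
  div_pos (Real.rpow_pos_of_pos Real.pi_pos _) (Real.Gamma_pos_of_pos (by positivity))

lemma continuousOn_radialVol_density (n : ℕ) :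
    ContinuousOn (fun t : ℝ => t ^ (n - 1) * (2 / (1 - t ^ 2)) ^ n) (Set.Ioo (-1) 1) := by
  refine ContinuousOn.mul (by fun_prop) (ContinuousOn.pow (ContinuousOn.div (by fun_prop)
    (by fun_prop) ?_) n)
  intro t ht
  have := ht.1; have := ht.2
  nlinarith

lemma hasDerivAt_radialVol (n : ℕ) {r : ℝ} (hr0 : 0 ≤ r) (hr : r < 1) :
    HasDerivAt (radialVol n) (r ^ (n - 1) * (2 / (1 - r ^ 2)) ^ n) r := by
  have hc := continuousOn_radialVol_density n
  have hmem : r ∈ Set.Ioo (-1 : ℝ) 1 := ⟨by linarith, hr⟩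
  refine intervalIntegral.integral_hasDerivAt_right ?_ ?_ ?_
  · refine (hc.mono ?_).intervalIntegrable
    rw [Set.uIcc_of_le hr0]
    exact fun t ht => ⟨by linarith [ht.1], ht.2.trans_lt hr⟩
  · exact hc.stronglyMeasurableAtFilter isOpen_Ioo r hmem
  · exact hc.continuousAt (isOpen_Ioo.mem_nhds hmem)

lemma radialVol_zero (n : ℕ) : radialVol n 0 = 0 := intervalIntegral.integral_same

lemma nonneg_of_hasDerivAt_nonneg {f f' : ℝ → ℝ} (h0 : f 0 = 0)
    (hf : ∀ r, 0 ≤ r → r < 1 → HasDerivAt f (f' r) r) (hf' : ∀ r, 0 ≤ r → r < 1 → 0 ≤ f' r)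
    {r : ℝ} (hr0 : 0 ≤ r) (hr : r < 1) : 0 ≤ f r := by
  have hmono : MonotoneOn f (Set.Ico 0 1) := by
    refine monotoneOn_of_deriv_nonneg (convex_Ico 0 1) ?_ ?_ ?_
    · exact fun t ht => (hf t ht.1 ht.2).continuousAt.continuousWithinAt
    · intro t ht
      rw [interior_Ico] at ht
      exact (hf t ht.1.le ht.2).differentiableAt.differentiableWithinAt
    · intro t ht
      rw [interior_Ico] at ht
      rw [(hf t ht.1.le ht.2).deriv]
      exact hf' t ht.1.le ht.2
  have := hmono ⟨le_rfl, one_pos⟩ ⟨hr0, hr⟩ hr0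
  rwa [h0] at this

lemma radialVol_nonneg (n : ℕ) {r : ℝ} (hr0 : 0 ≤ r) (hr : r < 1) : 0 ≤ radialVol n r := by
  refine nonneg_of_hasDerivAt_nonneg (radialVol_zero n)
    (fun r h0 h1 => hasDerivAt_radialVol n h0 h1) (fun r h0 h1 => ?_) hr0 hr
  have : 0 < 1 - r ^ 2 := by nlinarith
  positivity

lemma hasDerivAt_sinh_param {r : ℝ} (hr : 1 - r ^ 2 ≠ 0) :
    HasDerivAt (fun r : ℝ => 2 * r / (1 - r ^ 2))
      (2 / (1 - r ^ 2) * ((1 + r ^ 2) / (1 - r ^ 2))) r := by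
  have h := ((hasDerivAt_id r).const_mul 2).fun_div (((hasDerivAt_id r).fun_pow 2).const_sub 1) hr
  refine h.congr_deriv ?_
  simp only [id]
  field_simp
  ring

lemma hasDerivAt_cosh_param {r : ℝ} (hr : 1 - r ^ 2 ≠ 0) :
    HasDerivAt (fun r : ℝ => (1 + r ^ 2) / (1 - r ^ 2))
      (2 / (1 - r ^ 2) * (2 * r / (1 - r ^ 2))) r := by
  have h := (((hasDerivAt_id r).fun_pow 2).const_add 1).fun_div
    (((hasDerivAt_id r).fun_pow 2).const_sub 1) hr
  refine h.congr_deriv ?_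
  simp only [id]
  field_simp
  ring

section

variable {k : ℕ} {r : ℝ}

lemma hasDerivAt_radialVol' (k : ℕ) (hr0 : 0 ≤ r) (hr : r < 1) :
    HasDerivAt (radialVol (k + 2)) ((2 * r / (1 - r ^ 2)) ^ (k + 1) * (2 / (1 - r ^ 2))) r := by
  refine (hasDerivAt_radialVol (k + 2) hr0 hr).congr_deriv ?_
  have : 1 - r ^ 2 ≠ 0 := by nlinarith
  rw [show k + 2 - 1 = k + 1 from rfl, mul_div_right_comm, mul_pow]
  ring

lemma radialVol_le_sinh_pow (hr0 : 0 ≤ r) (hr : r < 1) :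
    ((k : ℝ) + 1) * radialVol (k + 2) r ≤ (2 * r / (1 - r ^ 2)) ^ (k + 1) := by
  rw [← sub_nonneg]
  refine nonneg_of_hasDerivAt_nonneg
    (f := fun r => (2 * r / (1 - r ^ 2)) ^ (k + 1) - ((k : ℝ) + 1) * radialVol (k + 2) r)
    (by simp [radialVol_zero])
    (fun r h0 h1 => ((hasDerivAt_sinh_param (by nlinarith)).fun_pow (k + 1)).sub
      ((hasDerivAt_radialVol' k h0 h1).const_mul _)) (fun r h0 h1 => ?_) hr0 hr
  have h2 : 0 < 1 - r ^ 2 := by nlinarith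
  have h3 : 2 * r / (1 - r ^ 2) ≤ (1 + r ^ 2) / (1 - r ^ 2) := by
    gcongr
    nlinarith [sq_nonneg (1 - r)]
  have h4 : 0 ≤ ((k : ℝ) + 1) * (2 * r / (1 - r ^ 2)) ^ k * (2 / (1 - r ^ 2)) := by positivity
  have h5 := mul_nonneg h4 (sub_nonneg.2 h3)
  rw [show k + 1 - 1 = k from rfl]
  push_cast
  refine h5.trans_eq ?_
  ring

lemma radialVol_second_order (hr0 : 0 ≤ r) (hr : r < 1) :
    0 ≤ (2 * r / (1 - r ^ 2)) ^ (k + 2) * ((1 + r ^ 2) / (1 - r ^ 2))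
      - ((k : ℝ) + 2) * radialVol (k + 2) r
      - (((k : ℝ) + 1) * radialVol (k + 2) r) ^ (((k : ℝ) + 3) / (k + 1)) := by
  have hk : (0 : ℝ) < (k : ℝ) + 1 := by positivity
  refine nonneg_of_hasDerivAt_nonneg
    (f := fun r => (2 * r / (1 - r ^ 2)) ^ (k + 2) * ((1 + r ^ 2) / (1 - r ^ 2))
      - ((k : ℝ) + 2) * radialVol (k + 2) r
      - (((k : ℝ) + 1) * radialVol (k + 2) r) ^ (((k : ℝ) + 3) / (k + 1)))
    ?_
    (fun r h0 h1 => ((((hasDerivAt_sinh_param (by nlinarith)).fun_pow (k + 2)).fun_mul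
      (hasDerivAt_cosh_param (by nlinarith))).sub
      ((hasDerivAt_radialVol' k h0 h1).const_mul _)).sub
      (((hasDerivAt_radialVol' k h0 h1).const_mul _).rpow_const (Or.inr ?_)))
      (fun r h0 h1 => ?_) hr0 hr
  · simp only [radialVol_zero, mul_zero]
    rw [Real.zero_rpow (by positivity)]
    simp
  · rw [le_div_iff₀ hk]; linarith
  have h2 : 0 < 1 - r ^ 2 := by nlinarith
  have hX := radialVol_nonneg (k + 2) h0 h1
  have h3 := radialVol_le_sinh_pow (k := k) h0 h1
  set S := 2 * r / (1 - r ^ 2) with hS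
  have hS0 : 0 ≤ S := by positivity
  set X := radialVol (k + 2) r
  set ω := 2 / (1 - r ^ 2) with hω
  have hω0 : 0 < ω := by positivity
  set C := (1 + r ^ 2) / (1 - r ^ 2) with hC
  have hC2 : C ^ 2 = 1 + S ^ 2 := by rw [hC, hS]; field_simp; ring
  have h4 : (((k : ℝ) + 1) * X) ^ (((k : ℝ) + 3) / (k + 1) - 1) ≤ S ^ 2 := by
    calc _ ≤ (S ^ (k + 1)) ^ (((k : ℝ) + 3) / (k + 1) - 1) := by
          refine Real.rpow_le_rpow (by positivity) h3 ?_
          rw [sub_nonneg, le_div_iff₀ hk]; linarith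
      _ = S ^ 2 := by
          rw [← Real.rpow_natCast, ← Real.rpow_mul hS0, ← Real.rpow_natCast]
          congr 1
          push_cast
          field_simp
          ring
  have h5 := mul_nonneg (by positivity : 0 ≤ ((k : ℝ) + 3) * S ^ (k + 1) * ω)
    (sub_nonneg.2 h4)
  refine h5.trans_eq ?_
  rw [show k + 2 - 1 = k + 1 from rfl]
  push_cast
  generalize (((k : ℝ) + 1) * X) ^ (((k : ℝ) + 3) / (k + 1) - 1) = R
  have h6 : ((k : ℝ) + 3) / (k + 1) * (k + 1) = k + 3 := by field_simp
  linear_combination (-((k : ℝ) + 2) * S ^ (k + 1) * ω) * hC2 + S ^ (k + 1) * ω * R * h6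

lemma radialVol_third_order (hr0 : 0 ≤ r) (hr : r < 1) :
    (((k : ℝ) + 2) * radialVol (k + 2) r) ^ 2
      + (((k : ℝ) + 1) * radialVol (k + 2) r) ^ (2 * ((k : ℝ) + 2) / (k + 1))
      ≤ (2 * r / (1 - r ^ 2)) ^ (2 * (k + 2)) := by
  have hk : (0 : ℝ) < (k : ℝ) + 1 := by positivity
  rw [← sub_nonneg, ← sub_sub]
  refine nonneg_of_hasDerivAt_nonneg
    (f := fun r => (2 * r / (1 - r ^ 2)) ^ (2 * (k + 2))
      - (((k : ℝ) + 2) * radialVol (k + 2) r) ^ 2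
      - (((k : ℝ) + 1) * radialVol (k + 2) r) ^ (2 * ((k : ℝ) + 2) / (k + 1)))
    ?_
    (fun r h0 h1 => (((hasDerivAt_sinh_param (by nlinarith)).fun_pow (2 * (k + 2))).sub
      (((hasDerivAt_radialVol' k h0 h1).const_mul _).fun_pow 2)).sub
      (((hasDerivAt_radialVol' k h0 h1).const_mul _).rpow_const (Or.inr ?_)))
      (fun r h0 h1 => ?_) hr0 hr
  · simp only [radialVol_zero, mul_zero]
    rw [Real.zero_rpow (by positivity)]
    simp
  · rw [le_div_iff₀ hk]; linarith
  have h2 : 0 < 1 - r ^ 2 := by nlinarith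
  have hX := radialVol_nonneg (k + 2) h0 h1
  have h3 := radialVol_second_order (k := k) h0 h1
  have h4 : 2 * ((k : ℝ) + 2) / (k + 1) - 1 = ((k : ℝ) + 3) / (k + 1) := by field_simp; ring
  rw [h4, show 2 * (k + 2) - 1 = (k + 2) + (k + 1) by omega]
  set S := 2 * r / (1 - r ^ 2) with hS
  have hS0 : 0 ≤ S := by positivity
  set X := radialVol (k + 2) r
  set ω := 2 / (1 - r ^ 2) with hω
  have hω0 : 0 < ω := by positivity
  have h5 := mul_nonneg (by positivity : 0 ≤ 2 * ((k : ℝ) + 2) * S ^ (k + 1) * ω) h3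
  refine h5.trans_eq ?_
  push_cast
  generalize (((k : ℝ) + 1) * X) ^ (((k : ℝ) + 3) / (k + 1)) = R
  have h6 : 2 * ((k : ℝ) + 2) / (k + 1) * (k + 1) = 2 * (k + 2) := by field_simp
  rw [pow_add]
  linear_combination S ^ (k + 1) * ω * R * h6

end

lemma rpow_add_rpow_le_of_le {α β γ p₀ p : ℝ} (hα : 0 ≤ α) (hβ : 0 ≤ β) (hγ : 0 ≤ γ)
    (hp₀ : 0 < p₀) (hp : p₀ ≤ p) (h : α ^ p₀ + β ^ p₀ ≤ γ ^ p₀) : α ^ p + β ^ p ≤ γ ^ p := by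
  have h1 : 1 ≤ p / p₀ := by rwa [le_div_iff₀ hp₀, one_mul]
  have e : ∀ t : ℝ, 0 ≤ t → t ^ p = (t ^ p₀) ^ (p / p₀) := fun t ht => by
    rw [← Real.rpow_mul ht, mul_div_cancel₀ _ hp₀.ne']
  rw [e α hα, e β hβ, e γ hγ]
  exact (Real.add_rpow_le_rpow_add (Real.rpow_nonneg hα _) (Real.rpow_nonneg hβ _) h1).trans
    (Real.rpow_le_rpow (by positivity) h (by positivity))

lemma isoProfile_radialVol_le {n : ℕ} (hn : 2 ≤ n) {p : ℝ}
    (hp : 2 * (n : ℝ) / ((n : ℝ) - 1) ≤ p) {r : ℝ} (hr0 : 0 ≤ r) (hr : r < 1) :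
    isoProfile n p (n * unitBallVol n * radialVol n r)
      ≤ n * unitBallVol n * (2 * r / (1 - r ^ 2)) ^ (n - 1) := by
  obtain ⟨k, rfl⟩ : ∃ k, n = k + 2 := ⟨n - 2, by omega⟩
  have hσ := unitBallVol_pos (k + 2)
  have hX := radialVol_nonneg (k + 2) hr0 hr
  have h3 := radialVol_third_order (k := k) hr0 hr
  have h2 : 0 < 1 - r ^ 2 := by nlinarith
  have hk : (0 : ℝ) < (k : ℝ) + 1 := by positivity
  have hk2 : (0 : ℝ) < (k : ℝ) + 2 := by positivity
  rw [show k + 2 - 1 = k + 1 from rfl]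
  set S := 2 * r / (1 - r ^ 2) with hS
  have hS0 : 0 ≤ S := by positivity
  set X := radialVol (k + 2) r
  set σ := unitBallVol (k + 2)
  have hnk : ((k + 2 : ℕ) : ℝ) = (k : ℝ) + 2 := by push_cast; ring
  have hnk1 : (k : ℝ) + 2 - 1 = k + 1 := by ring
  rw [hnk, hnk1] at hp
  have hp0 : 0 < 2 * ((k : ℝ) + 2) / (k + 1) := by positivity
  have hpp : 0 < p := hp0.trans_le hp
  set α := (((k : ℝ) + 2) * X) ^ (((k : ℝ) + 1) / (k + 2)) with hα
  have ha : euclProfile (k + 2) (((k + 2 : ℕ) : ℝ) * σ * X) = (((k : ℝ) + 2) * σ) * α := by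
    rw [euclProfile, hnk, show 1 - 1 / ((k : ℝ) + 2) = ((k : ℝ) + 1) / (k + 2) by field_simp; ring,
      show ((k : ℝ) + 2) * σ * X = σ * (((k : ℝ) + 2) * X) by ring,
      Real.mul_rpow hσ.le (by positivity)]
    have : σ ^ (1 / ((k : ℝ) + 2)) * σ ^ (((k : ℝ) + 1) / (k + 2)) = σ := by
      rw [← Real.rpow_add hσ, ← add_div, show 1 + ((k : ℝ) + 1) = k + 2 by ring,
        div_self hk2.ne', Real.rpow_one]
    change _ * σ ^ (1 / ((k : ℝ) + 2)) * _ = _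
    linear_combination ((k : ℝ) + 2) * α * this
  have hmain : α ^ p + (((k : ℝ) + 1) * X) ^ p ≤ (S ^ (k + 1)) ^ p := by
    refine rpow_add_rpow_le_of_le (by positivity) (by positivity) (by positivity) hp0 hp ?_
    have e1 : α ^ (2 * ((k : ℝ) + 2) / (k + 1)) = (((k : ℝ) + 2) * X) ^ 2 := by
      rw [hα, ← Real.rpow_mul (by positivity), ← Real.rpow_natCast]
      congr 1
      push_cast
      field_simp
    have e2 : (S ^ (k + 1)) ^ (2 * ((k : ℝ) + 2) / (k + 1)) = S ^ (2 * (k + 2)) := by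
      rw [← Real.rpow_natCast, ← Real.rpow_mul hS0, ← Real.rpow_natCast]
      congr 1
      push_cast
      field_simp
    rw [e1, e2]
    exact h3
  rw [isoProfile, ha, hnk, hnk1,
    show ((k : ℝ) + 1) * (((k : ℝ) + 2) * σ * X)
      = (((k : ℝ) + 2) * σ) * (((k : ℝ) + 1) * X) by ring,
    Real.mul_rpow (x := ((k : ℝ) + 2) * σ) (y := α) (by positivity) (by positivity),
    Real.mul_rpow (x := ((k : ℝ) + 2) * σ) (y := ((k : ℝ) + 1) * X) (by positivity)
      (by positivity), ← mul_add, Real.mul_rpow (by positivity) (by positivity),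
      ← Real.rpow_mul (by positivity),
    mul_one_div_cancel hpp.ne', Real.rpow_one]
  refine mul_le_mul_of_nonneg_left ?_ (by positivity)
  calc _ ≤ ((S ^ (k + 1)) ^ p) ^ (1 / p) := Real.rpow_le_rpow (by positivity) hmain (by positivity)
    _ = _ := by rw [← Real.rpow_mul (by positivity), mul_one_div_cancel hpp.ne', Real.rpow_one]

lemma hypVol_closedBall {n : ℕ} (hn : 0 < n) {r : ℝ} (hr0 : 0 ≤ r) (hr : r < 1) :
    hypVol n (Metric.closedBall 0 r) = ENNReal.ofReal (n * unitBallVol n * radialVol n r) := by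
  have : Nonempty (Fin n) := ⟨⟨0, hn⟩⟩
  have hsub : Metric.closedBall (0 : EuclideanSpace ℝ (Fin n)) r ⊆ Metric.ball 0 1 :=
    Metric.closedBall_subset_ball hr
  have hc : ContinuousOn (fun x : EuclideanSpace ℝ (Fin n) => (2 / (1 - ‖x‖ ^ 2)) ^ n)
      (Metric.closedBall 0 r) := by
    refine ContinuousOn.pow (ContinuousOn.div (by fun_prop) (by fun_prop) ?_) n
    intro x hx
    have := mem_closedBall_zero_iff.1 hx
    nlinarith [norm_nonneg x]
  rw [hypVol_apply measurableSet_closedBall, Set.inter_eq_self_of_subset_left hsub,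
    ← ofReal_integral_eq_lintegral_ofReal (hc.integrableOn_compact (isCompact_closedBall 0 r))]
  swap
  · filter_upwards [ae_restrict_mem measurableSet_closedBall] with x hx
    have := mem_closedBall_zero_iff.1 hx
    have : 0 < 1 - ‖x‖ ^ 2 := by nlinarith [norm_nonneg x]
    exact pow_nonneg (by positivity) n
  congr 1
  have h1 : ∫ x in Metric.closedBall (0 : EuclideanSpace ℝ (Fin n)) r, (2 / (1 - ‖x‖ ^ 2)) ^ n
      = ∫ x : EuclideanSpace ℝ (Fin n),
        (Set.Iic r).indicator (fun t : ℝ => (2 / (1 - t ^ 2)) ^ n) ‖x‖ := by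
    rw [← integral_indicator measurableSet_closedBall]
    congr 1
    ext x
    by_cases hx : ‖x‖ ≤ r
    · rw [Set.indicator_of_mem (mem_closedBall_zero_iff.2 hx),
        Set.indicator_of_mem (Set.mem_Iic.2 hx)]
    · rw [Set.indicator_of_notMem (fun h => hx (mem_closedBall_zero_iff.1 h)),
        Set.indicator_of_notMem (fun h => hx (Set.mem_Iic.1 h))]
  rw [h1, integral_fun_norm_addHaar, finrank_euclideanSpace_fin]
  have h2 : (volume : Measure (EuclideanSpace ℝ (Fin n))).real (Metric.ball 0 1)
      = unitBallVol n := by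
    rw [Measure.real, EuclideanSpace.volume_ball, Fintype.card_fin, ENNReal.ofReal_one, one_pow,
      one_mul, ENNReal.toReal_ofReal (div_nonneg (by positivity)
        (Real.Gamma_pos_of_pos (by positivity)).le), unitBallVol, Real.sqrt_eq_rpow,
      ← Real.rpow_mul_natCast Real.pi_pos.le]
    congr 2
    ring
  have h3 : ∫ y in Set.Ioi (0 : ℝ), y ^ (n - 1) • (Set.Iic r).indicator
      (fun t : ℝ => (2 / (1 - t ^ 2)) ^ n) y = radialVol n r := by
    rw [radialVol, intervalIntegral.integral_of_le hr0, ← Set.Ioi_inter_Iic,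
      ← setIntegral_indicator measurableSet_Iic]
    congr 1
    ext y
    by_cases hy : y ∈ Set.Iic r <;> simp [hy]
  rw [h2, h3, nsmul_eq_mul, smul_eq_mul, mul_assoc]

end BallVolume

section Neighbourhoods

variable {n : ℕ}

lemma isoProfile_zero (hn : 2 ≤ n) {p : ℝ} (hp : 0 < p) : isoProfile n p 0 = 0 := by
  have hn' : (2 : ℝ) ≤ n := by exact_mod_cast hn
  have h1 : 1 - 1 / (n : ℝ) ≠ 0 := by
    rw [sub_ne_zero, ne_eq, eq_comm, div_eq_iff (by positivity)]
    linarith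
  rw [isoProfile, euclProfile, Real.zero_rpow h1, mul_zero, mul_zero, Real.zero_rpow hp.ne',
    add_zero, Real.zero_rpow (by positivity)]

lemma mul_sinh_pow_le_radialVol_sub (hn : 1 ≤ n) {r θ : ℝ} (hr0 : 0 ≤ r) (hr : r < 1) (hθ : 0 ≤ θ)
    (hr' : r + θ * (1 - r ^ 2) < 1) :
    2 * θ * (2 * r / (1 - r ^ 2)) ^ (n - 1)
      ≤ radialVol n (r + θ * (1 - r ^ 2)) - radialVol n r := by
  obtain ⟨m, rfl⟩ : ∃ m, n = m + 1 := ⟨n - 1, by omega⟩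
  have h2 : 0 < 1 - r ^ 2 := by nlinarith
  have hle : r ≤ r + θ * (1 - r ^ 2) := by nlinarith
  have key := (convex_Icc r (r + θ * (1 - r ^ 2))).mul_sub_le_image_sub_of_le_deriv
    (f := radialVol (m + 1)) (C := r ^ m * (2 / (1 - r ^ 2)) ^ (m + 1)) ?_ ?_ ?_
    r ⟨le_rfl, hle⟩ _ ⟨hle, le_rfl⟩ hle
  · refine le_trans (le_of_eq ?_) key
    rw [show m + 1 - 1 = m from rfl, mul_div_right_comm, mul_pow, add_sub_cancel_left, pow_succ]
    have : 2 / (1 - r ^ 2) * (1 - r ^ 2) = 2 := div_mul_cancel₀ _ h2.ne'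
    linear_combination (-θ * (2 / (1 - r ^ 2)) ^ m * r ^ m) * this
  · exact fun t ht => (hasDerivAt_radialVol _ (hr0.trans ht.1)
      (ht.2.trans_lt hr')).continuousAt.continuousWithinAt
  · intro t ht
    rw [interior_Icc] at ht
    exact (hasDerivAt_radialVol _ (hr0.trans ht.1.le)
      (ht.2.trans hr')).differentiableAt.differentiableWithinAt
  · intro t ht
    rw [interior_Icc] at ht
    have ht1 := ht.2.trans hr'
    rw [(hasDerivAt_radialVol _ (hr0.trans ht.1.le) ht1).deriv, show m + 1 - 1 = m from rfl]
    have h3 : 0 < 1 - t ^ 2 := by nlinarith [ht.1]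
    have h4 : r ^ 2 ≤ t ^ 2 := pow_le_pow_left₀ hr0 ht.1.le 2
    have h5 : 2 / (1 - r ^ 2) ≤ 2 / (1 - t ^ 2) :=
      div_le_div_of_nonneg_left (by norm_num) h3 (by linarith)
    exact mul_le_mul (pow_le_pow_left₀ hr0 ht.1.le m)
      (pow_le_pow_left₀ (by positivity) h5 _) (by positivity)
      (pow_nonneg (hr0.trans ht.1.le) m)

lemma one_sub_sq_ge {r θ : ℝ} (hr0 : 0 ≤ r) (hr : r < 1) (hθ : 0 ≤ θ) (hθ1 : θ ≤ 1) :
    (1 - 2 * θ) * (1 - r ^ 2) ≤ 1 - (r + θ * (1 - r ^ 2)) ^ 2 := by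
  have h2 : 0 < 1 - r ^ 2 := by nlinarith
  have h3 : 0 ≤ 2 - 2 * r - θ * (1 - r ^ 2) := by nlinarith
  have := mul_nonneg (mul_nonneg hθ h2.le) h3
  nlinarith

lemma closedBall_subset_hypNbhd {E : Type*} [NormedAddCommGroup E] [NormedSpace ℝ E]
    {ε r : ℝ} (hε0 : 0 < ε) (hε : ε < 1 / 2) (hr0 : 0 < r) (hr : r < 1) :
    Metric.closedBall (0 : E) (r + ε * (1 - 2 * ε) * (1 - r ^ 2))
      ⊆ hypNbhd ε (Metric.closedBall (0 : E) r) := by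
  set θ := ε * (1 - 2 * ε) with hθ
  have hθ0 : 0 < θ := mul_pos hε0 (by linarith)
  have hθ1 : θ < 1 / 2 := by nlinarith
  have h2 : 0 < 1 - r ^ 2 := by nlinarith
  have h3 := one_sub_sq_ge hr0.le hr hθ0.le (by linarith)
  have h4 : 0 < (1 - 2 * θ) * (1 - r ^ 2) := mul_pos (by linarith) h2
  intro x hx
  have hx' := mem_closedBall_zero_iff.1 hx
  have hx2 : ‖x‖ ^ 2 ≤ (r + θ * (1 - r ^ 2)) ^ 2 := pow_le_pow_left₀ (norm_nonneg x) hx' 2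
  have hx1 : 0 < 1 - ‖x‖ ^ 2 := by linarith
  refine ⟨by nlinarith [norm_nonneg x], ?_⟩
  rcases le_or_gt ‖x‖ r with hxr | hxr
  · refine ⟨x, mem_closedBall_zero_iff.2 hxr, ?_⟩
    rw [HypNear, sub_self, norm_zero, zero_pow two_ne_zero]
    positivity
  · have hx0 : 0 < ‖x‖ := hr0.trans hxr
    have hny : ‖(r / ‖x‖) • x‖ = r := by
      rw [norm_smul, Real.norm_eq_abs, abs_of_pos (by positivity), div_mul_cancel₀ _ hx0.ne']
    refine ⟨(r / ‖x‖) • x, mem_closedBall_zero_iff.2 hny.le, ?_⟩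
    have hxy : ‖x - (r / ‖x‖) • x‖ = ‖x‖ - r := by
      have : x - (r / ‖x‖) • x = (1 - r / ‖x‖) • x := by rw [sub_smul, one_smul]
      rw [this, norm_smul, Real.norm_eq_abs, abs_of_nonneg, sub_mul, one_mul,
        div_mul_cancel₀ _ hx0.ne']
      rw [sub_nonneg, div_le_one hx0]
      exact hxr.le
    rw [HypNear, hxy, hny]
    calc (‖x‖ - r) ^ 2 ≤ (θ * (1 - r ^ 2)) ^ 2 :=
          pow_le_pow_left₀ (by linarith) (by linarith) 2
      _ = θ ^ 2 * (1 - r ^ 2) ^ 2 := by ring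
      _ < ε ^ 2 * (1 - 2 * θ) * (1 - r ^ 2) ^ 2 := by
          refine mul_lt_mul_of_pos_right ?_ (by positivity)
          have : ε ^ 2 * (1 - 2 * θ) - θ ^ 2 = ε ^ 2 * (2 * ε) := by rw [hθ]; ring
          have : 0 < ε ^ 2 * (2 * ε) := by positivity
          linarith
      _ = ε ^ 2 * (((1 - 2 * θ) * (1 - r ^ 2)) * (1 - r ^ 2)) := by ring
      _ ≤ ε ^ 2 * ((1 - ‖x‖ ^ 2) * (1 - r ^ 2)) := by
          gcongr
          linarith

lemma exists_subset_closedBall {A : Set (EuclideanSpace ℝ (Fin n))} (hA : IsCompact A)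
    (hA1 : A ⊆ Metric.ball 0 1) : ∃ ρ : ℝ, 0 < ρ ∧ ρ < 1 ∧ A ⊆ Metric.closedBall 0 ρ := by
  obtain ⟨ρ, hρ, hAρ⟩ := exists_lt_subset_ball hA.isClosed hA1
  refine ⟨max ρ (1 / 2), by positivity, max_lt hρ (by norm_num), ?_⟩
  exact hAρ.trans (Metric.ball_subset_closedBall.trans
    (Metric.closedBall_subset_closedBall (le_max_left _ _)))

theorem isoProfile_le_hypVol_hypNbhd (hn : 2 ≤ n) {p : ℝ}
    (hp : 2 * (n : ℝ) / ((n : ℝ) - 1) ≤ p) {A : Set (EuclideanSpace ℝ (Fin n))}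
    (hA : IsCompact A) (hA1 : A ⊆ Metric.ball 0 1) {v : ℝ} (hv0 : 0 ≤ v)
    (hv : ENNReal.ofReal v ≤ hypVol n A) {ε : ℝ} (hε0 : 0 < ε) (hε : ε < 1 / 2) :
    ENNReal.ofReal (v + 2 * ε * (1 - 2 * ε) * isoProfile n p v) ≤ hypVol n (hypNbhd ε A) := by
  have hn' : (2 : ℝ) ≤ n := by exact_mod_cast hn
  have hp0 : 0 < p := lt_of_lt_of_le (div_pos (by linarith) (by linarith)) hp
  rcases hv0.eq_or_lt with rfl | hvpos
  · simp [isoProfile_zero hn hp0]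
  have hnσ : 0 < n * unitBallVol n := mul_pos (by linarith) (unitBallVol_pos n)
  obtain ⟨ρ, hρ0, hρ1, hAρ⟩ := exists_subset_closedBall hA hA1
  have hvρ : v ≤ n * unitBallVol n * radialVol n ρ := by
    have := hv.trans (measure_mono hAρ)
    rw [hypVol_closedBall (by omega) hρ0.le hρ1] at this
    exact (ENNReal.ofReal_le_ofReal_iff
      (mul_nonneg hnσ.le (radialVol_nonneg n hρ0.le hρ1))).1 this
  obtain ⟨r, ⟨hr0, hrρ⟩, hr⟩ : v ∈ (fun r => n * unitBallVol n * radialVol n r) '' Set.Icc 0 ρ := by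
    refine intermediate_value_Icc hρ0.le ?_ ⟨by simpa [radialVol_zero] using hv0, hvρ⟩
    exact continuousOn_const.mul fun t ht => (hasDerivAt_radialVol n ht.1
      (ht.2.trans_lt hρ1)).continuousAt.continuousWithinAt
  have hr : n * unitBallVol n * radialVol n r = v := hr
  have hr1 : r < 1 := hrρ.trans_lt hρ1
  have hrpos : 0 < r := by
    rcases hr0.eq_or_lt with rfl | h
    · rw [radialVol_zero, mul_zero] at hr
      exact absurd hr hvpos.ne
    · exact h
  set θ := ε * (1 - 2 * ε) with hθ
  have hθ0 : 0 < θ := mul_pos hε0 (by linarith)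
  have hθ1 : θ < 1 / 2 := by nlinarith
  have h2 : 0 < 1 - r ^ 2 := by nlinarith
  have h3 := one_sub_sq_ge hr0 hr1 hθ0.le (by linarith)
  have h4 : 0 < (1 - 2 * θ) * (1 - r ^ 2) := mul_pos (by linarith) h2
  have hr'0 : 0 ≤ r + θ * (1 - r ^ 2) := by positivity
  have hr'1 : r + θ * (1 - r ^ 2) < 1 := by nlinarith
  calc ENNReal.ofReal (v + 2 * ε * (1 - 2 * ε) * isoProfile n p v)
      ≤ ENNReal.ofReal (n * unitBallVol n * radialVol n (r + θ * (1 - r ^ 2))) := by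
        refine ENNReal.ofReal_le_ofReal ?_
        have h5 := isoProfile_radialVol_le hn hp hr0 hr1
        rw [hr] at h5
        have h6 := mul_sinh_pow_le_radialVol_sub (n := n) (by omega) hr0 hr1 hθ0.le hr'1
        have h7 := mul_le_mul_of_nonneg_left h6 hnσ.le
        have h8 := mul_le_mul_of_nonneg_left h5 (by positivity : 0 ≤ 2 * θ)
        rw [show 2 * ε * (1 - 2 * ε) = 2 * θ by rw [hθ]; ring]
        linarith
    _ = hypVol n (Metric.closedBall 0 (r + θ * (1 - r ^ 2))) :=
        (hypVol_closedBall (by omega) hr'0 hr'1).symm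
    _ ≤ hypVol n (hypNbhd ε (Metric.closedBall 0 r)) :=
        measure_mono (closedBall_subset_hypNbhd hε0 hε hrpos hr1)
    _ ≤ hypVol n (hypNbhd ε A) := by
        refine hypVol_hypNbhd_closedBall_le hA hA1 hrpos hr1 ?_ ε
        rw [hypVol_closedBall (by omega) hr0 hr1, hr]
        exact hv

end Neighbourhoods

section Coarea

open Filter Topology

lemma lintegral_mul_measure_section {α β : Type*} [MeasurableSpace α] [MeasurableSpace β]
    (ν : Measure α) (μ : Measure β) [SFinite ν] [SFinite μ] {h : α → ENNReal} (hh : Measurable h)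
    {P : Set (α × β)} (hP : MeasurableSet P) :
    ∫⁻ s, h s * μ (Prod.mk s ⁻¹' P) ∂ν = ∫⁻ x, ∫⁻ s in {s | (s, x) ∈ P}, h s ∂ν ∂μ := by
  have h1 : ∀ s, h s * μ (Prod.mk s ⁻¹' P) = ∫⁻ x, P.indicator (fun q => h q.1) (s, x) ∂μ := by
    intro s
    have : (fun x => P.indicator (fun q => h q.1) (s, x))
        = (Prod.mk s ⁻¹' P).indicator fun _ => h s := by
      ext x
      by_cases hx : (s, x) ∈ P <;> simp [hx]
    rw [this, lintegral_indicator_const (measurable_prodMk_left hP)]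
  simp_rw [h1]
  rw [lintegral_lintegral_swap (f := fun s x => P.indicator (fun q => h q.1) (s, x))
    ((hh.comp measurable_fst).indicator hP).aemeasurable]
  refine lintegral_congr fun x => ?_
  rw [← lintegral_indicator (show MeasurableSet {s | (s, x) ∈ P} from measurable_prodMk_right hP)]
  refine lintegral_congr fun s => ?_
  by_cases hx : (s, x) ∈ P <;> simp [hx]

variable {n : ℕ} {u : EuclideanSpace ℝ (Fin n) → ℝ}

lemma hasCompactSupport_of_tsupport_subset_ball
    (hsupp : tsupport u ⊆ Metric.ball (0 : EuclideanSpace ℝ (Fin n)) 1) : HasCompactSupport u :=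
  Metric.isCompact_of_isClosed_isBounded (isClosed_tsupport u) (Metric.isBounded_ball.subset hsupp)

lemma exists_taylor_bound {E : Type*} [NormedAddCommGroup E] [NormedSpace ℝ E] {u : E → ℝ}
    (hu : ContDiff ℝ (⊤ : ℕ∞) u) (hc : HasCompactSupport u) :
    ∃ C : ℝ, 0 ≤ C ∧ ∀ x y, |u y - u x| ≤ ‖fderiv ℝ u x‖ * ‖y - x‖ + C * ‖y - x‖ ^ 2 := by
  have h1 : ContDiff ℝ 1 (fderiv ℝ u) :=
    hu.fderiv_right (by
      rw [one_add_one_eq_two]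
      exact WithTop.coe_le_coe.2 (le_top : (2 : ℕ∞) ≤ ⊤))
  obtain ⟨C, hC⟩ := h1.lipschitzWith_of_hasCompactSupport (hc.fderiv (𝕜 := ℝ)) one_ne_zero
  refine ⟨C, C.2, fun x y => ?_⟩
  have hd : Differentiable ℝ u := hu.differentiable (by simp)
  have h2 := (convex_closedBall x ‖y - x‖).norm_image_sub_le_of_norm_hasFDerivWithin_le'
    (f := u) (f' := fderiv ℝ u) (φ := fderiv ℝ u x) (C := C * ‖y - x‖)
    (fun z _ => (hd z).hasFDerivAt.hasFDerivWithinAt) (fun z hz => ?_)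
    (Metric.mem_closedBall_self (norm_nonneg _)) (y := y) (by simp [dist_eq_norm])
  · have h3 := (fderiv ℝ u x).le_opNorm (y - x)
    have h4 := norm_add_le (u y - u x - fderiv ℝ u x (y - x)) (fderiv ℝ u x (y - x))
    rw [sub_add_cancel] at h4
    rw [← Real.norm_eq_abs]
    calc _ ≤ _ := h4
      _ ≤ C * ‖y - x‖ * ‖y - x‖ + ‖fderiv ℝ u x‖ * ‖y - x‖ := add_le_add h2 h3
      _ = _ := by ring
  · rw [← dist_eq_norm]
    exact (hC.dist_le_mul z x).trans
      (mul_le_mul_of_nonneg_left (by simpa [dist_eq_norm] using hz) C.2)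

/-- The oscillation of `u` at `x` at hyperbolic scale `ε`, divided by `ε`, is at most this. -/
noncomputable def slopeBound {E : Type*} [NormedAddCommGroup E] [NormedSpace ℝ E] (u : E → ℝ)
    (C ε : ℝ) (x : E) : ℝ :=
  ‖fderiv ℝ u x‖ * √((1 - ‖x‖ ^ 2) * (1 - ‖x‖ ^ 2 + 2 * ε)) + C * ε

lemma norm_sub_le_of_hypNear {E : Type*} [NormedAddCommGroup E] {ε : ℝ} (hε : 0 < ε) {x y : E}
    (hx : ‖x‖ < 1) (hy : ‖y‖ < 1) (h : HypNear ε x y) :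
    ‖y - x‖ ≤ ε ∧ ‖y - x‖ ≤ ε * √((1 - ‖x‖ ^ 2) * (1 - ‖x‖ ^ 2 + 2 * ε)) := by
  have hx2 : 0 < 1 - ‖x‖ ^ 2 := by nlinarith [norm_nonneg x]
  have hy2 : 0 < 1 - ‖y‖ ^ 2 := by nlinarith [norm_nonneg y]
  have hxn := norm_nonneg x
  have hyn := norm_nonneg y
  unfold HypNear at h
  rw [norm_sub_rev] at h
  have h1 : ‖y - x‖ ≤ ε := by
    refine (sq_le_sq₀ (norm_nonneg _) hε.le).1 (h.le.trans ?_)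
    have : (1 - ‖x‖ ^ 2) * (1 - ‖y‖ ^ 2) ≤ 1 :=
      mul_le_one₀ (by nlinarith) hy2.le (by nlinarith)
    nlinarith [sq_nonneg ε]
  refine ⟨h1, ?_⟩
  have h2 : ‖x‖ ≤ ‖y‖ + ‖y - x‖ := by
    have := norm_sub_le y (y - x)
    simpa using this
  have h3 : 1 - ‖y‖ ^ 2 ≤ 1 - ‖x‖ ^ 2 + 2 * ε := by nlinarith
  have h4 : ε * √((1 - ‖x‖ ^ 2) * (1 - ‖x‖ ^ 2 + 2 * ε))
      = √(ε ^ 2 * ((1 - ‖x‖ ^ 2) * (1 - ‖x‖ ^ 2 + 2 * ε))) := by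
    rw [Real.sqrt_mul (sq_nonneg ε), Real.sqrt_sq hε.le]
  rw [h4]
  refine Real.le_sqrt_of_sq_le (h.le.trans ?_)
  gcongr

lemma hypNbhd_superlevel_subset {C : ℝ} (hC : 0 ≤ C)
    (hT : ∀ x y, |u y - u x| ≤ ‖fderiv ℝ u x‖ * ‖y - x‖ + C * ‖y - x‖ ^ 2) {ρ : ℝ}
    (hρ : tsupport u ⊆ Metric.closedBall 0 ρ) (hρ1 : ρ < 1) {ε s : ℝ} (hε : 0 < ε) (hs : 0 < s)
    (hερ : ε ≤ (1 - ρ) / 2) :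
    hypNbhd ε {x | s ≤ |u x|} ⊆
      {x | s ≤ |u x| + ε * slopeBound u C ε x} ∩ Metric.closedBall 0 ((1 + ρ) / 2) := by
  rintro x ⟨hx, y, hy, hxy⟩
  have hy : s ≤ |u y| := hy
  have hyρ : ‖y‖ ≤ ρ := by
    refine mem_closedBall_zero_iff.1 (hρ (subset_tsupport u ?_))
    intro h
    rw [h, abs_zero] at hy
    linarith
  obtain ⟨h1, h2⟩ := norm_sub_le_of_hypNear hε hx (hyρ.trans_lt hρ1) hxy
  constructor
  · have h3 := hT x y
    have h4 : |u y| ≤ |u x| + |u y - u x| := by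
      have := abs_add_le (u x) (u y - u x)
      rwa [add_sub_cancel] at this
    have h5 : ‖fderiv ℝ u x‖ * ‖y - x‖
        ≤ ‖fderiv ℝ u x‖ * (ε * √((1 - ‖x‖ ^ 2) * (1 - ‖x‖ ^ 2 + 2 * ε))) :=
      mul_le_mul_of_nonneg_left h2 (norm_nonneg _)
    have h6 : C * ‖y - x‖ ^ 2 ≤ C * ε ^ 2 :=
      mul_le_mul_of_nonneg_left (pow_le_pow_left₀ (norm_nonneg _) h1 2) hC
    change s ≤ |u x| + ε * slopeBound u C ε x
    unfold slopeBound
    linarith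
  · refine mem_closedBall_zero_iff.2 ?_
    have : ‖x‖ ≤ ‖y‖ + ‖y - x‖ := by
      have := norm_sub_le y (y - x)
      simpa using this
    linarith

/-- The distribution function of `|u|` for the hyperbolic volume. -/
noncomputable def distrib (u : EuclideanSpace ℝ (Fin n) → ℝ) (s : ℝ) : ℝ :=
  (hypVol n {x | s < |u x|}).toReal

lemma hypVol_superlevel_lt_top (hsupp : tsupport u ⊆ Metric.ball 0 1) {s : ℝ} (hs : 0 ≤ s) :
    hypVol n {x | s < |u x|} < ⊤ := by
  obtain ⟨ρ, _, hρ1, hρ⟩ := exists_subset_closedBall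
    (hasCompactSupport_of_tsupport_subset_ball hsupp) hsupp
  refine (measure_mono ?_).trans_lt (hypVol_closedBall_lt_top hρ1)
  intro x hx
  refine hρ (subset_tsupport u fun h => ?_)
  have hx : s < |u x| := hx
  rw [h, abs_zero] at hx
  linarith

lemma measurable_hypVol_superlevel (u : EuclideanSpace ℝ (Fin n) → ℝ) :
    Measurable fun s : ℝ => hypVol n {x | s < |u x|} :=
  Antitone.measurable fun _ _ h => measure_mono fun _ hx => h.trans_lt hx

lemma measurable_distrib (u : EuclideanSpace ℝ (Fin n) → ℝ) : Measurable (distrib u) :=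
  (measurable_hypVol_superlevel u).ennreal_toReal

lemma measurable_isoProfile (n : ℕ) (p : ℝ) : Measurable (isoProfile n p) := by
  unfold isoProfile euclProfile
  fun_prop

instance : SFinite (hypVol n) := by
  unfold hypVol
  infer_instance

lemma isCompact_superlevel (hu : Continuous u) (hc : HasCompactSupport u) {s : ℝ} (hs : 0 < s) :
    IsCompact {x | s ≤ |u x|} ∧ {x | s ≤ |u x|} ⊆ tsupport u := by
  have hsub : {x | s ≤ |u x|} ⊆ tsupport u := by
    intro x hx
    refine subset_tsupport u fun h => ?_
    have hx : s ≤ |u x| := hx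
    rw [h, abs_zero] at hx
    linarith
  exact ⟨hc.of_isClosed_subset (isClosed_le continuous_const hu.abs) hsub, hsub⟩

lemma measurable_slopeBound (hu : ContDiff ℝ (⊤ : ℕ∞) u) (C ε : ℝ) :
    Measurable (slopeBound u C ε) := by
  have : Continuous (fderiv ℝ u) := hu.continuous_fderiv (by simp)
  unfold slopeBound
  fun_prop

/-- The isoperimetric inequality for neighbourhoods of superlevel sets, integrated in the level. -/
lemma lintegral_isoProfile_distrib_le_of_scale (hn : 2 ≤ n) {p : ℝ}
    (hp : 2 * (n : ℝ) / ((n : ℝ) - 1) ≤ p) (hu : ContDiff ℝ (⊤ : ℕ∞) u)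
    (hsupp : tsupport u ⊆ Metric.ball 0 1) {C : ℝ} (hC : 0 ≤ C)
    (hT : ∀ x y, |u y - u x| ≤ ‖fderiv ℝ u x‖ * ‖y - x‖ + C * ‖y - x‖ ^ 2) {ρ : ℝ}
    (hρ : tsupport u ⊆ Metric.closedBall 0 ρ) (hρ1 : ρ < 1) {ε : ℝ} (hε : 0 < ε)
    (hε2 : ε < 1 / 2) (hερ : ε ≤ (1 - ρ) / 2) {h : ℝ → ENNReal} (hh : Measurable h)
    (hbd : ∀ T : ℝ, ∃ Λ : ENNReal, Λ ≠ ⊤ ∧ ∀ s, 0 ≤ s → s ≤ T → h s ≤ Λ) :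
    ENNReal.ofReal (2 * (1 - 2 * ε)) *
        ∫⁻ s in Set.Ioi 0, h s * ENNReal.ofReal (isoProfile n p (distrib u s))
      ≤ ∫⁻ x in Metric.closedBall 0 ((1 + ρ) / 2), (ENNReal.ofReal ε)⁻¹ *
          (∫⁻ s in Set.Icc |u x| (|u x| + ε * slopeBound u C ε x), h s) ∂hypVol n := by
  have hcs := hasCompactSupport_of_tsupport_subset_ball hsupp
  have huc : Continuous u := hu.continuous
  set K' : Set (EuclideanSpace ℝ (Fin n)) := Metric.closedBall 0 ((1 + ρ) / 2) with hK'
  have hK'm : MeasurableSet K' := measurableSet_closedBall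
  have hK'fin : hypVol n K' < ⊤ := hypVol_closedBall_lt_top (by linarith)
  set J := ∫⁻ s in Set.Ioi 0, h s * ENNReal.ofReal (isoProfile n p (distrib u s)) with hJ
  set I0 := ∫⁻ s in Set.Ioi 0, h s * hypVol n {x | s < |u x|} with hI0
  have hDm := measurable_slopeBound hu C ε
  have hI0eq : I0 = ∫⁻ x in K', (∫⁻ s in Set.Ioo 0 |u x|, h s) ∂hypVol n := by
    have hP : MeasurableSet {q : ℝ × EuclideanSpace ℝ (Fin n) | q.1 < |u q.2|} :=
      measurableSet_lt measurable_fst (huc.abs.measurable.comp measurable_snd)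
    have := lintegral_mul_measure_section (volume.restrict (Set.Ioi (0 : ℝ)))
      ((hypVol n).restrict K') hh hP
    have e1 : I0 = ∫⁻ s in Set.Ioi 0, h s * (hypVol n).restrict K'
        (Prod.mk s ⁻¹' {q : ℝ × EuclideanSpace ℝ (Fin n) | q.1 < |u q.2|}) := by
      refine setLIntegral_congr_fun measurableSet_Ioi fun s hs => ?_
      congr 1
      rw [Measure.restrict_apply (measurable_prodMk_left hP)]
      congr 1
      ext x
      constructor
      · intro hx
        refine ⟨hx, ?_⟩
        have h1 : x ∈ {x | s ≤ |u x|} := (show s < |u x| from hx).le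
        have h2 := hρ ((isCompact_superlevel huc hcs hs).2 h1)
        exact Metric.closedBall_subset_closedBall (by linarith) h2
      · exact fun hx => hx.1
    rw [e1, this]
    refine lintegral_congr fun x => ?_
    have hm : MeasurableSet {s : ℝ | s < |u x|} := measurableSet_Iio
    change ∫⁻ s in {s : ℝ | s < |u x|}, h s ∂(volume.restrict (Set.Ioi 0)) = _
    rw [Measure.restrict_restrict hm]
    congr 2
    ext s
    simp [and_comm]
  have hI0fin : I0 ≠ ⊤ := by
    obtain ⟨B, hB⟩ := hcs.exists_bound_of_continuous huc
    obtain ⟨Λ, hΛ, hΛb⟩ := hbd B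
    rw [hI0eq]
    refine ne_of_lt (lt_of_le_of_lt (b := ∫⁻ x in K', Λ * ENNReal.ofReal B ∂hypVol n) ?_ ?_)
    · refine lintegral_mono fun x => ?_
      calc ∫⁻ s in Set.Ioo 0 |u x|, h s ≤ ∫⁻ s in Set.Ioo 0 |u x|, Λ := by
            refine setLIntegral_mono measurable_const fun s hs => hΛb s hs.1.le ?_
            exact hs.2.le.trans (hB x)
        _ = Λ * ENNReal.ofReal |u x| := by
            rw [setLIntegral_const, Real.volume_Ioo, sub_zero]
        _ ≤ _ := by gcongr; exact hB x
    · rw [setLIntegral_const]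
      exact ENNReal.mul_lt_top (ENNReal.mul_lt_top hΛ.lt_top ENNReal.ofReal_lt_top) hK'fin
  have hP : MeasurableSet {q : ℝ × EuclideanSpace ℝ (Fin n) |
      q.1 ≤ |u q.2| + ε * slopeBound u C ε q.2} :=
    measurableSet_le measurable_fst ((huc.abs.measurable.add (hDm.const_mul ε)).comp measurable_snd)
  have hineq : I0 + ENNReal.ofReal (2 * ε * (1 - 2 * ε)) * J
      ≤ ∫⁻ x in K', (∫⁻ s in Set.Ioc 0 (|u x| + ε * slopeBound u C ε x), h s) ∂hypVol n := by
    have := lintegral_mul_measure_section (volume.restrict (Set.Ioi (0 : ℝ)))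
      ((hypVol n).restrict K') hh hP
    have e2 : ∀ x, ∫⁻ s in {s | (s, x) ∈ {q : ℝ × EuclideanSpace ℝ (Fin n) |
        q.1 ≤ |u q.2| + ε * slopeBound u C ε q.2}}, h s ∂(volume.restrict (Set.Ioi 0))
        = ∫⁻ s in Set.Ioc 0 (|u x| + ε * slopeBound u C ε x), h s := by
      intro x
      have hm : MeasurableSet {s : ℝ | s ≤ |u x| + ε * slopeBound u C ε x} := measurableSet_Iic
      change ∫⁻ s in {s : ℝ | s ≤ |u x| + ε * slopeBound u C ε x}, h s
        ∂(volume.restrict (Set.Ioi 0)) = _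
      rw [Measure.restrict_restrict hm]
      congr 2
      ext s
      simp [and_comm]
    simp_rw [e2] at this
    have hm1 : Measurable fun s => h s * ENNReal.ofReal (isoProfile n p (distrib u s)) :=
      hh.mul ((measurable_isoProfile n p).comp (measurable_distrib u)).ennreal_ofReal
    have hm2 : Measurable fun s => h s * hypVol n {x | s < |u x|} :=
      hh.mul (measurable_hypVol_superlevel u)
    rw [← this, hI0, hJ, ← lintegral_const_mul _ hm1, ← lintegral_add_left hm2]
    refine setLIntegral_mono' measurableSet_Ioi fun s hs => ?_
    have hs : 0 < s := hs
    obtain ⟨hAc, hAs⟩ := isCompact_superlevel huc hcs hs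
    have hfin := hypVol_superlevel_lt_top hsupp hs.le
    have hv : ENNReal.ofReal (distrib u s) = hypVol n {x | s < |u x|} :=
      ENNReal.ofReal_toReal hfin.ne
    have h1 := isoProfile_le_hypVol_hypNbhd hn hp hAc (hAs.trans hsupp) (v := distrib u s)
      ENNReal.toReal_nonneg (by
        rw [hv]; exact measure_mono fun x hx => (show s < |u x| from hx).le) hε hε2
    have hnn : 0 ≤ 2 * ε * (1 - 2 * ε) := mul_nonneg (by linarith) (by linarith)
    have hv0 : 0 ≤ distrib u s := ENNReal.toReal_nonneg
    have hn' : (2 : ℝ) ≤ n := by exact_mod_cast hn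
    have hiso : 0 ≤ isoProfile n p (distrib u s) := by
      refine Real.rpow_nonneg (add_nonneg (Real.rpow_nonneg ?_ _) (Real.rpow_nonneg ?_ _)) _
      · have := unitBallVol_pos n
        unfold euclProfile
        positivity
      · exact mul_nonneg (by linarith) hv0
    rw [ENNReal.ofReal_add hv0 (mul_nonneg hnn hiso), ENNReal.ofReal_mul hnn, hv] at h1
    calc _ = h s * (hypVol n {x | s < |u x|} + ENNReal.ofReal (2 * ε * (1 - 2 * ε)) *
          ENNReal.ofReal (isoProfile n p (distrib u s))) := by
          ring
      _ ≤ _ := by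
          gcongr
          refine h1.trans ?_
          rw [Measure.restrict_apply (measurable_prodMk_left hP)]
          exact measure_mono (hypNbhd_superlevel_subset hC hT hρ hρ1 hε hs hερ)
  have hsplit : ∫⁻ x in K', (∫⁻ s in Set.Ioc 0 (|u x| + ε * slopeBound u C ε x), h s) ∂hypVol n
      ≤ I0 + ∫⁻ x in K', (∫⁻ s in Set.Icc |u x| (|u x| + ε * slopeBound u C ε x), h s)
        ∂hypVol n := by
    rw [hI0eq, ← lintegral_add_left]
    · refine lintegral_mono fun x => ?_
      refine (lintegral_mono_set ?_).trans (lintegral_union_le _ _ _)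
      intro s hs
      rcases lt_or_ge s |u x| with hsx | hsx
      · exact Or.inl ⟨hs.1, hsx⟩
      · exact Or.inr ⟨hsx, hs.2⟩
    · have hP' : MeasurableSet {q : EuclideanSpace ℝ (Fin n) × ℝ | 0 < q.2 ∧ q.2 < |u q.1|} :=
        (measurableSet_lt measurable_const measurable_snd).inter
          (measurableSet_lt measurable_snd (huc.abs.measurable.comp measurable_fst))
      have hmeas : Measurable fun x => ∫⁻ s, {q : EuclideanSpace ℝ (Fin n) × ℝ |
          0 < q.2 ∧ q.2 < |u q.1|}.indicator (fun q => h q.2) (x, s) :=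
        ((hh.comp measurable_snd).indicator hP').lintegral_prod_right'
      convert hmeas using 2 with x
      rw [← lintegral_indicator measurableSet_Ioo]
      refine lintegral_congr fun s => ?_
      by_cases hs : 0 < s ∧ s < |u x|
      · rw [Set.indicator_of_mem (show s ∈ Set.Ioo 0 |u x| from hs)]
        simp [hs]
      · rw [Set.indicator_of_notMem (show s ∉ Set.Ioo 0 |u x| from hs)]
        simp [hs]
  have hfinal := (ENNReal.add_le_add_iff_left hI0fin).1 (hineq.trans hsplit)
  have hε' : ENNReal.ofReal ε ≠ 0 := (ENNReal.ofReal_pos.2 hε).ne'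
  rw [lintegral_const_mul' _ _ (ENNReal.inv_ne_top.2 hε'), ← ENNReal.mul_le_iff_le_inv hε'
    ENNReal.ofReal_ne_top, ← mul_assoc, ← ENNReal.ofReal_mul hε.le]
  rwa [show ε * (2 * (1 - 2 * ε)) = 2 * ε * (1 - 2 * ε) by ring]

end Coarea

section CoareaLimit

open Filter Topology

variable {n : ℕ} {u : EuclideanSpace ℝ (Fin n) → ℝ}

lemma inv_mul_setLIntegral_Icc_le {h : ℝ → ENNReal} {b : ENNReal} {w ε D : ℝ} (hε : 0 < ε)
    (hb : ∀ s ∈ Set.Icc w (w + ε * D), h s ≤ b) :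
    (ENNReal.ofReal ε)⁻¹ * ∫⁻ s in Set.Icc w (w + ε * D), h s ≤ b * ENNReal.ofReal D := by
  have hε' : ENNReal.ofReal ε ≠ 0 := (ENNReal.ofReal_pos.2 hε).ne'
  rw [mul_comm, ← div_eq_mul_inv]
  refine ENNReal.div_le_of_le_mul ?_
  calc _ ≤ ∫⁻ s in Set.Icc w (w + ε * D), b := setLIntegral_mono measurable_const hb
    _ = b * (ENNReal.ofReal ε * ENNReal.ofReal D) := by
        rw [setLIntegral_const, Real.volume_Icc, add_sub_cancel_left, ENNReal.ofReal_mul hε.le]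
    _ = _ := by ring

lemma tendsto_slopeBound {E : Type*} [NormedAddCommGroup E] [NormedSpace ℝ E] (u : E → ℝ) (C : ℝ)
    {x : E} (hx : ‖x‖ < 1) :
    Tendsto (fun ε => slopeBound u C ε x) (𝓝 0) (𝓝 ((1 - ‖x‖ ^ 2) * ‖fderiv ℝ u x‖)) := by
  have hc : Continuous fun ε => slopeBound u C ε x := by
    unfold slopeBound
    fun_prop
  have h := hc.tendsto 0
  have hx2 : 0 ≤ 1 - ‖x‖ ^ 2 := by nlinarith [norm_nonneg x]
  have e : slopeBound u C 0 x = (1 - ‖x‖ ^ 2) * ‖fderiv ℝ u x‖ := by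
    simp only [slopeBound, mul_zero, add_zero]
    rw [Real.sqrt_mul_self hx2, mul_comm]
  rwa [e] at h

lemma slopeBound_le {E : Type*} [NormedAddCommGroup E] [NormedSpace ℝ E] {u : E → ℝ} {B C ε : ℝ}
    (hC : 0 ≤ C) {x : E} (hx : ‖x‖ < 1) (hB : ‖fderiv ℝ u x‖ ≤ B) (hε1 : ε ≤ 1) :
    slopeBound u C ε x ≤ B * 2 + C := by
  have hB0 : 0 ≤ B := (norm_nonneg _).trans hB
  have hx2 : 0 ≤ 1 - ‖x‖ ^ 2 := by nlinarith [norm_nonneg x]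
  have h1 : √((1 - ‖x‖ ^ 2) * (1 - ‖x‖ ^ 2 + 2 * ε)) ≤ 2 := by
    rw [Real.sqrt_le_left (by norm_num)]
    nlinarith [sq_nonneg ‖x‖]
  unfold slopeBound
  have h2 : C * ε ≤ C := mul_le_of_le_one_right hC hε1
  have h3 := mul_le_mul hB h1 (Real.sqrt_nonneg _) hB0
  linarith

/-- The isoperimetric inequality for superlevel sets, integrated against a weight in the level,
with the perimeter replaced through the coarea formula by a gradient integral. -/
lemma lintegral_isoProfile_distrib_le (hn : 2 ≤ n) {p : ℝ}
    (hp : 2 * (n : ℝ) / ((n : ℝ) - 1) ≤ p) (hu : ContDiff ℝ (⊤ : ℕ∞) u)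
    (hsupp : tsupport u ⊆ Metric.ball 0 1) {h : ℝ → ENNReal} (hh : Measurable h)
    (hbd : ∀ T : ℝ, ∃ Λ : ENNReal, Λ ≠ ⊤ ∧ ∀ s, 0 ≤ s → s ≤ T → h s ≤ Λ)
    (husc : ∀ s, 0 ≤ s → ∀ b, h s < b → ∀ᶠ t in 𝓝[≥] s, h t < b) :
    ∫⁻ s in Set.Ioi 0, h s * ENNReal.ofReal (isoProfile n p (distrib u s))
      ≤ ∫⁻ x, h |u x| * ENNReal.ofReal ((1 - ‖x‖ ^ 2) / 2 * ‖fderiv ℝ u x‖) ∂hypVol n := by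
  have hcs := hasCompactSupport_of_tsupport_subset_ball hsupp
  have huc : Continuous u := hu.continuous
  obtain ⟨ρ, hρ0, hρ1, hρ⟩ := exists_subset_closedBall hcs hsupp
  obtain ⟨C, hC, hT⟩ := exists_taylor_bound hu hcs
  obtain ⟨Bu, hBu⟩ := hcs.exists_bound_of_continuous huc
  obtain ⟨B, hB⟩ := (hcs.fderiv (𝕜 := ℝ)).exists_bound_of_continuous
    (hu.continuous_fderiv (by simp))
  have hB0 : 0 ≤ B := (norm_nonneg _).trans (hB 0)
  set ε0 : ℝ := min (1 / 2) ((1 - ρ) / 2) with hε0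
  have hε0pos : 0 < ε0 := lt_min (by norm_num) (by linarith)
  set e : ℕ → ℝ := fun k => ε0 / (k + 2) with he
  have he0 : ∀ k, 0 < e k := fun k => by positivity
  have hek : ∀ k, e k ≤ ε0 / 2 := fun k => by
    simp only [he]
    gcongr
    linarith [(Nat.cast_nonneg k : (0 : ℝ) ≤ k)]
  have hel : Tendsto e atTop (𝓝 0) :=
    tendsto_const_nhds.div_atTop
      (tendsto_natCast_atTop_atTop.atTop_add tendsto_const_nhds)
  have hε0a : ε0 ≤ 1 / 2 := min_le_left _ _
  have hε0b : ε0 ≤ (1 - ρ) / 2 := min_le_right _ _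
  set K' : Set (EuclideanSpace ℝ (Fin n)) := Metric.closedBall 0 ((1 + ρ) / 2) with hK'
  have hK'x : ∀ x ∈ K', ‖x‖ < 1 := fun x hx =>
    (mem_closedBall_zero_iff.1 hx).trans_lt (by linarith)
  have hK'fin : hypVol n K' < ⊤ := hypVol_closedBall_lt_top (by linarith)
  set F : ℕ → EuclideanSpace ℝ (Fin n) → ENNReal := fun k x => (ENNReal.ofReal (e k))⁻¹ *
    ∫⁻ s in Set.Icc |u x| (|u x| + e k * slopeBound u C (e k) x), h s with hF
  set J := ∫⁻ s in Set.Ioi 0, h s * ENNReal.ofReal (isoProfile n p (distrib u s)) with hJ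
  have h1 : ∀ k, ENNReal.ofReal (2 * (1 - 2 * e k)) * J ≤ ∫⁻ x in K', F k x ∂hypVol n := fun k =>
    lintegral_isoProfile_distrib_le_of_scale hn hp hu hsupp hC hT hρ hρ1 (he0 k)
      (by linarith [hek k]) (by linarith [hek k]) hh hbd
  obtain ⟨Λ, hΛ, hΛb⟩ := hbd (Bu + (B * 2 + C))
  have hFm : ∀ k, Measurable (F k) := by
    intro k
    have hDm := measurable_slopeBound hu C (e k)
    have hP' : MeasurableSet {q : EuclideanSpace ℝ (Fin n) × ℝ |
        |u q.1| ≤ q.2 ∧ q.2 ≤ |u q.1| + e k * slopeBound u C (e k) q.1} :=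
      (measurableSet_le (huc.abs.measurable.comp measurable_fst) measurable_snd).inter
        (measurableSet_le measurable_snd
          ((huc.abs.measurable.add (hDm.const_mul (e k))).comp measurable_fst))
    have hmeas : Measurable fun x => ∫⁻ s, {q : EuclideanSpace ℝ (Fin n) × ℝ |
        |u q.1| ≤ q.2 ∧ q.2 ≤ |u q.1| + e k * slopeBound u C (e k) q.1}.indicator
          (fun q => h q.2) (x, s) :=
      ((hh.comp measurable_snd).indicator hP').lintegral_prod_right'
    refine Measurable.const_mul ?_ _
    convert hmeas using 2 with x
    rw [← lintegral_indicator measurableSet_Icc]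
    refine lintegral_congr fun s => ?_
    by_cases hs : |u x| ≤ s ∧ s ≤ |u x| + e k * slopeBound u C (e k) x
    · rw [Set.indicator_of_mem (show s ∈ Set.Icc |u x| _ from hs)]
      simp [hs]
    · rw [Set.indicator_of_notMem (show s ∉ Set.Icc |u x| _ from hs)]
      simp only [Set.indicator, Set.mem_ofPred_eq, hs, if_false]
  have hFb : ∀ k, ∀ x ∈ K', F k x ≤ Λ * ENNReal.ofReal (B * 2 + C) := by
    intro k x hx
    have hsl := slopeBound_le hC (hK'x x hx) (hB x) (ε := e k) (by linarith [hek k])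
    refine (inv_mul_setLIntegral_Icc_le (he0 k) (b := Λ) fun s hs => ?_).trans (by gcongr)
    refine hΛb s ((abs_nonneg _).trans hs.1) (hs.2.trans (add_le_add (hBu x) ?_))
    have : e k * slopeBound u C (e k) x ≤ e k * (B * 2 + C) :=
      mul_le_mul_of_nonneg_left hsl (he0 k).le
    have h2 : 0 ≤ B * 2 + C := by positivity
    nlinarith [hek k]
  have hlim : ∀ x ∈ K', limsup (fun k => F k x) atTop
      ≤ h |u x| * ENNReal.ofReal ((1 - ‖x‖ ^ 2) * ‖fderiv ℝ u x‖) := by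
    intro x hx
    have hD : Tendsto (fun k => slopeBound u C (e k) x) atTop
        (𝓝 ((1 - ‖x‖ ^ 2) * ‖fderiv ℝ u x‖)) := (tendsto_slopeBound u C (hK'x x hx)).comp hel
    have hstep : ∀ b, h |u x| < b → b ≠ ⊤ → limsup (fun k => F k x) atTop
        ≤ b * ENNReal.ofReal ((1 - ‖x‖ ^ 2) * ‖fderiv ℝ u x‖) := by
      intro b hb hbt
      have hT' : Tendsto (fun k => b * ENNReal.ofReal (slopeBound u C (e k) x)) atTop
          (𝓝 (b * ENNReal.ofReal ((1 - ‖x‖ ^ 2) * ‖fderiv ℝ u x‖))) :=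
        ENNReal.Tendsto.const_mul (ENNReal.tendsto_ofReal hD) (Or.inr hbt)
      rw [← hT'.limsup_eq]
      refine limsup_le_limsup ?_
      obtain ⟨δ, hδ, hδb⟩ := mem_nhdsGE_iff_exists_Icc_subset.1
        (husc |u x| (abs_nonneg _) b hb)
      have hDe : Tendsto (fun k => |u x| + e k * slopeBound u C (e k) x) atTop (𝓝 |u x|) := by
        have := (hel.mul hD).const_add |u x|
        rwa [zero_mul, add_zero] at this
      filter_upwards [hDe.eventually_lt_const hδ] with k hk
      exact inv_mul_setLIntegral_Icc_le (he0 k) fun s hs =>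
        (hδb ⟨hs.1, hs.2.trans hk.le⟩).le
    obtain ⟨Λ', hΛ', hΛb'⟩ := hbd |u x|
    have hfin : h |u x| < ⊤ := (hΛb' _ (abs_nonneg _) le_rfl).trans_lt hΛ'.lt_top
    have : (𝓝[>] (h |u x|)).NeBot := nhdsGT_neBot_of_exists_gt ⟨⊤, hfin⟩
    refine ge_of_tendsto (x := 𝓝[>] (h |u x|)) (ENNReal.Tendsto.mul_const
      (tendsto_id.mono_left nhdsWithin_le_nhds) (Or.inr ENNReal.ofReal_ne_top)) ?_
    filter_upwards [self_mem_nhdsWithin, nhdsWithin_le_nhds (Iio_mem_nhds hfin)] with b hb hb'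
    exact hstep b hb (ne_of_lt hb')
  have h2 : limsup (fun k => ∫⁻ x in K', F k x ∂hypVol n) atTop
      ≤ ∫⁻ x in K', limsup (fun k => F k x) atTop ∂hypVol n := by
    refine limsup_lintegral_le (fun _ => Λ * ENNReal.ofReal (B * 2 + C)) hFm (fun k => ?_) ?_
    · filter_upwards [ae_restrict_mem measurableSet_closedBall] with x hx using hFb k x hx
    · rw [setLIntegral_const]
      exact (ENNReal.mul_lt_top (ENNReal.mul_lt_top hΛ.lt_top ENNReal.ofReal_lt_top) hK'fin).ne
  have h3 : ∫⁻ x in K', limsup (fun k => F k x) atTop ∂hypVol n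
      ≤ ENNReal.ofReal 2 * ∫⁻ x, h |u x| *
        ENNReal.ofReal ((1 - ‖x‖ ^ 2) / 2 * ‖fderiv ℝ u x‖) ∂hypVol n := by
    rw [← lintegral_const_mul' _ _ ENNReal.ofReal_ne_top]
    refine (lintegral_mono_ae ?_).trans (setLIntegral_le_lintegral K' _)
    filter_upwards [ae_restrict_mem measurableSet_closedBall] with x hx
    refine (hlim x hx).trans (le_of_eq ?_)
    rw [mul_left_comm, ← ENNReal.ofReal_mul zero_le_two]
    congr 2
    ring
  have h4 : Tendsto (fun k => ENNReal.ofReal (2 * (1 - 2 * e k)) * J) atTop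
      (𝓝 (ENNReal.ofReal 2 * J)) := by
    refine ENNReal.Tendsto.mul_const (ENNReal.tendsto_ofReal ?_) (Or.inl (by simp))
    have := ((hel.const_mul 2).const_sub 1).const_mul 2
    simpa using this
  have h5 : ENNReal.ofReal 2 * J ≤ limsup (fun k => ∫⁻ x in K', F k x ∂hypVol n) atTop := by
    rw [← h4.limsup_eq]
    exact limsup_le_limsup (Eventually.of_forall h1)
  exact (ENNReal.mul_le_mul_iff_right (by simp) ENNReal.ofReal_ne_top).1 (h5.trans (h2.trans h3))

end CoareaLimit

section Transport

open Filter Topology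

variable {α : Type*} [MeasurableSpace α]

lemma exists_lt_measure_superlevel {ν : Measure α} {w : α → ℝ} {s : ℝ} {b : ENNReal}
    (hb : b < ν {x | s < w x}) : ∃ s' > s, b < ν {x | s' < w x} := by
  have hU : {x | s < w x} = ⋃ k : ℕ, {x | s + 1 / ((k : ℝ) + 1) < w x} := by
    ext x
    simp only [Set.mem_iUnion, Set.mem_ofPred_eq]
    constructor
    · intro hx
      obtain ⟨k, hk⟩ := exists_nat_one_div_lt (sub_pos.2 hx)
      exact ⟨k, by linarith⟩
    · rintro ⟨k, hk⟩
      have : (0 : ℝ) < 1 / ((k : ℝ) + 1) := by positivity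
      linarith
  have hm : Monotone fun k : ℕ => {x | s + 1 / ((k : ℝ) + 1) < w x} := by
    intro i j hij x hx
    have hx : s + 1 / ((i : ℝ) + 1) < w x := hx
    have : 1 / ((j : ℝ) + 1) ≤ 1 / ((i : ℝ) + 1) := Nat.one_div_le_one_div hij
    exact (by linarith : s + 1 / ((j : ℝ) + 1) < w x)
  have ht := tendsto_measure_iUnion_atTop (μ := ν) hm
  rw [← hU] at ht
  obtain ⟨k, hk⟩ := (ht.eventually_const_lt hb).exists
  exact ⟨_, by simp only [gt_iff_lt, lt_add_iff_pos_right]; positivity, hk⟩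

/-- Monotone transport of the weight `w ^ r` along the level sets of `w` to a density `G` on
`(0, L)`: the map `T` sends a level to the corresponding point of `[0, L]`, and `ω` is its
generalized inverse. -/
lemma exists_level_transport {μ : Measure α} {w : α → ℝ} (hw : Measurable w) (hw0 : ∀ x, 0 ≤ w x)
    {B : ℝ} (hwB : ∀ x, w x ≤ B) {r : ℝ} (hr : 0 < r) {G : ℝ → ℝ} (hG : Continuous G)
    (hG0 : ∀ v, 0 < G v) {L : ℝ} (hL : 0 < L)
    (hM : ∫⁻ x, ENNReal.ofReal (w x ^ r) ∂μ = ENNReal.ofReal (∫ v in (0 : ℝ)..L, G v)) :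
    ∃ T ω : ℝ → ℝ, Antitone T ∧ (∀ s, 0 ≤ T s ∧ T s ≤ L) ∧ Measurable ω ∧
      (∀ s V, 0 ≤ s → 0 < V → V < L → (s < ω V ↔ V < T s)) ∧
      (∀ V, 0 < V → V < L → 0 < ω V) ∧
      (μ.withDensity fun x => ENNReal.ofReal (w x ^ r)).map w =
        ((volume.restrict (Set.Ioo 0 L)).withDensity fun v => ENNReal.ofReal (G v)).map ω := by
  set ν := μ.withDensity fun x => ENNReal.ofReal (w x ^ r) with hν
  set lam := (volume.restrict (Set.Ioo 0 L)).withDensity fun v => ENNReal.ofReal (G v) with hlam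
  set Γ : ℝ → ℝ := fun V => ∫ v in (0 : ℝ)..V, G v with hΓ
  have hGi : ∀ a b, IntervalIntegrable G volume a b := fun a b => hG.intervalIntegrable a b
  have hΓ0 : Γ 0 = 0 := by simp [hΓ]
  have hΓm : StrictMono Γ := by
    intro a b hab
    have h1 := intervalIntegral.integral_interval_sub_left (hGi 0 b) (hGi 0 a)
    have h2 : 0 < ∫ v in a..b, G v :=
      intervalIntegral.intervalIntegral_pos_of_pos (hGi a b) hG0 hab
    simp only [hΓ]
    linarith
  have hΓc : Continuous Γ := intervalIntegral.continuous_primitive hGi 0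
  have hνuniv : ν Set.univ = ENNReal.ofReal (Γ L) := by
    rw [hν, withDensity_apply _ MeasurableSet.univ, Measure.restrict_univ, hM]
  have hνfin : IsFiniteMeasure ν := ⟨by rw [hνuniv]; exact ENNReal.ofReal_lt_top⟩
  have hlamIoo : ∀ t, 0 ≤ t → t ≤ L → lam (Set.Iio t) = ENNReal.ofReal (Γ t) := by
    intro t ht htL
    rw [hlam, withDensity_apply _ measurableSet_Iio, Measure.restrict_restrict measurableSet_Iio]
    have : Set.Iio t ∩ Set.Ioo 0 L = Set.Ioo 0 t := by
      ext V
      constructor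
      · exact fun h => ⟨h.2.1, h.1⟩
      · exact fun h => ⟨h.2, h.1, lt_of_lt_of_le h.2 htL⟩
    rw [this, ← ofReal_integral_eq_lintegral_ofReal _ (ae_of_all _ fun v => (hG0 v).le),
      ← integral_Ioc_eq_integral_Ioo, ← intervalIntegral.integral_of_le ht]
    have := (hGi 0 t).1
    exact this.mono_set Set.Ioo_subset_Ioc_self
  have hlamuniv : lam Set.univ = ENNReal.ofReal (Γ L) := by
    rw [← hlamIoo L hL.le le_rfl]
    have : lam (Set.Iio L)ᶜ = 0 := by
      refine withDensity_absolutelyContinuous _ _ ?_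
      rw [Measure.restrict_apply (measurableSet_Iio (a := L)).compl]
      convert measure_empty (μ := (volume : Measure ℝ))
      ext V
      simp only [Set.mem_inter_iff, Set.mem_compl_iff, Set.mem_Iio, Set.mem_Ioo,
        Set.mem_empty_iff_false, iff_false]
      exact fun h => h.1 h.2.2
    rw [← measure_add_measure_compl (measurableSet_Iio (a := L))]
    rw [this, add_zero]
  have hlamfin : IsFiniteMeasure lam := ⟨by rw [hlamuniv]; exact ENNReal.ofReal_lt_top⟩
  have hex : ∀ s, ∃ t, (0 ≤ t ∧ t ≤ L) ∧ ENNReal.ofReal (Γ t) = ν {x | s < w x} := by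
    intro s
    have h1 : ν {x | s < w x} ≤ ENNReal.ofReal (Γ L) := hνuniv ▸ measure_mono (Set.subset_univ _)
    have h2 : (ν {x | s < w x}).toReal ∈ Set.Icc (Γ 0) (Γ L) := by
      refine ⟨by rw [hΓ0]; exact ENNReal.toReal_nonneg, ?_⟩
      exact ENNReal.toReal_le_of_le_ofReal (hΓ0 ▸ (hΓm hL).le) h1
    obtain ⟨t, ht, hte⟩ := intermediate_value_Icc hL.le hΓc.continuousOn h2
    exact ⟨t, ht, by rw [hte, ENNReal.ofReal_toReal (measure_ne_top _ _)]⟩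
  choose T hT01 hTΓ using hex
  have hlt : ∀ s V, 0 ≤ V → (V < T s ↔ ENNReal.ofReal (Γ V) < ν {x | s < w x}) := by
    intro s V hV
    have hΓV : 0 ≤ Γ V := hΓ0 ▸ hΓm.monotone hV
    rw [← hTΓ, ENNReal.ofReal_lt_ofReal_iff_of_nonneg hΓV, hΓm.lt_iff_lt]
  have hTanti : Antitone T := by
    intro s s' hss
    by_contra! h
    have h1 := (hlt s' (T s) (hT01 s).1).1 h
    rw [hTΓ] at h1
    exact absurd (measure_mono (μ := ν) fun x (hx : s' < w x) => hss.trans_lt hx) (not_le.2 h1)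
  have hT0 : T 0 = L := by
    refine le_antisymm (hT01 0).2 (hΓm.le_iff_le.1 ?_)
    have h1 : ν {x | 0 < w x}ᶜ = 0 := by
      have hms : MeasurableSet {x | 0 < w x}ᶜ := (measurableSet_lt measurable_const hw).compl
      rw [hν, withDensity_apply _ hms, setLIntegral_congr_fun (g := fun _ => 0) hms, lintegral_zero]
      intro x hx
      have hx0 : w x = 0 := le_antisymm (not_lt.1 hx) (hw0 x)
      simp [hx0, Real.zero_rpow hr.ne']
    have h2 : ν {x | 0 < w x} = ENNReal.ofReal (Γ L) := by
      rw [← hνuniv, ← measure_add_measure_compl (measurableSet_lt measurable_const hw), h1,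
        add_zero]
    rw [← hTΓ] at h2
    have h3 : Γ 0 ≤ Γ (T 0) := hΓm.monotone (hT01 0).1
    rw [hΓ0] at h3
    exact (ENNReal.ofReal_le_ofReal_iff h3).1 h2.ge
  have hTB : ∀ s V, 0 < V → V < T s → s ≤ B := by
    intro s V hV h
    by_contra! hs
    have h1 := (hlt s V hV.le).1 h
    have : {x | s < w x} = ∅ := by
      ext x
      simpa using (hwB x).trans hs.le
    rw [this, measure_empty] at h1
    exact not_lt_bot h1
  set S : ℝ → Set ℝ := fun V => {s | s = 0 ∨ (0 ≤ s ∧ s ≤ B ∧ V < T s)} with hS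
  have hSb : ∀ V, BddAbove (S V) := fun V => ⟨max B 0, by
    rintro s (rfl | h)
    · exact le_max_right _ _
    · exact h.2.1.trans (le_max_left _ _)⟩
  have hSn : ∀ V, (S V).Nonempty := fun V => ⟨0, Or.inl rfl⟩
  set ω : ℝ → ℝ := fun V => sSup (S V) with hω
  have hω0 : ∀ V, 0 ≤ ω V := fun V => le_csSup (hSb V) (Or.inl rfl)
  have hωanti : Antitone ω := fun V V' hV =>
    csSup_le_csSup (hSb V) (hSn V') fun s hs => hs.imp id fun h => ⟨h.1, h.2.1, hV.trans_lt h.2.2⟩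
  have hiff : ∀ s V, 0 ≤ s → 0 < V → V < L → (s < ω V ↔ V < T s) := by
    intro s V hs hV hVL
    constructor
    · intro h
      obtain ⟨s', hs', hss'⟩ := exists_lt_of_lt_csSup (hSn V) h
      rcases hs' with rfl | h'
      · linarith
      · exact h'.2.2.trans_le (hTanti hss'.le)
    · intro h
      obtain ⟨s', hss', h'⟩ := exists_lt_measure_superlevel ((hlt s V hV.le).1 h)
      have h2 := (hlt s' V hV.le).2 h'
      exact lt_of_lt_of_le hss' (le_csSup (hSb V) (Or.inr ⟨hs.trans hss'.le, hTB s' V hV h2, h2⟩))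
  refine ⟨T, ω, hTanti, hT01, hωanti.measurable, hiff,
    fun V hV hVL => (hiff 0 V le_rfl hV hVL).2 (hT0 ▸ hVL), ?_⟩
  have hlamω : ∀ a, 0 ≤ a → lam (ω ⁻¹' Set.Ioi a) = lam (Set.Iio (T a)) := by
    intro a ha
    refine measure_congr ?_
    have : ∀ᵐ V ∂lam, V ∈ Set.Ioo 0 L :=
      (withDensity_absolutelyContinuous _ _).ae_le (ae_restrict_mem measurableSet_Ioo)
    filter_upwards [this] with V hV
    exact propext (hiff a V ha hV.1 hV.2)
  have hfin1 : IsFiniteMeasure (ν.map w) := Measure.isFiniteMeasure_map ν w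
  refine ext_of_generate_finite _ (borel_eq_generateFrom_Ioi ℝ ▸ BorelSpace.measurable_eq)
    isPiSystem_Ioi ?_ ?_
  · rintro _ ⟨a, rfl⟩
    rw [Measure.map_apply hw measurableSet_Ioi,
      Measure.map_apply hωanti.measurable measurableSet_Ioi]
    rcases le_or_gt 0 a with ha | ha
    · rw [hlamω a ha, hlamIoo _ (hT01 a).1 (hT01 a).2, hTΓ]
      rfl
    · have e1 : w ⁻¹' Set.Ioi a = Set.univ := by
        ext x; simpa using ha.trans_le (hw0 x)
      have e2 : ω ⁻¹' Set.Ioi a = Set.univ := by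
        ext x; simpa using ha.trans_le (hω0 x)
      rw [e1, e2, hνuniv, hlamuniv]
  · rw [Measure.map_apply hw MeasurableSet.univ,
      Measure.map_apply hωanti.measurable MeasurableSet.univ, Set.preimage_univ, Set.preimage_univ,
      hνuniv, hlamuniv]

end Transport

section TransportBounds

open Filter Topology

variable {α : Type*} [MeasurableSpace α]

lemma setLIntegral_Ioo_rpow {a t : ℝ} (ha : 0 < a) (ht : 0 ≤ t) :
    ∫⁻ s in Set.Ioo 0 t, ENNReal.ofReal (s ^ (a - 1)) = ENNReal.ofReal (t ^ a / a) := by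
  have hi : IntervalIntegrable (fun s : ℝ => s ^ (a - 1)) volume 0 t :=
    intervalIntegral.intervalIntegrable_rpow' (by linarith)
  rw [← ofReal_integral_eq_lintegral_ofReal (hi.1.mono_set Set.Ioo_subset_Ioc_self)
    (by
      filter_upwards [ae_restrict_mem measurableSet_Ioo] with s hs
      exact Real.rpow_nonneg hs.1.le _),
    ← integral_Ioc_eq_integral_Ioo, ← intervalIntegral.integral_of_le ht,
    integral_rpow (Or.inl (by linarith))]
  rw [sub_add_cancel, Real.zero_rpow ha.ne', sub_zero]

lemma measure_superlevel_eq_lintegral {μ : Measure α} {w : α → ℝ} (hw : Measurable w) {r s : ℝ}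
    (hs : 0 ≤ s) :
    μ {x | s < w x} = ∫⁻ y in Set.Ioi s, ENNReal.ofReal (y ^ (-r))
      ∂(μ.withDensity fun x => ENNReal.ofReal (w x ^ r)).map w := by
  have hm : Measurable fun y : ℝ => ENNReal.ofReal (y ^ (-r)) := by fun_prop
  have hd : Measurable fun x => ENNReal.ofReal (w x ^ r) := (hw.pow_const r).ennreal_ofReal
  have hmw : Measurable fun x => ENNReal.ofReal (w x ^ (-r)) := hm.comp hw
  rw [setLIntegral_map measurableSet_Ioi hm hw, setLIntegral_withDensity_eq_setLIntegral_mul _ hd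
    hmw (hw measurableSet_Ioi)]
  rw [setLIntegral_congr_fun (g := fun _ => 1) (hw measurableSet_Ioi), setLIntegral_one]
  · rfl
  · intro x hx
    have hx : s < w x := hx
    have hx0 : 0 < w x := hs.trans_lt hx
    simp only [Pi.mul_apply]
    rw [← ENNReal.ofReal_mul (Real.rpow_nonneg hx0.le _), ← Real.rpow_add hx0, add_neg_cancel,
      Real.rpow_zero, ENNReal.ofReal_one]

/-- The one-dimensional transport estimates behind the sharp Sobolev inequality: `T` is a monotone
reparametrization of the levels of `w`, and the density `G` is at our disposal. -/
lemma exists_level_profile {μ : Measure α} {w : α → ℝ} (hw : Measurable w) (hw0 : ∀ x, 0 ≤ w x)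
    {B : ℝ} (hwB : ∀ x, w x ≤ B) {r : ℝ} (hr : 0 < r) {G : ℝ → ℝ} (hG : Continuous G)
    (hG0 : ∀ v, 0 < G v) {L : ℝ} (hL : 0 < L)
    (hM : ∫⁻ x, ENNReal.ofReal (w x ^ r) ∂μ = ENNReal.ofReal (∫ v in (0 : ℝ)..L, G v)) :
    ∃ T : ℝ → ℝ, Antitone T ∧ (∀ s, 0 ≤ T s ∧ T s ≤ L) ∧
      (∀ a : ℝ, 0 ≤ a → ∫⁻ x, ENNReal.ofReal (w x ^ r * T (w x) ^ a) ∂μ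
        ≤ ∫⁻ v in Set.Ioo 0 L, ENNReal.ofReal (v ^ a * G v)) ∧
      (∀ θ, 0 < θ → θ < 1 →
        ENNReal.ofReal (r * θ)⁻¹ * ∫⁻ v in Set.Ioo 0 L, ENNReal.ofReal (G v ^ θ)
          ≤ ∫⁻ s in Set.Ioi 0, ENNReal.ofReal (s ^ (r * θ - 1)) *
            (μ {x | s < w x} ^ θ * ENNReal.ofReal (T s) ^ (1 - θ))) := by
  obtain ⟨T, ω, hT, hTL, hω, hiff, hω0, hmap⟩ := exists_level_transport hw hw0 hwB hr hG hG0 hL hM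
  have hGm : Measurable fun v => ENNReal.ofReal (G v) := hG.measurable.ennreal_ofReal
  refine ⟨T, hT, hTL, fun a ha => ?_, fun θ hθ0 hθ1 => ?_⟩
  · have hd : Measurable fun x => ENNReal.ofReal (w x ^ r) := (hw.pow_const r).ennreal_ofReal
    have hTm : Measurable fun y => ENNReal.ofReal (T y ^ a) :=
      (hT.measurable.pow_const a).ennreal_ofReal
    have hTw : Measurable fun x => ENNReal.ofReal (T (w x) ^ a) := hTm.comp hw
    have hTω : Measurable fun v => ENNReal.ofReal (T (ω v) ^ a) := hTm.comp hω
    calc ∫⁻ x, ENNReal.ofReal (w x ^ r * T (w x) ^ a) ∂μ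
        = ∫⁻ x, ENNReal.ofReal (w x ^ r) * ENNReal.ofReal (T (w x) ^ a) ∂μ := by
          refine lintegral_congr fun x => ?_
          rw [ENNReal.ofReal_mul (Real.rpow_nonneg (hw0 x) _)]
      _ = ∫⁻ y, ENNReal.ofReal (T y ^ a)
          ∂(μ.withDensity fun x => ENNReal.ofReal (w x ^ r)).map w := by
          rw [lintegral_map hTm hw, lintegral_withDensity_eq_lintegral_mul _ hd hTw]
          rfl
      _ = ∫⁻ v in Set.Ioo 0 L, ENNReal.ofReal (G v) * ENNReal.ofReal (T (ω v) ^ a) := by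
          rw [hmap, lintegral_map hTm hω, lintegral_withDensity_eq_lintegral_mul _ hGm
            hTω]
          rfl
      _ ≤ _ := by
          refine setLIntegral_mono' measurableSet_Ioo fun v hv => ?_
          rw [← ENNReal.ofReal_mul (hG0 v).le, mul_comm (G v)]
          refine ENNReal.ofReal_le_ofReal (mul_le_mul_of_nonneg_right ?_ (hG0 v).le)
          refine Real.rpow_le_rpow (hTL _).1 ?_ ha
          exact not_lt.1 fun h => lt_irrefl _ ((hiff _ v (hω0 v hv.1 hv.2).le hv.1 hv.2).2 h)
  · set k : ℝ → ENNReal := fun v => (ENNReal.ofReal (ω v ^ (-r)) * ENNReal.ofReal (G v)) ^ θ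
      with hk
    have hk0m : Measurable fun v => ENNReal.ofReal (ω v ^ (-r)) * ENNReal.ofReal (G v) :=
      (hω.pow_const _).ennreal_ofReal.mul hGm
    have hkm : Measurable k := hk0m.pow_const θ
    have hinv : Measurable fun y : ℝ => ENNReal.ofReal (y ^ (-r)) := by fun_prop
    have hinvω : Measurable fun v => ENNReal.ofReal (ω v ^ (-r)) := hinv.comp hω
    have hHolder : ∀ s ∈ Set.Ioi (0 : ℝ),
        (volume.restrict (Set.Ioo 0 L)).withDensity k (ω ⁻¹' Set.Ioi s)
          ≤ μ {x | s < w x} ^ θ * ENNReal.ofReal (T s) ^ (1 - θ) := by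
      intro s hs
      have hs : 0 < s := hs
      have hm : MeasurableSet (ω ⁻¹' Set.Ioi s) := hω measurableSet_Ioi
      have hset : ω ⁻¹' Set.Ioi s ∩ Set.Ioo 0 L = Set.Ioo 0 (T s) := by
        ext v
        constructor
        · exact fun h => ⟨h.2.1, (hiff s v hs.le h.2.1 h.2.2).1 h.1⟩
        · intro h
          have hvL := h.2.trans_le (hTL s).2
          exact ⟨(hiff s v hs.le h.1 hvL).2 h.2, h.1, hvL⟩
      have e1 : μ {x | s < w x} = ∫⁻ v in Set.Ioo 0 (T s),
          ENNReal.ofReal (ω v ^ (-r)) * ENNReal.ofReal (G v) := by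
        rw [measure_superlevel_eq_lintegral hw (r := r) hs.le, hmap,
          setLIntegral_map measurableSet_Ioi hinv hω,
          setLIntegral_withDensity_eq_setLIntegral_mul _ hGm hinvω hm,
          Measure.restrict_restrict hm, hset]
        refine lintegral_congr fun v => ?_
        simp [mul_comm]
      rw [withDensity_apply _ hm, Measure.restrict_restrict hm, hset, e1]
      have hH := ENNReal.lintegral_mul_norm_pow_le (μ := volume.restrict (Set.Ioo 0 (T s)))
        hk0m.aemeasurable (aemeasurable_const (b := (1 : ENNReal))) hθ0.le (sub_nonneg.2 hθ1.le)
        (add_sub_cancel θ 1)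
      simpa using hH
    have hP : MeasurableSet {q : ℝ × ℝ | q.1 < ω q.2} :=
      measurableSet_lt measurable_fst (hω.comp measurable_snd)
    have hh : Measurable fun s : ℝ => ENNReal.ofReal (s ^ (r * θ - 1)) := by fun_prop
    have hsw := lintegral_mul_measure_section (volume.restrict (Set.Ioi (0 : ℝ)))
      ((volume.restrict (Set.Ioo 0 L)).withDensity k) hh hP
    calc _ = ∫⁻ v, ∫⁻ s in {s | (s, v) ∈ {q : ℝ × ℝ | q.1 < ω q.2}},
          ENNReal.ofReal (s ^ (r * θ - 1)) ∂(volume.restrict (Set.Ioi 0))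
          ∂((volume.restrict (Set.Ioo 0 L)).withDensity k) := ?_
      _ = _ := hsw.symm
      _ ≤ _ := setLIntegral_mono' measurableSet_Ioi fun s hs =>
          mul_le_mul_right (hHolder s hs) _
    have hin : ∀ v, ∫⁻ s in {s | (s, v) ∈ {q : ℝ × ℝ | q.1 < ω q.2}},
          ENNReal.ofReal (s ^ (r * θ - 1)) ∂(volume.restrict (Set.Ioi 0))
        = ∫⁻ s in Set.Ioo 0 (ω v), ENNReal.ofReal (s ^ (r * θ - 1)) := by
      intro v
      have hm : MeasurableSet {s : ℝ | s < ω v} := measurableSet_Iio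
      change ∫⁻ s in {s : ℝ | s < ω v}, ENNReal.ofReal (s ^ (r * θ - 1))
        ∂(volume.restrict (Set.Ioi 0)) = _
      rw [Measure.restrict_restrict hm]
      congr 2
      ext s
      simp [and_comm]
    have hinm : Measurable fun v => ∫⁻ s in {s | (s, v) ∈ {q : ℝ × ℝ | q.1 < ω q.2}},
          ENNReal.ofReal (s ^ (r * θ - 1)) ∂(volume.restrict (Set.Ioi 0)) := by
      have hmeas : Measurable fun v => ∫⁻ s, {q : ℝ × ℝ | q.2 < ω q.1}.indicator
          (fun q => ENNReal.ofReal (q.2 ^ (r * θ - 1))) (v, s) ∂(volume.restrict (Set.Ioi 0)) :=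
        ((hh.comp measurable_snd).indicator
          (measurableSet_lt measurable_snd (hω.comp measurable_fst))).lintegral_prod_right'
      convert hmeas using 2 with v
      have hm : MeasurableSet {s : ℝ | (s, v) ∈ {q : ℝ × ℝ | q.1 < ω q.2}} :=
        measurable_prodMk_right hP
      rw [← lintegral_indicator hm]
      refine lintegral_congr fun s => ?_
      by_cases hs : s < ω v <;> simp [hs]
    rw [lintegral_withDensity_eq_lintegral_mul _ hkm hinm,
      ← lintegral_const_mul' _ _ ENNReal.ofReal_ne_top]
    refine setLIntegral_congr_fun measurableSet_Ioo fun v hv => ?_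
    have hωv := hω0 v hv.1 hv.2
    have hωr : 0 ≤ ω v ^ (-r) := Real.rpow_nonneg hωv.le _
    simp only [Pi.mul_apply]
    rw [hin, setLIntegral_Ioo_rpow (mul_pos hr hθ0) hωv.le, hk]
    simp only
    rw [← ENNReal.ofReal_mul hωr, ENNReal.ofReal_rpow_of_nonneg (mul_nonneg hωr (hG0 v).le) hθ0.le,
      ← ENNReal.ofReal_mul (by positivity), ← ENNReal.ofReal_mul (Real.rpow_nonneg
        (mul_nonneg hωr (hG0 v).le) _), Real.mul_rpow hωr (hG0 v).le, ← Real.rpow_mul hωv.le]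
    congr 1
    rw [neg_mul, Real.rpow_neg hωv.le]
    field_simp

end TransportBounds

section DualPairing

open Filter Topology

variable {n : ℕ} {u : EuclideanSpace ℝ (Fin n) → ℝ}

lemma euclProfile_nonneg (n : ℕ) {v : ℝ} (hv : 0 ≤ v) : 0 ≤ euclProfile n v := by
  have := unitBallVol_pos n
  unfold euclProfile
  positivity

lemma mul_add_mul_le_rpow_mul_rpow {p q : ℝ} (hpq : p.HolderConjugate q) {a b c d : ℝ}
    (ha : 0 ≤ a) (hb : 0 ≤ b) (hc : 0 ≤ c) (hd : 0 ≤ d) :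
    c * a + d * b ≤ (c ^ q + d ^ q) ^ (1 / q) * (a ^ p + b ^ p) ^ (1 / p) := by
  have := Real.inner_le_Lp_mul_Lq_of_nonneg Finset.univ (f := ![c, d]) (g := ![a, b]) hpq.symm
    (by intro i _; fin_cases i <;> simpa) (by intro i _; fin_cases i <;> simpa)
  simpa [Fin.sum_univ_two] using this

lemma ofReal_mul_mul_le_young {p q : ℝ} (hpq : p.HolderConjugate q) {a b X : ℝ}
    (hab : 0 ≤ a ^ q + b ^ q) :
    ENNReal.ofReal p * (ENNReal.ofReal ((a ^ q + b ^ q) ^ (1 / q)) * ENNReal.ofReal X)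
      ≤ ENNReal.ofReal (X ^ p) + ENNReal.ofReal (p - 1) * ENNReal.ofReal (a ^ q + b ^ q) := by
  rcases le_or_gt X 0 with hX | hX
  · rw [ENNReal.ofReal_of_nonpos hX]
    simp
  have hH : 0 ≤ (a ^ q + b ^ q) ^ (1 / q) := Real.rpow_nonneg hab _
  have h := Real.young_inequality_of_nonneg hX.le hH hpq
  have e : ((a ^ q + b ^ q) ^ (1 / q)) ^ q = a ^ q + b ^ q := by
    rw [← Real.rpow_mul hab, one_div_mul_cancel hpq.symm.ne_zero, Real.rpow_one]
  rw [e] at h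
  have h2 := mul_le_mul_of_nonneg_left h hpq.nonneg
  have h3 : p * (X ^ p / p + (a ^ q + b ^ q) / q) = X ^ p + (p - 1) * (a ^ q + b ^ q) := by
    rw [← hpq.div_conj_eq_sub_one]
    have := hpq.ne_zero
    field_simp
  rw [h3] at h2
  rw [← ENNReal.ofReal_mul hH, ← ENNReal.ofReal_mul hpq.nonneg,
    ← ENNReal.ofReal_mul hpq.sub_one_pos.le,
    ← ENNReal.ofReal_add (Real.rpow_nonneg hX.le _) (mul_nonneg hpq.sub_one_pos.le hab)]
  refine ENNReal.ofReal_le_ofReal (le_trans (le_of_eq ?_) h2)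
  ring

/-- Pairing the isoperimetric profile with a weight in the level, and absorbing the gradient by
Young's inequality. -/
lemma lintegral_pairing_le (hn : 2 ≤ n) {p q : ℝ} (hpq : p.HolderConjugate q)
    (hp : 2 * (n : ℝ) / ((n : ℝ) - 1) ≤ p) (hu : ContDiff ℝ (⊤ : ℕ∞) u)
    (hsupp : tsupport u ⊆ Metric.ball 0 1) {T : ℝ → ℝ} (hT : Antitone T) (hT0 : ∀ s, 0 ≤ T s)
    {κ e d lam : ℝ} (hκ : 0 ≤ κ) (he : 0 < e) (hd : 0 < d) (hlam : 0 ≤ lam) :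
    ENNReal.ofReal p * ∫⁻ s in Set.Ioi 0,
        (ENNReal.ofReal (κ * (s ^ e * T s ^ d)) * ENNReal.ofReal (euclProfile n (distrib u s)) +
          ENNReal.ofReal (lam * s ^ (p - 1)) * ENNReal.ofReal (((n : ℝ) - 1) * distrib u s))
      ≤ ∫⁻ x, ENNReal.ofReal (((1 - ‖x‖ ^ 2) / 2 * ‖fderiv ℝ u x‖) ^ p) ∂hypVol n +
        ENNReal.ofReal (p - 1) * ∫⁻ x, ENNReal.ofReal ((κ * (|u x| ^ e * T |u x| ^ d)) ^ q +
          (lam * |u x| ^ (p - 1)) ^ q) ∂hypVol n := by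
  set H : ℝ → ℝ → ℝ := fun t τ =>
    ((κ * (t ^ e * τ ^ d)) ^ q + (lam * t ^ (p - 1)) ^ q) ^ (1 / q) with hH
  have hq0 : 0 < q := hpq.symm.pos
  have hp1 : 0 < p - 1 := hpq.sub_one_pos
  have hHmono : ∀ t t' τ τ', 0 ≤ t → t ≤ t' → 0 ≤ τ → τ ≤ τ' → H t τ ≤ H t' τ' := by
    intro t t' τ τ' h1 h2 h3 h4
    simp only [hH]
    have h5 : 0 ≤ t' := h1.trans h2
    gcongr
  have hTm : Measurable T := hT.measurable
  have hhm : Measurable fun s => ENNReal.ofReal (H s (T s)) := by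
    simp only [hH]
    fun_prop
  have hbd : ∀ R : ℝ, ∃ Λ : ENNReal, Λ ≠ ⊤ ∧ ∀ s, 0 ≤ s → s ≤ R → ENNReal.ofReal (H s (T s)) ≤ Λ :=
    fun R => ⟨ENNReal.ofReal (H R (T 0)), ENNReal.ofReal_ne_top, fun s hs hsR =>
      ENNReal.ofReal_le_ofReal (hHmono _ _ _ _ hs hsR (hT0 s) (hT hs))⟩
  have husc : ∀ s, 0 ≤ s → ∀ b, ENNReal.ofReal (H s (T s)) < b →
      ∀ᶠ t in 𝓝[≥] s, ENNReal.ofReal (H t (T t)) < b := by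
    intro s hs b hb
    have hc : Continuous fun t => ENNReal.ofReal (H t (T s)) := by
      refine ENNReal.continuous_ofReal.comp ?_
      simp only [hH]
      refine Continuous.rpow_const (Continuous.add ?_ ?_) fun _ => Or.inr (by positivity)
      · exact (continuous_const.mul ((Real.continuous_rpow_const he.le).mul
          continuous_const)).rpow_const fun _ => Or.inr hq0.le
      · exact (continuous_const.mul (Real.continuous_rpow_const hp1.le)).rpow_const
          fun _ => Or.inr hq0.le
    filter_upwards [nhdsWithin_le_nhds ((hc.tendsto s).eventually_lt_const hb),
      self_mem_nhdsWithin] with t ht hst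
    have hst : s ≤ t := hst
    exact (ENNReal.ofReal_le_ofReal
      (hHmono _ _ _ _ (hs.trans hst) le_rfl (hT0 t) (hT hst))).trans_lt ht
  have hK := lintegral_isoProfile_distrib_le hn hp hu hsupp hhm hbd husc
  have hn' : (2 : ℝ) ≤ n := by exact_mod_cast hn
  have hL : ∫⁻ s in Set.Ioi 0,
      (ENNReal.ofReal (κ * (s ^ e * T s ^ d)) * ENNReal.ofReal (euclProfile n (distrib u s)) +
        ENNReal.ofReal (lam * s ^ (p - 1)) * ENNReal.ofReal (((n : ℝ) - 1) * distrib u s))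
      ≤ ∫⁻ s in Set.Ioi 0, ENNReal.ofReal (H s (T s)) *
        ENNReal.ofReal (isoProfile n p (distrib u s)) := by
    refine setLIntegral_mono' measurableSet_Ioi fun s hs => ?_
    have hs : 0 < s := hs
    have hv : 0 ≤ distrib u s := ENNReal.toReal_nonneg
    have hTs := hT0 s
    have ha := euclProfile_nonneg n hv
    have hb : 0 ≤ ((n : ℝ) - 1) * distrib u s := mul_nonneg (by linarith) hv
    rw [← ENNReal.ofReal_mul (by positivity), ← ENNReal.ofReal_mul (by positivity),
      ← ENNReal.ofReal_add (by positivity) (by positivity), ← ENNReal.ofReal_mul (by positivity)]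
    exact ENNReal.ofReal_le_ofReal
      (mul_add_mul_le_rpow_mul_rpow hpq ha hb (by positivity) (by positivity))
  refine (mul_le_mul_right (hL.trans hK) _).trans ?_
  have huc : Continuous fun x => |u x| := hu.continuous.abs
  have hfm : Measurable fun x => (κ * (|u x| ^ e * T |u x| ^ d)) ^ q +
      (lam * |u x| ^ (p - 1)) ^ q := by
    have h1 : Measurable fun x => |u x| := huc.measurable
    have h2 : Measurable fun x => T |u x| := hTm.comp h1
    fun_prop
  rw [← lintegral_const_mul' _ _ ENNReal.ofReal_ne_top,
    ← lintegral_const_mul' _ _ ENNReal.ofReal_ne_top,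
    ← lintegral_add_right _ (hfm.ennreal_ofReal.const_mul _)]
  refine lintegral_mono fun x => ?_
  have hTs := hT0 |u x|
  exact ofReal_mul_mul_le_young hpq (by positivity)

end DualPairing

section DualOptimization

open Filter Topology

variable {n : ℕ} {u : EuclideanSpace ℝ (Fin n) → ℝ}

lemma optimal_scale_eq {p q A D : ℝ} (hpq : p.HolderConjugate q) (hA : 0 < A) (hD : 0 < D) :
    p * ((A / D) ^ (p - 1) * A) - (p - 1) * (((A / D) ^ (p - 1)) ^ q * D)
      = A ^ p * D ^ (1 - p) := by
  have h0 : 0 < A / D := div_pos hA hD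
  have h1 : ((A / D) ^ (p - 1)) ^ q = A ^ p / D ^ p := by
    rw [← Real.rpow_mul h0.le, hpq.sub_one_mul_conj, Real.div_rpow hA.le hD.le]
  have h2 : (A / D) ^ (p - 1) = A ^ p / A / (D ^ p / D) := by
    rw [Real.div_rpow hA.le hD.le, Real.rpow_sub_one hA.ne', Real.rpow_sub_one hD.ne']
  have h3 : D ^ (1 - p) = D / D ^ p := by rw [Real.rpow_sub hD, Real.rpow_one]
  have h4 : 0 < D ^ p := Real.rpow_pos_of_pos hD _
  rw [h1, h2, h3]
  field_simp
  ring

lemma setLIntegral_Ioo_ofReal_const_mul {f : ℝ → ℝ} (hf : Continuous f) (hf0 : ∀ v, 0 ≤ f v)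
    {c L : ℝ} (hc : 0 ≤ c) (hL : 0 ≤ L) :
    ∫⁻ v in Set.Ioo 0 L, ENNReal.ofReal (c * f v)
      = ENNReal.ofReal (c * ∫ v in (0 : ℝ)..L, f v) := by
  have hi : IntervalIntegrable (fun v => c * f v) volume 0 L :=
    (continuous_const.mul hf).intervalIntegrable 0 L
  rw [← ofReal_integral_eq_lintegral_ofReal (hi.1.mono_set Set.Ioo_subset_Ioc_self)
    (ae_of_all _ fun v => mul_nonneg hc (hf0 v)),
    ← integral_Ioc_eq_integral_Ioo, ← intervalIntegral.integral_of_le hL,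
    intervalIntegral.integral_const_mul]

/-- The Poincaré–Sobolev inequality with the constant produced by a trial density `g` on
`(0, L)`. -/
lemma sobolev_of_trial_density (hn : 2 ≤ n) {p q : ℝ} (hpq : p.HolderConjugate q)
    (hp : 2 * (n : ℝ) / ((n : ℝ) - 1) ≤ p) (hpn : p < n) (hu : ContDiff ℝ (⊤ : ℕ∞) u)
    (hsupp : tsupport u ⊆ Metric.ball 0 1) {W M E : ℝ} (hW0 : 0 ≤ W) (hM0 : 0 < M) (hE0 : 0 ≤ E)
    (hW : ∫⁻ x, ENNReal.ofReal (|u x| ^ p) ∂hypVol n = ENNReal.ofReal W)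
    (hM : ∫⁻ x, ENNReal.ofReal (|u x| ^ ((n : ℝ) * p / ((n : ℝ) - p))) ∂hypVol n
      = ENNReal.ofReal M)
    (hE : ∫⁻ x, ENNReal.ofReal (((1 - ‖x‖ ^ 2) / 2 * ‖fderiv ℝ u x‖) ^ p) ∂hypVol n
      = ENNReal.ofReal E) {g : ℝ → ℝ} (hg : Continuous g) (hg0 : ∀ v, 0 < g v) {L : ℝ}
    (hL : 0 < L) :
    (n * unitBallVol n ^ (1 / (n : ℝ)) * ((n - p) / (p * (n - 1))) *
        ∫ v in (0 : ℝ)..L, g v ^ (1 - 1 / (n : ℝ))) ^ p *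
      (∫ v in (0 : ℝ)..L, |v| ^ (q / n) * g v) ^ (1 - p) *
      (M / ∫ v in (0 : ℝ)..L, g v) ^ (1 - p / n) + ((n - 1) / p) ^ p * W ≤ E := by
  have hn' : (2 : ℝ) ≤ n := by exact_mod_cast hn
  have hp0 : 0 < p := hpq.pos
  have hq0 : 0 < q := hpq.symm.pos
  have hp1 : 0 < p - 1 := hpq.sub_one_pos
  have hnp : 0 < (n : ℝ) - p := by linarith
  set r : ℝ := (n : ℝ) * p / ((n : ℝ) - p) with hr
  have hr0 : 0 < r := by positivity
  set θ : ℝ := 1 - 1 / (n : ℝ) with hθ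
  have hθ1 : θ < 1 := by
    have : (0 : ℝ) < 1 / (n : ℝ) := by positivity
    linarith
  have hθ0 : 0 < θ := by
    have : 1 / (n : ℝ) < 1 := by rw [div_lt_one (by linarith)]; linarith
    linarith
  have hrθ : r * θ = p * (n - 1) / (n - p) := by
    rw [hr, hθ]
    field_simp
  have hrθq : (r * θ - 1) * q = r := by
    rw [hrθ, hpq.conjugate_eq, hr]
    field_simp
    ring
  have he0 : 0 < r * θ - 1 := by
    by_contra! h
    nlinarith
  set I0 := ∫ v in (0 : ℝ)..L, g v with hI0
  set I1 := ∫ v in (0 : ℝ)..L, |v| ^ (q / n) * g v with hI1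
  set I2 := ∫ v in (0 : ℝ)..L, g v ^ θ with hI2
  have hgθ : Continuous fun v => g v ^ θ := hg.rpow_const fun v => Or.inl (hg0 v).ne'
  have hg1 : Continuous fun v : ℝ => |v| ^ (q / n) * g v :=
    (continuous_abs.rpow_const fun _ => Or.inr (by positivity)).mul hg
  have hI0p : 0 < I0 :=
    intervalIntegral.intervalIntegral_pos_of_pos (hg.intervalIntegrable 0 L) hg0 hL
  have hI1p : 0 < I1 := intervalIntegral.intervalIntegral_pos_of_pos_on
    (hg1.intervalIntegrable 0 L)
    (fun v hv => mul_pos (Real.rpow_pos_of_pos (abs_pos.2 hv.1.ne') _) (hg0 v)) hL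
  have hI2p : 0 < I2 := intervalIntegral.intervalIntegral_pos_of_pos (hgθ.intervalIntegrable 0 L)
    (fun v => Real.rpow_pos_of_pos (hg0 v) _) hL
  set c := M / I0 with hc
  have hc0 : 0 < c := div_pos hM0 hI0p
  have hσ := unitBallVol_pos n
  set β : ℝ := n * unitBallVol n ^ (1 / (n : ℝ)) with hβ
  have hβ0 : 0 < β := by positivity
  set A : ℝ := β * (r * θ)⁻¹ * (c ^ θ * I2) with hA
  have hA0 : 0 < A := by positivity
  set D : ℝ := c * I1 with hD
  have hD0 : 0 < D := by positivity
  set κ : ℝ := (A / D) ^ (p - 1) with hκ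
  have hκ0 : 0 < κ := by positivity
  set lam : ℝ := ((n - 1) / p) ^ (p - 1) with hlam
  have hn1 : (0 : ℝ) < n - 1 := by linarith
  have hlam0 : 0 < lam := by positivity
  have hcs := hasCompactSupport_of_tsupport_subset_ball hsupp
  obtain ⟨B, hB⟩ := hcs.exists_bound_of_continuous hu.continuous
  have huc : Continuous fun x => |u x| := hu.continuous.abs
  obtain ⟨T, hT, hTL, hT1, hT2⟩ := exists_level_profile (μ := hypVol n) huc.measurable
    (fun x => abs_nonneg _) hB hr0 (G := fun v => c * g v) (continuous_const.mul hg)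
    (fun v => mul_pos hc0 (hg0 v)) hL (by
      rw [hM, intervalIntegral.integral_const_mul, ← hI0, hc, div_mul_cancel₀ _ hI0p.ne'])
  have hT0 : ∀ s, 0 ≤ T s := fun s => (hTL s).1
  have hpair := lintegral_pairing_le hn hpq hp hu hsupp hT hT0 hκ0.le he0
    (by positivity : (0 : ℝ) < 1 / n) hlam0.le
  have hTm : Measurable T := hT.measurable
  have hleft1 : ENNReal.ofReal (κ * A) ≤ ∫⁻ s in Set.Ioi 0,
      ENNReal.ofReal (κ * (s ^ (r * θ - 1) * T s ^ (1 / (n : ℝ)))) *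
        ENNReal.ofReal (euclProfile n (distrib u s)) := by
    have h1 : ∫⁻ v in Set.Ioo 0 L, ENNReal.ofReal ((c * g v) ^ θ)
        = ENNReal.ofReal (c ^ θ * I2) := by
      rw [hI2, ← setLIntegral_Ioo_ofReal_const_mul hgθ
        (fun v => Real.rpow_nonneg (hg0 v).le _) (by positivity) hL.le]
      exact lintegral_congr fun v => by rw [Real.mul_rpow hc0.le (hg0 v).le]
    have h2 := hT2 θ hθ0 hθ1
    rw [h1, ← ENNReal.ofReal_mul (by positivity)] at h2
    have h3 : κ * A = κ * β * ((r * θ)⁻¹ * (c ^ θ * I2)) := by rw [hA]; ring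
    rw [h3, ENNReal.ofReal_mul (by positivity)]
    refine (mul_le_mul_right h2 _).trans ?_
    rw [← lintegral_const_mul' _ _ ENNReal.ofReal_ne_top]
    refine setLIntegral_mono' measurableSet_Ioi fun s hs => le_of_eq ?_
    have hs : 0 < s := hs
    have hTs := hT0 s
    have hv : 0 ≤ distrib u s := ENNReal.toReal_nonneg
    have h4 : hypVol n {x | s < |u x|} = ENNReal.ofReal (distrib u s) :=
      (ENNReal.ofReal_toReal (hypVol_superlevel_lt_top hsupp hs.le).ne).symm
    rw [h4, ENNReal.ofReal_rpow_of_nonneg hv hθ0.le,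
      ENNReal.ofReal_rpow_of_nonneg hTs (by linarith), ← ENNReal.ofReal_mul (by positivity),
      ← ENNReal.ofReal_mul (by positivity), ← ENNReal.ofReal_mul (by positivity),
      ← ENNReal.ofReal_mul (by positivity)]
    congr 1
    have h5 : 1 - θ = 1 / (n : ℝ) := by rw [hθ]; ring
    rw [h5, euclProfile, ← hβ, ← hθ]
    ring
  have hleft2 : ENNReal.ofReal (lam * (n - 1) * W / p) = ∫⁻ s in Set.Ioi 0,
      ENNReal.ofReal (lam * s ^ (p - 1)) * ENNReal.ofReal (((n : ℝ) - 1) * distrib u s) := by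
    have h1 := lintegral_rpow_eq_lintegral_meas_lt_mul (μ := hypVol n) (f := fun x => |u x|)
      (ae_of_all _ fun x => abs_nonneg _) huc.measurable.aemeasurable hp0
    rw [hW] at h1
    have h2 : lam * (n - 1) * W / p = (lam * (n - 1) / p) * W := by ring
    rw [h2, ENNReal.ofReal_mul (by positivity), h1, ← mul_assoc,
      ← ENNReal.ofReal_mul (by positivity),
      div_mul_cancel₀ _ hp0.ne', ← lintegral_const_mul' _ _ ENNReal.ofReal_ne_top]
    refine setLIntegral_congr_fun measurableSet_Ioi fun s hs => ?_
    have hs : 0 < s := hs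
    have h4 : hypVol n {x | s < |u x|} = ENNReal.ofReal (distrib u s) :=
      (ENNReal.ofReal_toReal (hypVol_superlevel_lt_top hsupp hs.le).ne).symm
    rw [h4, ENNReal.ofReal_mul hlam0.le, ENNReal.ofReal_mul hlam0.le, ENNReal.ofReal_mul hn1.le]
    ring
  have hright : ∫⁻ x, ENNReal.ofReal ((κ * (|u x| ^ (r * θ - 1) * T |u x| ^ (1 / (n : ℝ)))) ^ q +
      (lam * |u x| ^ (p - 1)) ^ q) ∂hypVol n ≤ ENNReal.ofReal (κ ^ q * D + lam ^ q * W) := by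
    have h1 : ∀ x, ENNReal.ofReal ((κ * (|u x| ^ (r * θ - 1) * T |u x| ^ (1 / (n : ℝ)))) ^ q +
        (lam * |u x| ^ (p - 1)) ^ q)
        = ENNReal.ofReal (κ ^ q) * ENNReal.ofReal (|u x| ^ r * T |u x| ^ (q / n)) +
          ENNReal.ofReal (lam ^ q) * ENNReal.ofReal (|u x| ^ p) := by
      intro x
      have hTx := hT0 |u x|
      have hux := abs_nonneg (u x)
      rw [← ENNReal.ofReal_mul (by positivity), ← ENNReal.ofReal_mul (by positivity),
        ← ENNReal.ofReal_add (by positivity) (by positivity),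
        Real.mul_rpow hκ0.le (by positivity), Real.mul_rpow (by positivity) (by positivity),
        Real.mul_rpow hlam0.le (by positivity), ← Real.rpow_mul hux, ← Real.rpow_mul hTx,
        ← Real.rpow_mul hux, hrθq, hpq.sub_one_mul_conj, one_div_mul_eq_div]
    have hm2 : Measurable fun x => ENNReal.ofReal (lam ^ q) * ENNReal.ofReal (|u x| ^ p) :=
      ((huc.measurable.pow_const p).ennreal_ofReal).const_mul _
    simp_rw [h1]
    rw [lintegral_add_right _ hm2, lintegral_const_mul' _ _ ENNReal.ofReal_ne_top,
      lintegral_const_mul' _ _ ENNReal.ofReal_ne_top, hW,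
      ENNReal.ofReal_add (by positivity) (by positivity), ENNReal.ofReal_mul (by positivity),
      ENNReal.ofReal_mul (p := lam ^ q) (by positivity)]
    gcongr
    refine (hT1 (q / n) (by positivity)).trans (le_of_eq ?_)
    rw [hD, hI1, ← setLIntegral_Ioo_ofReal_const_mul hg1
      (fun v => mul_nonneg (Real.rpow_nonneg (abs_nonneg v) _) (hg0 v).le) hc0.le hL.le]
    refine setLIntegral_congr_fun measurableSet_Ioo fun v hv => ?_
    rw [abs_of_pos hv.1]
    congr 1
    ring
  have hm2 : Measurable fun s => ENNReal.ofReal (lam * s ^ (p - 1)) *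
      ENNReal.ofReal (((n : ℝ) - 1) * distrib u s) := by
    have := measurable_distrib u
    fun_prop
  rw [lintegral_add_right _ hm2, hE, ← hleft2] at hpair
  have hfin := (mul_le_mul_right (add_le_add_left hleft1 _) (ENNReal.ofReal p)).trans
    (hpair.trans (add_le_add_right (mul_le_mul_right hright _) _))
  rw [← ENNReal.ofReal_add (by positivity) (by positivity), ← ENNReal.ofReal_mul hp0.le,
    ← ENNReal.ofReal_mul hp1.le, ← ENNReal.ofReal_add hE0 (by positivity),
    ENNReal.ofReal_le_ofReal_iff (by positivity)] at hfin
  have hopt := optimal_scale_eq hpq hA0 hD0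
  rw [← hκ] at hopt
  have hlamq : lam ^ q = ((n - 1) / p) ^ p := by
    rw [hlam, ← Real.rpow_mul (by positivity), hpq.sub_one_mul_conj]
  have hlamn : lam * (n - 1) = p * ((n - 1) / p) ^ p := by
    rw [hlam, Real.rpow_sub_one (by positivity)]
    field_simp
  have hAD : A ^ p * D ^ (1 - p)
      = (β * ((n - p) / (p * (n - 1))) * I2) ^ p * I1 ^ (1 - p) * c ^ (1 - p / n) := by
    have h1 : (r * θ)⁻¹ = (n - p) / (p * (n - 1)) := by rw [hrθ, inv_div]
    have h2 : A = (β * ((n - p) / (p * (n - 1))) * I2) * c ^ θ := by rw [hA, h1]; ring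
    have h3 : c ^ (1 - p / n) = (c ^ θ) ^ p * c ^ (1 - p) := by
      rw [← Real.rpow_mul hc0.le, ← Real.rpow_add hc0]
      congr 1
      rw [hθ]
      ring
    rw [h2, hD, Real.mul_rpow (by positivity) (by positivity), Real.mul_rpow hc0.le hI1p.le, h3]
    ring
  rw [← hAD, ← hopt]
  rw [hlamn, hlamq] at hfin
  have h6 : p * (κ * A + p * ((n - 1) / p) ^ p * W / p)
      = p * (κ * A) + p * (((n - 1) / p) ^ p * W) := by
    field_simp
  rw [h6] at hfin
  linarith

end DualOptimization

section SharpConstant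

open Filter Topology

lemma lintegral_rpow_mul_one_add_rpow {a k m : ℝ} (ha : 0 < a) (hm : -1 < m)
    (hk : (m + 1) / a < k) :
    ∫⁻ v in Set.Ioi (0 : ℝ), ENNReal.ofReal (v ^ m * (1 + v ^ a) ^ (-k))
      = ENNReal.ofReal (1 / a * Gamma ((m + 1) / a) * Gamma (k - (m + 1) / a) / Gamma k) := by
  have hc : 0 < (m + 1) / a := div_pos (by linarith) ha
  have hk0 : 0 < k := hc.trans hk
  have hΓ := Gamma_pos_of_pos hk0
  have hΓ1 := Gamma_pos_of_pos hc
  have hΓ2 : 0 < Gamma (k - (m + 1) / a) := Gamma_pos_of_pos (by linarith)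
  have gamma_lint : ∀ {s r : ℝ}, 0 < s → 0 < r →
      ∫⁻ t in Set.Ioi (0 : ℝ), ENNReal.ofReal (t ^ (s - 1) * exp (-(r * t)))
        = ENNReal.ofReal ((1 / r) ^ s * Gamma s) := by
    intro s r hs hr
    have h := Real.integral_rpow_mul_exp_neg_mul_Ioi hs hr
    rw [← h, ofReal_integral_eq_lintegral_ofReal]
    · refine Integrable.of_integral_ne_zero ?_
      rw [h]
      have := Gamma_pos_of_pos hs
      positivity
    · refine (ae_restrict_iff' measurableSet_Ioi).2 (ae_of_all _ fun t (ht : 0 < t) => ?_)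
      change 0 ≤ t ^ (s - 1) * exp (-(r * t))
      positivity
  have power_lint : ∀ {t : ℝ}, 0 < t →
      ∫⁻ v in Set.Ioi (0 : ℝ), ENNReal.ofReal (v ^ m * exp (-t * v ^ a))
        = ENNReal.ofReal (t ^ (-(m + 1) / a) * (1 / a) * Gamma ((m + 1) / a)) := by
    intro t ht
    rw [← integral_rpow_mul_exp_neg_mul_rpow ha hm ht, ofReal_integral_eq_lintegral_ofReal]
    · exact integrableOn_rpow_mul_exp_neg_mul_rpow hm ha ht
    · refine (ae_restrict_iff' measurableSet_Ioi).2 (ae_of_all _ fun v (hv : 0 < v) => ?_)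
      change 0 ≤ v ^ m * exp (-t * v ^ a)
      positivity
  have hswap : ENNReal.ofReal (Gamma k) *
      ∫⁻ v in Set.Ioi (0 : ℝ), ENNReal.ofReal (v ^ m * (1 + v ^ a) ^ (-k))
      = ENNReal.ofReal (1 / a * Gamma ((m + 1) / a)) *
        ENNReal.ofReal ((1 / 1) ^ (k - (m + 1) / a) * Gamma (k - (m + 1) / a)) := by
    rw [← gamma_lint (by linarith) one_pos, ← lintegral_const_mul' _ _ ENNReal.ofReal_ne_top,
      ← lintegral_const_mul' _ _ ENNReal.ofReal_ne_top]
    calc _ = ∫⁻ v in Set.Ioi (0 : ℝ), ∫⁻ t in Set.Ioi (0 : ℝ),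
          ENNReal.ofReal (v ^ m * (t ^ (k - 1) * exp (-((1 + v ^ a) * t)))) := by
          refine setLIntegral_congr_fun measurableSet_Ioi fun v (hv : 0 < v) => ?_
          have hv1 : 0 < 1 + v ^ a := by positivity
          simp only [ENNReal.ofReal_mul (show 0 ≤ v ^ m by positivity)]
          rw [lintegral_const_mul' _ _ ENNReal.ofReal_ne_top, gamma_lint hk0 hv1,
            one_div, Real.inv_rpow hv1.le, ← Real.rpow_neg hv1.le, mul_left_comm,
            ← ENNReal.ofReal_mul hΓ.le, mul_comm (Gamma k)]
      _ = ∫⁻ t in Set.Ioi (0 : ℝ), ∫⁻ v in Set.Ioi (0 : ℝ),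
          ENNReal.ofReal (v ^ m * (t ^ (k - 1) * exp (-((1 + v ^ a) * t)))) := by
          refine lintegral_lintegral_swap (Measurable.aemeasurable ?_)
          exact Measurable.ennreal_ofReal (by fun_prop)
      _ = _ := by
          refine setLIntegral_congr_fun measurableSet_Ioi fun t (ht : 0 < t) => ?_
          have h0 : 0 ≤ t ^ (k - 1) * exp (-t) := by positivity
          have h1 : ∀ v : ℝ, ENNReal.ofReal (v ^ m * (t ^ (k - 1) * exp (-((1 + v ^ a) * t))))
              = ENNReal.ofReal (t ^ (k - 1) * exp (-t)) *
                ENNReal.ofReal (v ^ m * exp (-t * v ^ a)) := by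
            intro v
            rw [← ENNReal.ofReal_mul h0, show -((1 + v ^ a) * t) = -t + -t * v ^ a by ring,
              Real.exp_add]
            ring_nf
          simp only [h1]
          rw [lintegral_const_mul' _ _ ENNReal.ofReal_ne_top, power_lint ht,
            ← ENNReal.ofReal_mul h0, ← ENNReal.ofReal_mul (by positivity),
            show k - (m + 1) / a - 1 = k - 1 + -(m + 1) / a by ring, Real.rpow_add ht]
          ring_nf
  rw [div_one, Real.one_rpow, one_mul, ← ENNReal.ofReal_mul (by positivity)] at hswap
  rw [ENNReal.ofReal_div_of_pos hΓ, ← hswap, mul_comm, ENNReal.mul_div_cancel_right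
    (ENNReal.ofReal_pos.2 hΓ).ne' ENNReal.ofReal_ne_top]

lemma tendsto_intervalIntegral_rpow_mul_one_add_rpow {a k m : ℝ} (ha : 0 < a) (hm : -1 < m)
    (hk : (m + 1) / a < k) :
    Tendsto (fun L : ℝ => ∫ v in (0 : ℝ)..L, |v| ^ m * (1 + |v| ^ a) ^ (-k)) atTop
      (𝓝 (1 / a * Gamma ((m + 1) / a) * Gamma (k - (m + 1) / a) / Gamma k)) := by
  have hc : 0 < (m + 1) / a := div_pos (by linarith) ha
  have hΓ := Gamma_pos_of_pos (hc.trans hk)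
  have hΓ1 := Gamma_pos_of_pos hc
  have hΓ2 : 0 < Gamma (k - (m + 1) / a) := Gamma_pos_of_pos (by linarith)
  have hmeas : Measurable fun v : ℝ => |v| ^ m * (1 + |v| ^ a) ^ (-k) := by fun_prop
  have h0 : ∀ v : ℝ, 0 ≤ |v| ^ m * (1 + |v| ^ a) ^ (-k) := fun v => by positivity
  have hl : ∫⁻ v in Set.Ioi (0 : ℝ), ENNReal.ofReal (|v| ^ m * (1 + |v| ^ a) ^ (-k))
      = ENNReal.ofReal (1 / a * Gamma ((m + 1) / a) * Gamma (k - (m + 1) / a) / Gamma k) := by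
    rw [← lintegral_rpow_mul_one_add_rpow ha hm hk]
    refine setLIntegral_congr_fun measurableSet_Ioi fun v (hv : 0 < v) => ?_
    simp only [abs_of_pos hv]
  have hint : IntegrableOn (fun v : ℝ => |v| ^ m * (1 + |v| ^ a) ^ (-k)) (Set.Ioi 0) := by
    refine (lintegral_ofReal_ne_top_iff_integrable hmeas.aestronglyMeasurable
      (ae_of_all _ h0)).1 ?_
    rw [hl]
    exact ENNReal.ofReal_ne_top
  have hval : ∫ v in Set.Ioi (0 : ℝ), |v| ^ m * (1 + |v| ^ a) ^ (-k)
      = 1 / a * Gamma ((m + 1) / a) * Gamma (k - (m + 1) / a) / Gamma k := by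
    rw [integral_eq_lintegral_of_nonneg_ae (ae_of_all _ h0) hmeas.aestronglyMeasurable, hl,
      ENNReal.toReal_ofReal (by positivity)]
  rw [← hval]
  exact intervalIntegral_tendsto_integral_Ioi 0 hint tendsto_id

lemma sobolevConst_rpow_eq {n : ℕ} (hn : 2 ≤ n) {p q : ℝ} (hpq : p.HolderConjugate q)
    (hpn : p < n) {I M : ℝ} (hM : 0 ≤ M)
    (hI : I = Gamma ((n : ℝ) / p) * Gamma ((n : ℝ) + 1 - (n : ℝ) / p) / Gamma n) :
    (n * unitBallVol n ^ (1 / (n : ℝ)) * ((n - p) / (p * (n - 1))) *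
        (I * ((n - 1) / (n / p - 1)))) ^ p *
      (I * (n / q / (n / p - 1))) ^ (1 - p) * (M / I) ^ (1 - p / n)
      = sobolevConst n p ^ p * M ^ (1 - p / n) := by
  have hn' : (2 : ℝ) ≤ n := by exact_mod_cast hn
  have hn0 : (0 : ℝ) < n := by linarith
  have hp0 : 0 < p := hpq.pos
  have hq0 : 0 < q := hpq.symm.pos
  have hp1 : 0 < p - 1 := hpq.sub_one_pos
  have hnp : 0 < (n : ℝ) - p := by linarith
  have hσ := unitBallVol_pos n
  have hnp1 : (n : ℝ) / p < n := by rw [div_lt_iff₀ hp0]; nlinarith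
  have hΓ : 0 < Gamma (n : ℝ) := Gamma_pos_of_pos hn0
  have hΓ1 : 0 < Gamma ((n : ℝ) / p) := Gamma_pos_of_pos (by positivity)
  have hΓ2 : 0 < Gamma ((n : ℝ) + 1 - (n : ℝ) / p) := Gamma_pos_of_pos (by linarith)
  have hI0 : 0 < I := by rw [hI]; positivity
  set X : ℝ := (n : ℝ) * (p - 1) / ((n : ℝ) - p) with hX
  have hX0 : 0 < X := by positivity
  have h1 : (n : ℝ) * unitBallVol n ^ (1 / (n : ℝ)) * ((n - p) / (p * (n - 1))) *
      (I * ((n - 1) / (n / p - 1))) = n * unitBallVol n ^ (1 / (n : ℝ)) * I := by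
    have : (n : ℝ) - 1 ≠ 0 := by linarith
    have : (n : ℝ) / p - 1 = (n - p) / p := by field_simp
    rw [this]
    field_simp
  have h2 : (n : ℝ) / q / (n / p - 1) = X := by
    have h3 : (n : ℝ) / p - 1 = (n - p) / p := by field_simp
    rw [h3, hX, hpq.conjugate_eq]
    field_simp
  have hS : sobolevConst n p
      = n * unitBallVol n ^ (1 / (n : ℝ)) * (X ^ (-(1 - 1 / p)) * I ^ (1 / (n : ℝ))) := by
    have h3 : Gamma (n : ℝ) / (Gamma ((n : ℝ) / p) * Gamma ((n : ℝ) + 1 - (n : ℝ) / p) *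
        unitBallVol n) = (unitBallVol n * I)⁻¹ := by
      rw [hI]
      field_simp
    rw [sobolevConst, h3, ← hX, Real.inv_rpow (by positivity), Real.mul_rpow hσ.le hI0.le,
      Real.rpow_neg hX0.le]
    field_simp
  rw [h1, h2, hS]
  have hσn : 0 < (n : ℝ) * unitBallVol n ^ (1 / (n : ℝ)) := by positivity
  rw [Real.mul_rpow hσn.le hI0.le, Real.mul_rpow hσn.le (by positivity),
    Real.mul_rpow (x := X ^ (-(1 - 1 / p))) (by positivity) (by positivity),
    Real.mul_rpow hI0.le hX0.le,
    Real.div_rpow hM hI0.le, ← Real.rpow_mul hX0.le, ← Real.rpow_mul hI0.le,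
    show -(1 - 1 / p) * p = 1 - p by field_simp; ring,
    show 1 / (n : ℝ) * p = p + (1 - p) - (1 - p / n) by ring,
    Real.rpow_sub hI0 (p + (1 - p)), Real.rpow_add hI0]
  ring

/-- The Poincaré–Sobolev inequality for functions with nonzero critical norm. -/
lemma sobolev_of_pos {n : ℕ} {u : EuclideanSpace ℝ (Fin n) → ℝ} (hn : 2 ≤ n) {p : ℝ}
    (hp : 2 * (n : ℝ) / ((n : ℝ) - 1) ≤ p) (hpn : p < n) (hu : ContDiff ℝ (⊤ : ℕ∞) u)
    (hsupp : tsupport u ⊆ Metric.ball 0 1) {W M E : ℝ} (hW0 : 0 ≤ W) (hM0 : 0 < M) (hE0 : 0 ≤ E)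
    (hW : ∫⁻ x, ENNReal.ofReal (|u x| ^ p) ∂hypVol n = ENNReal.ofReal W)
    (hM : ∫⁻ x, ENNReal.ofReal (|u x| ^ ((n : ℝ) * p / ((n : ℝ) - p))) ∂hypVol n
      = ENNReal.ofReal M)
    (hE : ∫⁻ x, ENNReal.ofReal (((1 - ‖x‖ ^ 2) / 2 * ‖fderiv ℝ u x‖) ^ p) ∂hypVol n
      = ENNReal.ofReal E) :
    sobolevConst n p ^ p * M ^ (1 - p / n) + ((n - 1) / p) ^ p * W ≤ E := by
  have hn' : (2 : ℝ) ≤ n := by exact_mod_cast hn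
  have hn0 : (0 : ℝ) < n := by linarith
  have hp1 : 1 < p := by
    refine lt_of_lt_of_le ?_ hp
    rw [lt_div_iff₀ (by linarith)]
    linarith
  have hpq := Real.HolderConjugate.conjExponent hp1
  set q : ℝ := p.conjExponent
  have hp0 : 0 < p := hpq.pos
  have hq0 : 0 < q := hpq.symm.pos
  set a : ℝ := q / n with ha
  have ha0 : 0 < a := by positivity
  have hb : 1 / a = n - n / p := by
    rw [ha, one_div_div]
    have := hpq.inv_add_inv_eq_one
    field_simp at this ⊢
    linarith
  have hnp : 1 < (n : ℝ) / p := by rw [lt_div_iff₀ hp0]; linarith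
  have ha1 : (a + 1) / a = 1 + 1 / a := by field_simp
  have hΓs : Gamma ((n : ℝ) / p) = (n / p - 1) * Gamma (n / p - 1) := by
    rw [← Gamma_add_one (by linarith)]
    congr 1
    ring
  have hΓn : Gamma (n : ℝ) = (n - 1) * Gamma (n - 1) := by
    rw [← Gamma_add_one (by linarith)]
    congr 1
    ring
  have hΓb : Gamma ((n : ℝ) + 1 - n / p) = 1 / a * Gamma (1 / a) := by
    rw [← Gamma_add_one (by positivity), hb]
    congr 1
    ring
  have hΓ1 : 0 < Gamma ((n : ℝ) - 1) := Gamma_pos_of_pos (by linarith)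
  have hΓ2 : 0 < Gamma ((n : ℝ) / p - 1) := Gamma_pos_of_pos (by linarith)
  have hΓ3 : 0 < Gamma (1 / a) := Gamma_pos_of_pos (by positivity)
  have hn1 : 0 < (n : ℝ) - 1 := by linarith
  have hs : 0 < (n : ℝ) / p - 1 := by linarith
  have hnp0 : (n : ℝ) - p ≠ 0 := by linarith
  set I : ℝ := Gamma ((n : ℝ) / p) * Gamma ((n : ℝ) + 1 - (n : ℝ) / p) / Gamma n with hI
  have hI0 : 0 < I := by rw [hI, hΓs, hΓn, hΓb]; positivity
  set g : ℝ → ℝ := fun v => (1 + |v| ^ a) ^ (-(n : ℝ)) with hg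
  have hpos : ∀ v : ℝ, 0 < 1 + |v| ^ a := fun v => by positivity
  have t0 : Tendsto (fun L : ℝ => ∫ v in (0 : ℝ)..L, g v) atTop (𝓝 I) := by
    have h := tendsto_intervalIntegral_rpow_mul_one_add_rpow (a := a) (k := n) (m := 0) ha0
      (by norm_num) (by rw [zero_add, hb]; linarith)
    simp only [Real.rpow_zero, one_mul, zero_add] at h
    convert h using 2
    rw [hI, hΓb, hb, sub_sub_cancel]
    ring
  have t1 : Tendsto (fun L : ℝ => ∫ v in (0 : ℝ)..L, |v| ^ a * g v) atTop
      (𝓝 (I * (n / q / (n / p - 1)))) := by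
    have h := tendsto_intervalIntegral_rpow_mul_one_add_rpow (a := a) (k := n) (m := a) ha0
      (by linarith) (by rw [ha1, hb]; linarith)
    convert h using 2
    rw [ha1, add_comm 1 (1 / a), Gamma_add_one (by positivity),
      show (n : ℝ) - (1 / a + 1) = n / p - 1 by rw [hb]; ring, hI, hΓb, hΓs,
      show (n : ℝ) / q = 1 / a by rw [ha, one_div_div]]
    field_simp
  have t2 : Tendsto (fun L : ℝ => ∫ v in (0 : ℝ)..L, g v ^ (1 - 1 / (n : ℝ))) atTop
      (𝓝 (I * ((n - 1) / (n / p - 1)))) := by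
    have h := tendsto_intervalIntegral_rpow_mul_one_add_rpow (a := a) (k := n - 1) (m := 0) ha0
      (by norm_num) (by rw [zero_add, hb]; linarith)
    simp only [Real.rpow_zero, one_mul, zero_add] at h
    have hgk : ∀ v, g v ^ (1 - 1 / (n : ℝ)) = (1 + |v| ^ a) ^ (-((n : ℝ) - 1)) := by
      intro v
      rw [hg, ← Real.rpow_mul (hpos v).le]
      congr 1
      field_simp
    simp only [hgk]
    convert h using 2
    rw [hI, hΓb, hΓs, hΓn, show (n : ℝ) - 1 - 1 / a = n / p - 1 by rw [hb]; ring]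
    field_simp
  rw [← sobolevConst_rpow_eq hn hpq hpn hM0.le hI]
  have hIq : 0 < I * (n / q / (n / p - 1)) := by positivity
  refine le_of_tendsto (Tendsto.add_const _ (((t2.const_mul _).rpow_const (Or.inr hp0.le)).mul
    (t1.rpow_const (Or.inl hIq.ne')) |>.mul
    ((tendsto_const_nhds.div t0 hI0.ne').rpow_const (Or.inl (by positivity)))))
    ((eventually_gt_atTop 0).mono fun L hL =>
      sobolev_of_trial_density hn hpq hp hpn hu hsupp hW0 hM0 hE0 hW hM hE ?_ ?_ hL)
  · exact (continuous_const.add (continuous_abs.rpow_const fun _ => Or.inr ha0.le)).rpow_const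
      fun v => Or.inl (hpos v).ne'
  · exact fun v => Real.rpow_pos_of_pos (hpos v) _

end SharpConstant

section BochnerIntegrals

variable {n : ℕ}

lemma lintegral_hypVol_eq_ofReal_integral {f : EuclideanSpace ℝ (Fin n) → ℝ} (hf : Continuous f)
    (hf0 : ∀ x ∈ Metric.ball (0 : EuclideanSpace ℝ (Fin n)) 1, 0 ≤ f x)
    {K : Set (EuclideanSpace ℝ (Fin n))} (hK : IsCompact K) (hK1 : K ⊆ Metric.ball 0 1)
    (hfK : ∀ x ∉ K, f x = 0) :
    ∫⁻ x, ENNReal.ofReal (f x) ∂hypVol n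
      = ENNReal.ofReal (∫ x in Metric.ball 0 1, f x * (2 / (1 - ‖x‖ ^ 2)) ^ (n : ℝ)) := by
  obtain ⟨ρ, -, hρ1, hKρ⟩ := exists_subset_closedBall hK hK1
  obtain ⟨C, hC⟩ := hK.exists_bound_of_continuousOn hf.continuousOn
  have hfin : ∫⁻ x, ENNReal.ofReal (f x) ∂hypVol n ≠ ⊤ := by
    refine ne_top_of_le_ne_top (ENNReal.mul_ne_top (ENNReal.ofReal_ne_top (r := C))
      (hypVol_closedBall_lt_top (n := n) hρ1).ne) ?_
    rw [← lintegral_indicator_const measurableSet_closedBall]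
    refine lintegral_mono fun x => ?_
    by_cases hx : x ∈ K
    · rw [Set.indicator_of_mem (hKρ hx)]
      exact ENNReal.ofReal_le_ofReal ((le_abs_self _).trans (hC x hx))
    · simp [hfK x hx]
  have hd : ∀ x ∈ Metric.ball (0 : EuclideanSpace ℝ (Fin n)) 1, 0 < 2 / (1 - ‖x‖ ^ 2) := by
    intro x hx
    have hx1 : ‖x‖ < 1 := mem_ball_zero_iff.1 hx
    have : 0 < 1 - ‖x‖ ^ 2 := by nlinarith [norm_nonneg x]
    positivity
  have heq : ∫⁻ x, ENNReal.ofReal (f x) ∂hypVol n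
      = ∫⁻ x in Metric.ball 0 1, ENNReal.ofReal (f x * (2 / (1 - ‖x‖ ^ 2)) ^ (n : ℝ)) := by
    rw [lintegral_hypVol _ hf.measurable.ennreal_ofReal]
    refine setLIntegral_congr_fun measurableSet_ball fun x hx => ?_
    simp only [Real.rpow_natCast]
    rw [mul_comm, ← ENNReal.ofReal_mul (hf0 x hx)]
  rw [heq] at hfin ⊢
  have hfm := hf.measurable
  rw [integral_eq_lintegral_of_nonneg_ae, ENNReal.ofReal_toReal hfin]
  · refine (ae_restrict_iff' measurableSet_ball).2 (ae_of_all _ fun x hx => ?_)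
    exact mul_nonneg (hf0 x hx) (Real.rpow_nonneg (hd x hx).le _)
  · exact Measurable.aestronglyMeasurable (by fun_prop)

lemma setIntegral_mul_density_nonneg {f : EuclideanSpace ℝ (Fin n) → ℝ}
    (hf0 : ∀ x ∈ Metric.ball (0 : EuclideanSpace ℝ (Fin n)) 1, 0 ≤ f x) :
    0 ≤ ∫ x in Metric.ball 0 1, f x * (2 / (1 - ‖x‖ ^ 2)) ^ (n : ℝ) := by
  refine setIntegral_nonneg measurableSet_ball fun x hx => mul_nonneg (hf0 x hx) ?_
  have hx1 : ‖x‖ < 1 := mem_ball_zero_iff.1 hx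
  have : 0 < 1 - ‖x‖ ^ 2 := by nlinarith [norm_nonneg x]
  positivity

end BochnerIntegrals

/-- The Poincaré–Sobolev inequality in the Poincaré ball model of `ℍⁿ`. -/
theorem poincare_sobolev_hyperbolic (n : ℕ) (hn : 4 ≤ n) (p : ℝ)
    (hp1 : 2 * (n : ℝ) / ((n : ℝ) - 1) ≤ p) (hp2 : p < n)
    (u : EuclideanSpace ℝ (Fin n) → ℝ) (hu : ContDiff ℝ (⊤ : ℕ∞) u)
    (hsupp : tsupport u ⊆ Metric.ball (0 : EuclideanSpace ℝ (Fin n)) 1) :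
    (∫ x in Metric.ball (0 : EuclideanSpace ℝ (Fin n)) 1,
        ((1 - ‖x‖ ^ 2) / 2) ^ p * ‖fderiv ℝ u x‖ ^ p * (2 / (1 - ‖x‖ ^ 2)) ^ (n : ℝ))
      - (((n : ℝ) - 1) / p) ^ p *
        ∫ x in Metric.ball (0 : EuclideanSpace ℝ (Fin n)) 1,
          |u x| ^ p * (2 / (1 - ‖x‖ ^ 2)) ^ (n : ℝ)
      ≥ sobolevConst n p ^ p *
        (∫ x in Metric.ball (0 : EuclideanSpace ℝ (Fin n)) 1,
            |u x| ^ ((n : ℝ) * p / ((n : ℝ) - p)) * (2 / (1 - ‖x‖ ^ 2)) ^ (n : ℝ)) ^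
          (((n : ℝ) - p) / (n : ℝ)) := by
  have hn' : (4 : ℝ) ≤ n := by exact_mod_cast hn
  have hp0 : 0 < p := lt_of_lt_of_le (div_pos (by linarith) (by linarith)) hp1
  have hnp : 0 < (n : ℝ) - p := by linarith
  have hr0 : 0 < (n : ℝ) * p / (n - p) := by positivity
  have hcpt : IsCompact (tsupport u) := hasCompactSupport_of_tsupport_subset_ball hsupp
  have hpow : ∀ {r : ℝ}, 0 < r →
      ∫⁻ x, ENNReal.ofReal (|u x| ^ r) ∂hypVol n
        = ENNReal.ofReal (∫ x in Metric.ball (0 : EuclideanSpace ℝ (Fin n)) 1,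
          |u x| ^ r * (2 / (1 - ‖x‖ ^ 2)) ^ (n : ℝ)) := fun {r} hr => by
    refine lintegral_hypVol_eq_ofReal_integral
      (hu.continuous.abs.rpow_const fun _ => Or.inr hr.le) (fun x _ => by positivity) hcpt hsupp ?_
    intro x hx
    rw [image_eq_zero_of_notMem_tsupport hx, abs_zero, Real.zero_rpow hr.ne']
  have hgrad : ∫⁻ x, ENNReal.ofReal (((1 - ‖x‖ ^ 2) / 2 * ‖fderiv ℝ u x‖) ^ p) ∂hypVol n
      = ENNReal.ofReal (∫ x in Metric.ball (0 : EuclideanSpace ℝ (Fin n)) 1,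
        ((1 - ‖x‖ ^ 2) / 2 * ‖fderiv ℝ u x‖) ^ p * (2 / (1 - ‖x‖ ^ 2)) ^ (n : ℝ)) := by
    have hDu : Continuous (fderiv ℝ u) := hu.continuous_fderiv (by simp)
    refine lintegral_hypVol_eq_ofReal_integral
      (Continuous.rpow_const (by fun_prop) fun _ => Or.inr hp0.le) ?_ hcpt hsupp ?_
    · intro x hx
      have hx1 : ‖x‖ < 1 := mem_ball_zero_iff.1 hx
      have : 0 < 1 - ‖x‖ ^ 2 := by nlinarith [norm_nonneg x]
      positivity
    · intro x hx
      have hx' : fderiv ℝ u x = 0 :=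
        image_eq_zero_of_notMem_tsupport fun h => hx (tsupport_fderiv_subset ℝ h)
      rw [hx', norm_zero, mul_zero, Real.zero_rpow hp0.ne']
  have hsplit : ∫ x in Metric.ball (0 : EuclideanSpace ℝ (Fin n)) 1,
        ((1 - ‖x‖ ^ 2) / 2) ^ p * ‖fderiv ℝ u x‖ ^ p * (2 / (1 - ‖x‖ ^ 2)) ^ (n : ℝ)
      = ∫ x in Metric.ball (0 : EuclideanSpace ℝ (Fin n)) 1,
        ((1 - ‖x‖ ^ 2) / 2 * ‖fderiv ℝ u x‖) ^ p * (2 / (1 - ‖x‖ ^ 2)) ^ (n : ℝ) := by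
    refine setIntegral_congr_fun measurableSet_ball fun x hx => ?_
    have hx1 : ‖x‖ < 1 := mem_ball_zero_iff.1 hx
    have : 0 ≤ (1 - ‖x‖ ^ 2) / 2 := by nlinarith [norm_nonneg x]
    simp only [Real.mul_rpow this (norm_nonneg _)]
  have hW := hpow hp0
  have hM := hpow hr0
  rw [hsplit, show ((n : ℝ) - p) / n = 1 - p / n by field_simp, ge_iff_le, le_sub_iff_add_le]
  have hW0 : 0 ≤ ∫ x in Metric.ball (0 : EuclideanSpace ℝ (Fin n)) 1,
      |u x| ^ p * (2 / (1 - ‖x‖ ^ 2)) ^ (n : ℝ) :=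
    setIntegral_mul_density_nonneg fun x _ => by positivity
  have hM0 : 0 ≤ ∫ x in Metric.ball (0 : EuclideanSpace ℝ (Fin n)) 1,
      |u x| ^ ((n : ℝ) * p / (n - p)) * (2 / (1 - ‖x‖ ^ 2)) ^ (n : ℝ) :=
    setIntegral_mul_density_nonneg fun x _ => by positivity
  have hE0 : 0 ≤ ∫ x in Metric.ball (0 : EuclideanSpace ℝ (Fin n)) 1,
      ((1 - ‖x‖ ^ 2) / 2 * ‖fderiv ℝ u x‖) ^ p * (2 / (1 - ‖x‖ ^ 2)) ^ (n : ℝ) := by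
    refine setIntegral_mul_density_nonneg fun x hx => ?_
    have hx1 : ‖x‖ < 1 := mem_ball_zero_iff.1 hx
    have : 0 < 1 - ‖x‖ ^ 2 := by nlinarith [norm_nonneg x]
    positivity
  rcases hM0.lt_or_eq with hpos | hzero
  · exact sobolev_of_pos (by omega) hp1 hp2 hu hsupp hW0 hpos hE0 hW hM hgrad
  · have hum := hu.continuous.measurable
    rw [← hzero, ENNReal.ofReal_zero,
      lintegral_eq_zero_iff (Measurable.ennreal_ofReal (by fun_prop))] at hM
    have hWz : ∫⁻ x, ENNReal.ofReal (|u x| ^ p) ∂hypVol n = 0 := by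
      refine (lintegral_eq_zero_iff (Measurable.ennreal_ofReal (by fun_prop))).2 ?_
      filter_upwards [hM] with x hx
      have hx' : |u x| ^ ((n : ℝ) * p / (n - p)) = 0 :=
        le_antisymm (ENNReal.ofReal_eq_zero.1 hx) (by positivity)
      rw [(Real.rpow_eq_zero (abs_nonneg _) hr0.ne').1 hx', Real.zero_rpow hp0.ne']
      simp
    have hWv := le_antisymm (ENNReal.ofReal_eq_zero.1 (hW.symm.trans hWz)) hW0
    have hexp : 1 - p / (n : ℝ) ≠ 0 := by
      rw [one_sub_div (by linarith)]
      positivity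
    rw [← hzero, hWv, Real.zero_rpow hexp, mul_zero, mul_zero, add_zero]
    exact hE0
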